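/- Fix θ > 0, integers 1 ≤ m ≤ N−1, a ∈ 𝒫_N, and real numbers y_1 > y_2 > ⋯ > y_m > y > 0 with min_{1≤i≤m−1}(y_i − y_{i+1}) > y. Then 𝓑_a(−y_1, …, −y_m; N; θ) · 𝓑_a(−y; N; θ) = ( Γ(Nθ) / (Γ((N−m)θ) Γ(θ)^m) ) · ( ∏_{1≤i<j≤m} (y_i − y_j)^{1−2θ} / ( y^{mθ} (y_1 ⋯ y_m)^θ ) ) · ∫_{V_y} G_{θ,y_1,…,y_m,y}(z_1,…,z_m) · F_{y_1,…,y_m,y}(z_1,…,z_m)^{θ(N−m)−1} · 𝓑_a( −(y_1+z_1), …, −(y_m+z_m), −y+(z_1+⋯+z_m); N; θ ) ∏_{i=1}^m z_i^{θ−1} dz_i, where V_y := {(z_1,…,z_m) ∈ ℝ^m : z_1,…,z_m ≥ 0 and z_1 + ⋯ + z_m ≤ y}, and, setting y_{m+1} := y − (z_1+⋯+z_m) and z_{m+1} := 0, G_{θ,y_1,…,y_m,y}(z) := ∏_{1≤i<j≤m} (y_i − y_j + z_i)^{θ−1} · ∏_{1≤i<j≤m+1} (y_i − y_j + z_i − z_j)(y_i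 − y_j − z_j)^{θ−1}, and F_{y_1,…,y_m,y}(z) := (1 − (z_1+⋯+z_m)/y) ∏_{i=1}^m (1 + z_i/y_i). -/

import Mathlib

open MeasureTheory Filter Topology
open scoped ENNReal

noncomputable section

/-- A triangular array with `M` levels: for `k : Fin M`, level `k+1` has `k+1` real entries. -/
abbrev Tri (M : ℕ) := ∀ k : Fin M, Fin (k.1 + 1) → ℝ

/-- `Interlaces u v` means `u ≺ v`, i.e. `v 1 > u 1 > v 2 > u 2 > ⋯ > v n > u n > v (n+1)`. -/
def Interlaces {n : ℕ} (u : Fin n → ℝ) (v : Fin (n + 1) → ℝ) : Prop :=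
  ∀ i : Fin n, u i < v i.castSucc ∧ v i.succ < u i

/-- Level `k+1` (for `k < N`) of the configuration consisting of the triangular array `x`
(levels `1, …, N-1`) together with the top level `a` (level `N`). -/
def lvl {N : ℕ} (a : Fin N → ℝ) (x : Tri (N - 1)) (k : ℕ) (hk : k < N) :
    Fin (k + 1) → ℝ :=
  if h : k < N - 1 then fun i => x ⟨k, h⟩ i
  else fun i => a ⟨i.1, by have := i.isLt; omega⟩

/-- The (unnormalized) density of the orbital beta process with top level `a`. -/
def obpWt (θ : ℝ) {N : ℕ} (a : Fin N → ℝ) (x : Tri (N - 1)) : ℝ :=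
  ∏ k : Fin (N - 1),
    ((∏ i : Fin (k.1 + 1), ∏ j : Fin (k.1 + 1),
        if i < j then |x k i - x k j| ^ (2 - 2 * θ) else 1) *
      ∏ s : Fin (k.1 + 2), ∏ r : Fin (k.1 + 1),
        |lvl a x (k.1 + 1) (by have := k.isLt; omega) s - x k r| ^ (θ - 1))

/-- The interlacing scheme `𝒫(a)`: arrays `(a⁽¹⁾ ≺ a⁽²⁾ ≺ ⋯ ≺ a⁽ᴺ⁻¹⁾ ≺ a)`. -/
def obpDomain {N : ℕ} (a : Fin N → ℝ) : Set (Tri (N - 1)) :=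
  {x | ∀ k : Fin (N - 1),
      Interlaces (x k) (lvl a x (k.1 + 1) (by have := k.isLt; omega))}

/-- The orbital beta process `𝕄^{a,θ}` with top level `a`. -/
def obp (θ : ℝ) {N : ℕ} (a : Fin N → ℝ) : Measure (Tri (N - 1)) :=
  (ENNReal.ofReal (∫ x in obpDomain a, obpWt θ a x))⁻¹ •
    volume.withDensity fun x =>
      ENNReal.ofReal ((obpDomain a).indicator (obpWt θ a) x)

/-- The Weyl chamber `𝒲_m = {x : x 0 ≥ x 1 ≥ ⋯}`. -/
def weylChamber (m : ℕ) : Set (Fin m → ℝ) :=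
  {x | ∀ i j : Fin m, i ≤ j → x j ≤ x i}

/-- The (unnormalized) density of the Gaussian beta ensemble. -/
def gbeWt (θ : ℝ) (m : ℕ) (x : Fin m → ℝ) : ℝ :=
  (∏ i : Fin m, ∏ j : Fin m, if i < j then |x i - x j| ^ (2 * θ) else 1) *
    Real.exp (-(θ / 2) * ∑ i, x i ^ 2)

/-- The Gaussian beta ensemble `𝕄^{(θ)}_m` of rank `m`. -/
def gbe (θ : ℝ) (m : ℕ) : Measure (Fin m → ℝ) :=
  (ENNReal.ofReal (∫ x in weylChamber m, gbeWt θ m x))⁻¹ •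
    volume.withDensity fun x =>
      ENNReal.ofReal ((weylChamber m).indicator (gbeWt θ m) x)

/-- The empirical measure `μ_N = (1/N) ∑ δ_{a_i/N}`. -/
def empMeasure {N : ℕ} (a : Fin N → ℝ) : Measure ℝ :=
  ((N : ℝ≥0∞))⁻¹ • ∑ i : Fin N, Measure.dirac (a i / N)

/-- The mean `𝔼[ν]` of a measure on `ℝ`. -/
def meanM (ν : Measure ℝ) : ℝ := ∫ t, t ∂ν

/-- The variance `Var[ν]` of a measure on `ℝ`. -/
def varM (ν : Measure ℝ) : ℝ := (∫ t, t ^ 2 ∂ν) - meanM ν ^ 2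

/-- A regular sequence of ordered tuples with limiting measure `μ`. -/
def RegularSeq (a : (N : ℕ) → Fin N → ℝ) (μ : Measure ℝ) : Prop :=
  (∀ N : ℕ, 1 ≤ N → StrictAnti (a N)) ∧
  (∃ C : ℝ, ∀ N : ℕ, ∀ hN : 1 ≤ N,
      |a N ⟨0, by omega⟩| ≤ C * N ∧ |a N ⟨N - 1, by omega⟩| ≤ C * N) ∧
  IsProbabilityMeasure μ ∧
  (∃ R : ℝ, μ {t : ℝ | |t| ≤ R}ᶜ = 0) ∧
  ∀ f : BoundedContinuousFunction ℝ ℝ,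
    Tendsto (fun N : ℕ => ∫ t, f t ∂empMeasure (a N)) atTop (𝓝 (∫ t, f t ∂μ))

/-- Projection of a triangular array (with top level of size `N`) to its `m`-th level. -/
def levelProj {N : ℕ} (m : ℕ) (h1 : 1 ≤ m) (h2 : m < N) (x : Tri (N - 1)) :
    Fin m → ℝ :=
  fun i => x ⟨m - 1, by omega⟩ ⟨i.1, (by have := i.isLt; omega : i.1 < m - 1 + 1)⟩

/-- Projection of a triangular array to its bottom `m` levels. -/
def triProj {N : ℕ} (m : ℕ) (h : m < N) (x : Tri (N - 1)) : Tri m :=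
  fun k i => x ⟨k.1, by have := k.isLt; omega⟩ ⟨i.1, i.isLt⟩

/-- The top level of a triangular array with `m` levels. -/
def topLvl {m : ℕ} (hm : 1 ≤ m) (x : Tri m) : Fin m → ℝ :=
  fun i => x ⟨m - 1, by omega⟩ ⟨i.1, (by have := i.isLt; omega : i.1 < m - 1 + 1)⟩

/-- The Gelfand–Tsetlin polytope `𝒲_{m,corners}` (weak interlacing). -/
def gtPoly (m : ℕ) : Set (Tri m) :=
  {x | ∀ k : Fin m, ∀ hk : k.1 + 1 < m, ∀ i : Fin (k.1 + 1),
      x k i ≤ x ⟨k.1 + 1, hk⟩ i.castSucc ∧ x ⟨k.1 + 1, hk⟩ i.succ ≤ x k i}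

/-- Unnormalized density of the Gaussian beta corners process with `m` levels. -/
def gbcWt (θ : ℝ) {m : ℕ} (hm : 1 ≤ m) (x : Tri m) : ℝ :=
  (∏ i : Fin m, ∏ j : Fin m,
      if i < j then topLvl hm x i - topLvl hm x j else 1) *
    Real.exp (-(θ / 2) * ∑ i, topLvl hm x i ^ 2) *
    ∏ k : Fin (m - 1),
      ((∏ i : Fin (k.1 + 1), ∏ j : Fin (k.1 + 1),
          if i < j then
            |x ⟨k.1, by have := k.isLt; omega⟩ i -
              x ⟨k.1, by have := k.isLt; omega⟩ j| ^ (2 - 2 * θ)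
          else 1) *
        ∏ i : Fin (k.1 + 1), ∏ j : Fin (k.1 + 2),
          |x ⟨k.1, by have := k.isLt; omega⟩ i -
            x ⟨k.1 + 1, by have := k.isLt; omega⟩ j| ^ (θ - 1))

/-- The Gaussian beta corners process `𝕄^{(θ)}_{m,corners}`. -/
def gbc (θ : ℝ) {m : ℕ} (hm : 1 ≤ m) : Measure (Tri m) :=
  (ENNReal.ofReal (∫ x in gtPoly m, gbcWt θ hm x))⁻¹ •
    volume.withDensity fun x =>
      ENNReal.ofReal ((gtPoly m).indicator (gbcWt θ hm) x)

/-- Strict interlacing domain `x⁽¹⁾ ≺ x⁽²⁾ ≺ ⋯ ≺ x⁽ᵐ⁾` inside `Tri m`. -/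
def triDomain (m : ℕ) : Set (Tri m) :=
  {x | ∀ k : Fin m, ∀ hk : k.1 + 1 < m, Interlaces (x k) (x ⟨k.1 + 1, hk⟩)}

/-- The θ-Gibbs conditional density of the bottom `n` levels given level `n+1`. -/
def gibbsWt (θ : ℝ) (n : ℕ) (x : Tri (n + 1)) : ℝ :=
  ((∏ k : Fin (n + 1), Real.Gamma ((k.1 + 1) * θ)) /
      Real.Gamma θ ^ ((n + 1) * (n + 2) / 2)) *
    (∏ i : Fin (n + 1), ∏ j : Fin (n + 1),
      if i < j then
        (x ⟨n, Nat.lt_succ_self n⟩ i - x ⟨n, Nat.lt_succ_self n⟩ j) ^ (1 - 2 * θ)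
      else 1) *
    ∏ k : Fin n,
      ((∏ i : Fin (k.1 + 1), ∏ j : Fin (k.1 + 1),
          if i < j then
            (x ⟨k.1, by have := k.isLt; omega⟩ i -
              x ⟨k.1, by have := k.isLt; omega⟩ j) ^ (2 - 2 * θ)
          else 1) *
        ∏ i : Fin (k.1 + 1), ∏ j : Fin (k.1 + 2),
          |x ⟨k.1, by have := k.isLt; omega⟩ i -
            x ⟨k.1 + 1, by have := k.isLt; omega⟩ j| ^ (θ - 1))

/-- `|a⁽ᵏ⁾|`, the sum of the entries of level `k` (with `a⁽⁰⁾ := 0` and `a⁽ᴺ⁾ := a`). -/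
def sumLvl {N : ℕ} (a : Fin N → ℝ) (x : Tri (N - 1)) (k : ℕ) : ℝ :=
  if k = 0 then 0
  else if h : k - 1 < N - 1 then ∑ i, x ⟨k - 1, h⟩ i
  else ∑ i, a i

/-- The multivariate Bessel function `𝓑_a(y; θ)`, defined through its combinatorial
integral representation over the interlacing scheme with top level `a`. -/
def MBF (θ : ℝ) {N : ℕ} (a : Fin N → ℝ) (y : Fin N → ℂ) : ℂ :=
  ((((∏ k : Fin N, Real.Gamma ((k.1 + 1) * θ)) /
        Real.Gamma θ ^ (N * (N + 1) / 2)) : ℝ) : ℂ) *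
    (((∏ i : Fin N, ∏ j : Fin N,
        if i < j then |a i - a j| ^ (1 - 2 * θ) else 1) : ℝ) : ℂ) *
    ∫ x in obpDomain a,
      Complex.exp (∑ k : Fin N,
        y k * ((sumLvl a x (k.1 + 1) - sumLvl a x k.1 : ℝ) : ℂ)) *
      ((obpWt θ a x : ℝ) : ℂ)

/-- Padding of an `m`-tuple with `N - m` zeros: `(y_1, …, y_m, 0^{N-m})`. -/
def padC {m N : ℕ} (_h : m ≤ N) (y : Fin m → ℂ) : Fin N → ℂ :=
  fun k => if h' : k.1 < m then y ⟨k.1, h'⟩ else 0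

/-- Integrand `exp(yz) ∏ (z - a_i)^{-θ}` of the left-directed contour integral,
with `w^{-θ} := exp(-θ Log w)` for the principal branch `Log`. -/
def contourFnL (θ : ℝ) {N : ℕ} (a : Fin N → ℝ) (y z : ℂ) : ℂ :=
  Complex.exp (y * z) *
    ∏ i : Fin N, Complex.exp (-(θ : ℂ) * Complex.log (z - (a i : ℂ)))

/-- Integrand `exp(-yz) ∏ (a_i - z)^{-θ}` of the right-directed contour integral. -/
def contourFnR (θ : ℝ) {N : ℕ} (a : Fin N → ℝ) (y z : ℂ) : ℂ :=
  Complex.exp (-y * z) *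
    ∏ i : Fin N, Complex.exp (-(θ : ℂ) * Complex.log ((a i : ℂ) - z))

/-- `(y_1, …, y_m, y_{m+1})` with `y_{m+1} := y - (z_1 + ⋯ + z_m)`. -/
def Yext {m : ℕ} (ys : Fin m → ℝ) (y : ℝ) (z : Fin m → ℝ) : Fin (m + 1) → ℝ :=
  fun j => if h : j.1 < m then ys ⟨j.1, h⟩ else y - ∑ i, z i

/-- `(z_1, …, z_m, z_{m+1})` with `z_{m+1} := 0`. -/
def Zext {m : ℕ} (z : Fin m → ℝ) : Fin (m + 1) → ℝ :=
  fun j => if h : j.1 < m then z ⟨j.1, h⟩ else 0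

/-- The function `G_{θ, y_1, …, y_m, y}(z_1, …, z_m)`. -/
def Gfn (θ : ℝ) {m : ℕ} (ys : Fin m → ℝ) (y : ℝ) (z : Fin m → ℝ) : ℝ :=
  (∏ i : Fin m, ∏ j : Fin m,
      if i < j then (ys i - ys j + z i) ^ (θ - 1) else 1) *
    ∏ i : Fin (m + 1), ∏ j : Fin (m + 1),
      if i < j then
        (Yext ys y z i - Yext ys y z j + Zext z i - Zext z j) *
          (Yext ys y z i - Yext ys y z j - Zext z j) ^ (θ - 1)
      else 1

/-- The function `F_{y_1, …, y_m, y}(z_1, …, z_m)`. -/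
def Ffn {m : ℕ} (ys : Fin m → ℝ) (y : ℝ) (z : Fin m → ℝ) : ℝ :=
  (1 - (∑ i, z i) / y) * ∏ i, (1 + z i / ys i)

set_option linter.unusedSectionVars false

namespace MBFPieri

open MvPolynomial

section Dunkl

variable {σ : Type*} [DecidableEq σ]

/-- The action of a transposition on polynomials. -/
def tr (i j : σ) : MvPolynomial σ ℝ →ₐ[ℝ] MvPolynomial σ ℝ := rename (Equiv.swap i j)

theorem tr_X (i j k : σ) : tr i j (X k) = X (Equiv.swap i j k) := by simp [tr]

theorem tr_self (i : σ) (f : MvPolynomial σ ℝ) : tr i i f = f := by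
  simp [tr]

theorem tr_tr (i j : σ) (f : MvPolynomial σ ℝ) : tr i j (tr i j f) = f := by
  rw [tr, rename_rename]; convert rename_id_apply f; ext k; simp

theorem tr_comm (i j : σ) : tr i j = tr j i := by rw [tr, Equiv.swap_comm]; rfl

theorem rename_tr (τ : Equiv.Perm σ) (i j : σ) (f : MvPolynomial σ ℝ) :
    rename τ (tr i j f) = tr (τ i) (τ j) (rename τ f) := by
  rw [tr, tr, rename_rename, rename_rename]; congr 1; congr 1
  ext k; simp [Equiv.swap_apply_def]; split_ifs <;> simp_all

theorem sub_dvd_sub_tr (i j : σ) (f : MvPolynomial σ ℝ) :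
    (X i - X j : MvPolynomial σ ℝ) ∣ f - tr i j f := by
  induction f using MvPolynomial.induction_on with
  | C a => simp [tr]
  | add p q hp hq =>
    rw [map_add]; convert dvd_add hp hq using 1; ring
  | mul_X p k hp =>
    rw [map_mul, tr_X]
    have : p * X k - tr i j p * X (Equiv.swap i j k)
      = (p - tr i j p) * X k + tr i j p * (X k - X (Equiv.swap i j k)) := by ring
    rw [this]
    refine dvd_add (hp.mul_right _) (Dvd.dvd.mul_left ?_ _)
    rcases eq_or_ne k i with rfl | h1
    · simp
    rcases eq_or_ne k j with rfl | h2
    · simp only [Equiv.swap_apply_right]; exact ⟨-1, by ring⟩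
    · rw [Equiv.swap_apply_of_ne_of_ne h1 h2]; simp

theorem X_sub_X_ne_zero {σ : Type*} {i j : σ} (h : i ≠ j) : (X i - X j : MvPolynomial σ ℝ) ≠ 0 :=
  sub_ne_zero.mpr fun e => h (X_injective e)

/-- The divided difference `(f - s_{ij} f) / (X_i - X_j)`. -/
def ddFun (i j : σ) (f : MvPolynomial σ ℝ) : MvPolynomial σ ℝ :=
  if i = j then 0 else (sub_dvd_sub_tr i j f).choose

theorem mul_ddFun (i j : σ) (f : MvPolynomial σ ℝ) :
    (X i - X j) * ddFun i j f = f - tr i j f := by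
  rw [ddFun]
  split_ifs with h
  · subst h; simp [tr_self]
  · exact (sub_dvd_sub_tr i j f).choose_spec.symm

theorem ddFun_unique {i j : σ} (h : i ≠ j) {f g : MvPolynomial σ ℝ}
    (e : (X i - X j) * g = f - tr i j f) : ddFun i j f = g :=
  mul_left_cancel₀ (X_sub_X_ne_zero h) ((mul_ddFun i j f).trans e.symm)

/-- The divided difference as a linear map. -/
def dd (i j : σ) : MvPolynomial σ ℝ →ₗ[ℝ] MvPolynomial σ ℝ where
  toFun := ddFun i j
  map_add' f g := by
    rcases eq_or_ne i j with h | h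
    · simp [ddFun, h]
    · apply ddFun_unique h; rw [mul_add, mul_ddFun, mul_ddFun, map_add]; ring
  map_smul' c f := by
    rcases eq_or_ne i j with h | h
    · simp [ddFun, h]
    · apply ddFun_unique h
      simp only [RingHom.id_apply, mul_smul_comm, mul_ddFun, map_smul, smul_sub]

theorem mul_dd (i j : σ) (f : MvPolynomial σ ℝ) :
    (X i - X j) * dd i j f = f - tr i j f := mul_ddFun i j f

theorem dd_unique {i j : σ} (h : i ≠ j) {f g : MvPolynomial σ ℝ}
    (e : (X i - X j) * g = f - tr i j f) : dd i j f = g := ddFun_unique h e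

theorem dd_self (i : σ) (f : MvPolynomial σ ℝ) : dd i i f = 0 := by simp [dd, ddFun]

theorem dd_mul (i j : σ) (f g : MvPolynomial σ ℝ) :
    dd i j (f * g) = f * dd i j g + dd i j f * tr i j g := by
  rcases eq_or_ne i j with rfl | h
  · simp [dd_self]
  · apply dd_unique h
    have h1 := mul_dd i j f
    have h2 := mul_dd i j g
    rw [map_mul]
    linear_combination f * h2 + tr i j g * h1

theorem dd_eq_zero {i j : σ} {f : MvPolynomial σ ℝ} (hf : tr i j f = f) : dd i j f = 0 := by
  rcases eq_or_ne i j with rfl | h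
  · simp [dd_self]
  · apply dd_unique h; simp [hf]

theorem dd_one (i j : σ) : dd i j (1 : MvPolynomial σ ℝ) = 0 := dd_eq_zero (by simp)

theorem dd_C (i j : σ) (a : ℝ) : dd i j (C a : MvPolynomial σ ℝ) = 0 :=
  dd_eq_zero (by simp [tr])

theorem dd_X (i j k : σ) : dd i j (X k : MvPolynomial σ ℝ)
    = (if k = i then 1 else 0) - (if k = j then 1 else 0) := by
  rcases eq_or_ne i j with rfl | h
  · simp [dd_self]
  · apply dd_unique h
    rw [tr_X]
    rcases eq_or_ne k i with rfl | h1
    · simp [h]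
    rcases eq_or_ne k j with rfl | h2
    · simp only [Equiv.swap_apply_right, if_neg h1]; simp
    · rw [Equiv.swap_apply_of_ne_of_ne h1 h2]; simp [h1, h2]

theorem rename_dd (τ : Equiv.Perm σ) (i j : σ) (f : MvPolynomial σ ℝ) :
    rename τ (dd i j f) = dd (τ i) (τ j) (rename τ f) := by
  rcases eq_or_ne i j with rfl | h
  · simp [dd_self]
  · symm
    apply dd_unique (τ.injective.ne h)
    rw [← rename_tr, ← map_sub, ← mul_dd]; simp

variable [Fintype σ]

/-- A multiplicity function for the Dunkl operators: symmetric, and invariant under all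
reflections with nonzero multiplicity. -/
structure IsMult (c : σ → σ → ℝ) : Prop where
  symm : ∀ i j, c i j = c j i
  inv : ∀ i j, c i j ≠ 0 → ∀ k l, c (Equiv.swap i j k) (Equiv.swap i j l) = c k l

/-- The Dunkl operator. -/
def dunkl (c : σ → σ → ℝ) (i : σ) : Module.End ℝ (MvPolynomial σ ℝ) :=
  (pderiv i).toLinearMap + ∑ j, c i j • dd i j

theorem dunkl_apply (c : σ → σ → ℝ) (i : σ) (f : MvPolynomial σ ℝ) :
    dunkl c i f = pderiv i f + ∑ j, c i j • dd i j f := by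
  simp [dunkl, LinearMap.sum_apply]

theorem dunkl_one (c : σ → σ → ℝ) (i : σ) : dunkl c i 1 = 0 := by
  simp [dunkl_apply, dd_one]

theorem dunkl_C (c : σ → σ → ℝ) (i : σ) (a : ℝ) : dunkl c i (C a) = 0 := by
  simp [dunkl_apply, dd_C]

/-- The commutator of the Dunkl operator with multiplication by a variable. -/
def dE (c : σ → σ → ℝ) (i k : σ) (f : MvPolynomial σ ℝ) : MvPolynomial σ ℝ :=
  (if i = k then f + ∑ l, c i l • tr i l f else 0) - c i k • tr i k f

theorem dunkl_X_mul (c : σ → σ → ℝ) (i k : σ) (f : MvPolynomial σ ℝ) :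
    dunkl c i (X k * f) = X k * dunkl c i f + dE c i k f := by
  simp only [dunkl_apply, dd_mul, dd_X, Derivation.leibniz, pderiv_X, smul_eq_mul, dE,
    smul_add, Finset.sum_add_distrib, sub_mul, smul_sub, Finset.sum_sub_distrib]
  rcases eq_or_ne i k with rfl | h
  · simp [mul_add, Finset.mul_sum, add_assoc]
    abel
  · simp [h, Ne.symm h, mul_add, Finset.mul_sum, sub_eq_add_neg, add_assoc]

theorem rename_dunkl {c : σ → σ → ℝ} (τ : Equiv.Perm σ) (hτ : ∀ k l, c (τ k) (τ l) = c k l)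
    (i : σ) (f : MvPolynomial σ ℝ) :
    rename τ (dunkl c i f) = dunkl c (τ i) (rename τ f) := by
  rw [dunkl_apply, dunkl_apply, map_add, map_sum]
  congr 1
  · rw [pderiv_rename τ.injective]
  · rw [← Equiv.sum_comp τ (fun j => c (τ i) j • dd (τ i) j (rename τ f))]
    refine Finset.sum_congr rfl fun j _ => ?_
    rw [map_smul, rename_dd, hτ]

theorem smul_tr_dunkl {c : σ → σ → ℝ} (hc : IsMult c) (j k i : σ) (f : MvPolynomial σ ℝ) :
    c j k • tr j k (dunkl c i f) = c j k • dunkl c (Equiv.swap j k i) (tr j k f) := by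
  rcases eq_or_ne (c j k) 0 with h | h
  · simp [h]
  · rw [tr, rename_dunkl _ (hc.inv j k h)]

theorem dE_dunkl_self {c : σ → σ → ℝ} (hc : IsMult c) {i j : σ} (hij : i ≠ j)
    (p : MvPolynomial σ ℝ) : dE c i i (dunkl c j p) + dunkl c i (dE c j i p)
        = dE c j i (dunkl c i p) + dunkl c j (dE c i i p) := by
  have h1 : ∀ l, c i l • tr i l (dunkl c j p) - c i l • dunkl c j (tr i l p)
     = if l = j then c i j • dunkl c i (tr i j p) - c i j • dunkl c j (tr i j p) else 0 := by
    intro l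
    rw [smul_tr_dunkl hc]
    split_ifs with h
    · subst h; simp
    · rw [Equiv.swap_apply_of_ne_of_ne hij.symm (Ne.symm h), sub_self]
  have h2 := Finset.sum_congr (rfl : (Finset.univ : Finset σ) = _) fun l _ => h1 l
  rw [Finset.sum_sub_distrib, Finset.sum_ite_eq', if_pos (Finset.mem_univ _)] at h2
  have h3 : c i j • tr i j (dunkl c i p) = c i j • dunkl c j (tr i j p) := by
    rw [smul_tr_dunkl hc, Equiv.swap_apply_left]
  have e1 : ∀ g, dE c i i g = g + ∑ l, c i l • tr i l g - c i i • g := fun g => by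
    rw [dE, if_pos rfl, tr_self]
  have e2 : ∀ g, dE c j i g = - (c i j • tr i j g) := fun g => by
    rw [dE, if_neg hij.symm, hc.symm j i, tr_comm j i, zero_sub]
  rw [e1, e1, e2, e2, h3, map_neg, map_sub, map_add, map_sum, map_smul, map_smul]
  simp only [map_smul]
  linear_combination h2

theorem dunkl_comm {c : σ → σ → ℝ} (hc : IsMult c) (i j : σ) (f : MvPolynomial σ ℝ) :
    dunkl c i (dunkl c j f) = dunkl c j (dunkl c i f) := by
  rcases eq_or_ne i j with rfl | hij
  · rfl
  induction f using MvPolynomial.induction_on with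
  | C a => simp only [dunkl_C, map_zero]
  | add p q hp hq => simp only [map_add, hp, hq]
  | mul_X p k hp =>
    have hX : ∀ i j, dunkl c i (dunkl c j (X k * p)) = X k * dunkl c i (dunkl c j p)
        + (dE c i k (dunkl c j p) + dunkl c i (dE c j k p)) := fun i j => by
      rw [dunkl_X_mul c j, LinearMap.map_add, dunkl_X_mul c i, add_assoc]
    rw [mul_comm p (X k), hX i j, hX j i, hp]
    refine congrArg (X k * dunkl c j (dunkl c i p) + ·) ?_
    rcases eq_or_ne i k with rfl | h1
    · exact dE_dunkl_self hc hij p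
    rcases eq_or_ne j k with rfl | h2
    · exact (dE_dunkl_self hc hij.symm p).symm
    · have e1 : ∀ g, dE c i k g = - (c i k • tr i k g) := fun g => by
        rw [dE, if_neg h1, zero_sub]
      have e2 : ∀ g, dE c j k g = - (c j k • tr j k g) := fun g => by
        rw [dE, if_neg h2, zero_sub]
      rw [e1, e1, e2, e2, smul_tr_dunkl hc, smul_tr_dunkl hc, map_neg, map_neg, map_smul, map_smul,
        Equiv.swap_apply_of_ne_of_ne hij.symm h2, Equiv.swap_apply_of_ne_of_ne hij h1]
      abel

end Dunkl

end MBFPieri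

namespace MBFPieri

open MvPolynomial

section CommEval

variable {σ A : Type*} [Ring A] [Algebra ℝ A]

/-- The algebra generated by a commuting family is a commutative ring. -/
abbrev adjoinRangeCommRing (D : σ → A) (h : ∀ i j, D i * D j = D j * D i) :
    CommRing (Algebra.adjoin ℝ (Set.range D)) where
  mul_comm := (Algebra.isMulCommutative_adjoin ℝ (by
    rintro _ ⟨i, rfl⟩ _ ⟨j, rfl⟩; exact h i j)).is_comm.comm

/-- Evaluation of polynomials at a commuting family of elements of an algebra. -/
def commEval (D : σ → A) (h : ∀ i j, D i * D j = D j * D i) : MvPolynomial σ ℝ →ₐ[ℝ] A :=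
  letI := adjoinRangeCommRing D h
  (Algebra.adjoin ℝ (Set.range D)).val.comp
    (aeval fun i => ⟨D i, Algebra.subset_adjoin ⟨i, rfl⟩⟩)

theorem commEval_X (D : σ → A) (h : ∀ i j, D i * D j = D j * D i) (i : σ) :
    commEval D h (X i) = D i := by
  let := adjoinRangeCommRing D h
  have := aeval_X (R := ℝ) (fun i => (⟨D i, Algebra.subset_adjoin ⟨i, rfl⟩⟩ :
    Algebra.adjoin ℝ (Set.range D))) i
  exact congrArg Subtype.val this

end CommEval

section Pairing

variable {σ : Type*} [DecidableEq σ] [Fintype σ] {c : σ → σ → ℝ}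

/-- Substitution of the Dunkl operators into a polynomial. -/
def dunklHom (hc : IsMult c) : MvPolynomial σ ℝ →ₐ[ℝ] Module.End ℝ (MvPolynomial σ ℝ) :=
  commEval (dunkl c) fun i j => LinearMap.ext fun f => dunkl_comm hc i j f

theorem dunklHom_X (hc : IsMult c) (i : σ) : dunklHom hc (X i) = dunkl c i := commEval_X _ _ i

theorem dunklHom_mul (hc : IsMult c) (p q f : MvPolynomial σ ℝ) :
    dunklHom hc (p * q) f = dunklHom hc p (dunklHom hc q f) := by
  rw [map_mul]; rfl

theorem dunklHom_comm (hc : IsMult c) (p q f : MvPolynomial σ ℝ) :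
    dunklHom hc p (dunklHom hc q f) = dunklHom hc q (dunklHom hc p f) := by
  rw [← dunklHom_mul, mul_comm, dunklHom_mul]

theorem dunklHom_C (hc : IsMult c) (a : ℝ) (f : MvPolynomial σ ℝ) :
    dunklHom hc (C a) f = a • f := by
  have : (C a : MvPolynomial σ ℝ) = algebraMap ℝ _ a := rfl
  rw [this, AlgHom.commutes, Module.algebraMap_end_apply]

theorem rename_dunklHom (hc : IsMult c) (τ : Equiv.Perm σ) (hτ : ∀ k l, c (τ k) (τ l) = c k l)
    (p f : MvPolynomial σ ℝ) :
    rename τ (dunklHom hc p f) = dunklHom hc (rename τ p) (rename τ f) := by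
  induction p using MvPolynomial.induction_on generalizing f with
  | C a => rw [rename_C, dunklHom_C, dunklHom_C, map_smul]
  | add p q hp hq => rw [map_add, map_add, map_add, LinearMap.add_apply, map_add, hp, hq]; rfl
  | mul_X p k hp =>
    rw [dunklHom_mul, hp, map_mul, dunklHom_mul, rename_X, dunklHom_X, dunklHom_X,
      rename_dunkl τ hτ]

/-- The Dunkl pairing of polynomials. -/
def pair (hc : IsMult c) (p q : MvPolynomial σ ℝ) : ℝ := constantCoeff (dunklHom hc p q)

theorem pair_add_left (hc : IsMult c) (p p' q : MvPolynomial σ ℝ) :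
    pair hc (p + p') q = pair hc p q + pair hc p' q := by
  rw [pair, map_add, LinearMap.add_apply, map_add]; rfl

theorem pair_add_right (hc : IsMult c) (p q q' : MvPolynomial σ ℝ) :
    pair hc p (q + q') = pair hc p q + pair hc p q' := by
  rw [pair, map_add, map_add]; rfl

/-- The pairing as a bilinear map. -/
def pairB (hc : IsMult c) : MvPolynomial σ ℝ →ₗ[ℝ] MvPolynomial σ ℝ →ₗ[ℝ] ℝ :=
  LinearMap.mk₂ ℝ (pair hc) (pair_add_left hc)
    (fun a p q => by
      rw [pair, map_smul, LinearMap.smul_apply, smul_eq_C_mul, map_mul, constantCoeff_C]; rfl)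
    (pair_add_right hc)
    (fun a p q => by
      rw [pair, map_smul, smul_eq_C_mul, map_mul, constantCoeff_C]; rfl)

theorem pairB_apply (hc : IsMult c) (p q : MvPolynomial σ ℝ) : pairB hc p q = pair hc p q := rfl

theorem pair_X_mul_left (hc : IsMult c) (i : σ) (p q : MvPolynomial σ ℝ) :
    pair hc (X i * p) q = pair hc p (dunkl c i q) := by
  rw [pair, mul_comm, dunklHom_mul, dunklHom_X]; rfl

theorem pair_tr (hc : IsMult c) (i j : σ) (p q : MvPolynomial σ ℝ) :
    c i j * pair hc (tr i j p) q = c i j * pair hc p (tr i j q) := by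
  rcases eq_or_ne (c i j) 0 with h | h
  · simp [h]
  · have := rename_dunklHom hc (Equiv.swap i j) (hc.inv i j h) p (tr i j q)
    have h2 := congrArg constantCoeff this
    rw [constantCoeff_rename] at h2
    change pair hc p (tr i j q) = pair hc (tr i j p) (tr i j (tr i j q)) at h2
    rw [h2, tr_tr]

theorem pair_dE (hc : IsMult c) (i k : σ) (p q : MvPolynomial σ ℝ) :
    pair hc (dE c i k p) q = pair hc p (dE c k i q) := by
  simp only [← pairB_apply, dE]
  rcases eq_or_ne i k with rfl | h
  · simp only [if_true, map_sub, map_add, map_sum, map_smul, LinearMap.add_apply,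
      LinearMap.sub_apply, LinearMap.sum_apply, LinearMap.smul_apply, smul_eq_mul]
    simp only [pairB_apply, pair_tr]
  · simp only [if_neg h, if_neg h.symm, zero_sub, map_neg, map_smul, LinearMap.neg_apply,
      LinearMap.smul_apply, smul_eq_mul]
    simp only [pairB_apply, pair_tr, hc.symm k i, tr_comm k i]

theorem pair_X_mul_right (hc : IsMult c) (i : σ) (p q : MvPolynomial σ ℝ) :
    pair hc p (X i * q) = pair hc (dunkl c i p) q := by
  induction p using MvPolynomial.induction_on generalizing q with
  | C a => rw [dunkl_C, pair, dunklHom_C, pair, map_zero]; simp [smul_eq_C_mul]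
  | add p p' hp hp' => rw [pair_add_left, hp, hp', map_add, pair_add_left]
  | mul_X p k hp =>
    rw [mul_comm p, pair_X_mul_left, dunkl_X_mul, dunkl_X_mul, pair_add_left, pair_add_right, hp,
      pair_X_mul_left, pair_dE]

theorem pair_symm (hc : IsMult c) (p q : MvPolynomial σ ℝ) : pair hc p q = pair hc q p := by
  induction p using MvPolynomial.induction_on generalizing q with
  | C a =>
    induction q using MvPolynomial.induction_on with
    | C b => simp [pair, smul_eq_C_mul, mul_comm]
    | add q q' h h' => rw [pair_add_left, pair_add_right, h, h']
    | mul_X q k h =>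
      rw [mul_comm, pair_X_mul_left, dunkl_C, pair_X_mul_right, dunkl_C]; simp [pair]
  | add p p' hp hp' => rw [pair_add_left, hp, hp', pair_add_right]
  | mul_X p k hp => rw [mul_comm, pair_X_mul_left, hp, pair_X_mul_right]

theorem dunkl_psum_one_mul (c : σ → σ → ℝ) (i : σ) (f : MvPolynomial σ ℝ) :
    dunkl c i ((∑ k, X k) * f) = (∑ k, X k) * dunkl c i f + f := by
  rw [Finset.sum_mul, map_sum, Finset.sum_mul]
  simp only [dunkl_X_mul, Finset.sum_add_distrib, dE, Finset.sum_sub_distrib, Finset.sum_ite_eq,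
    Finset.mem_univ, if_true]
  abel

end Pairing

end MBFPieri

namespace MBFPieri

open MvPolynomial

theorem pderiv_prod {σ ι : Type*} [DecidableEq ι] (i : σ) (s : Finset ι)
    (f : ι → MvPolynomial σ ℝ) :
    pderiv i (∏ p ∈ s, f p) = ∑ p ∈ s, (∏ q ∈ s.erase p, f q) * pderiv i (f p) := by
  induction s using Finset.induction_on with
  | empty => simp
  | insert a s ha ih =>
    rw [Finset.prod_insert ha, pderiv_mul, ih, Finset.sum_insert ha, Finset.erase_insert ha,
      Finset.mul_sum]
    congr 1
    · ring
    · refine Finset.sum_congr rfl fun p hp => ?_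
      have hpa : p ≠ a := fun h => ha (h ▸ hp)
      rw [Finset.erase_insert_of_ne hpa.symm, Finset.prod_insert
        (fun h => ha (Finset.mem_of_mem_erase h))]
      ring

theorem rename_tr_of_injective {σ τ : Type*} [DecidableEq σ] [DecidableEq τ] {e : σ → τ}
    (he : Function.Injective e) (i j : σ) (f : MvPolynomial σ ℝ) :
    tr (e i) (e j) (rename e f) = rename e (tr i j f) := by
  rw [tr, tr, rename_rename, rename_rename, he.swap_comp]

theorem rename_dd_of_injective {σ τ : Type*} [DecidableEq σ] [DecidableEq τ] {e : σ → τ}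
    (he : Function.Injective e) (i j : σ) (f : MvPolynomial σ ℝ) :
    dd (e i) (e j) (rename e f) = rename e (dd i j f) := by
  rcases eq_or_ne i j with rfl | h
  · simp [dd_self]
  · apply dd_unique (he.ne h)
    rw [rename_tr_of_injective he, ← map_sub, ← mul_dd]; simp

section SumVars

variable {σ τ : Type*}

/-- Linear maps out of polynomials in two groups of variables are determined by their values
on products. -/
theorem sum_linearMap_ext {M : Type*} [AddCommMonoid M] [Module ℝ M]
    {φ ψ : MvPolynomial (σ ⊕ τ) ℝ →ₗ[ℝ] M}
    (h : ∀ p q, φ (rename Sum.inl p * rename Sum.inr q) = ψ (rename Sum.inl p * rename Sum.inr q)) :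
    φ = ψ := by
  have key : ∀ f : MvPolynomial (σ ⊕ τ) ℝ, f ∈ Submodule.span ℝ
      (Set.range fun x : MvPolynomial σ ℝ × MvPolynomial τ ℝ =>
        (rename Sum.inl x.1 * rename Sum.inr x.2 : MvPolynomial (σ ⊕ τ) ℝ)) := by
    intro f
    induction f using MvPolynomial.induction_on with
    | C a => exact Submodule.subset_span ⟨(C a, 1), by simp⟩
    | add p q hp hq => exact Submodule.add_mem _ hp hq
    | mul_X p k hp =>
      induction hp using Submodule.span_induction with
      | mem x hx =>
        obtain ⟨⟨u, v⟩, rfl⟩ := hx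
        rcases k with k | k
        · exact Submodule.subset_span ⟨(u * X k, v), by simp; ring⟩
        · exact Submodule.subset_span ⟨(u, v * X k), by simp; ring⟩
      | zero => simp
      | add x y _ _ hx hy => rw [add_mul]; exact Submodule.add_mem _ hx hy
      | smul a x _ hx => rw [smul_mul_assoc]; exact Submodule.smul_mem _ _ hx
  refine LinearMap.ext fun x => ?_
  refine Submodule.span_induction (p := fun f _ => φ f = ψ f) ?_ ?_ ?_ ?_ (key _)
  · rintro _ ⟨x, rfl⟩; exact h _ _
  · simp
  · intro x y _ _ hx hy; simp [hx, hy]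
  · intro a x _ hx; simp [hx]

/-- The action of a linear functional on the first group of variables. -/
def liftFun (φ : MvPolynomial σ ℝ →ₗ[ℝ] ℝ) :
    MvPolynomial (σ ⊕ τ) ℝ →ₗ[ℝ] MvPolynomial τ ℝ :=
  (basisMonomials (σ ⊕ τ) ℝ).constr ℝ fun m =>
    φ (monomial (m.comapDomain Sum.inl Sum.inl_injective.injOn) 1) •
      monomial (m.comapDomain Sum.inr Sum.inr_injective.injOn) (1 : ℝ)

theorem liftFun_mul (φ : MvPolynomial σ ℝ →ₗ[ℝ] ℝ) (p : MvPolynomial σ ℝ)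
    (q : MvPolynomial τ ℝ) :
    liftFun φ (rename Sum.inl p * rename Sum.inr q) = φ p • q := by
  have h1 : ((LinearMap.mul ℝ (MvPolynomial (σ ⊕ τ) ℝ)).compr₂ (liftFun φ)).compl₁₂
        (rename Sum.inl).toLinearMap (rename Sum.inr).toLinearMap
      = (LinearMap.lsmul ℝ (MvPolynomial τ ℝ)).comp φ := by
    refine (basisMonomials σ ℝ).ext fun m => (basisMonomials τ ℝ).ext fun n => ?_
    simp only [coe_basisMonomials, LinearMap.compl₁₂_apply, LinearMap.compr₂_apply,
      AlgHom.toLinearMap_apply, LinearMap.mul_apply', LinearMap.comp_apply,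
      LinearMap.lsmul_apply, rename_monomial, monomial_mul, mul_one]
    have := (basisMonomials (σ ⊕ τ) ℝ).constr_basis ℝ (fun m =>
    φ (monomial (m.comapDomain Sum.inl Sum.inl_injective.injOn) 1) •
      monomial (m.comapDomain Sum.inr Sum.inr_injective.injOn) (1 : ℝ))
      (Finsupp.mapDomain Sum.inl m + Finsupp.mapDomain Sum.inr n)
    rw [coe_basisMonomials] at this
    rw [liftFun, this]
    have e1 : (Finsupp.mapDomain Sum.inl m + Finsupp.mapDomain Sum.inr n : σ ⊕ τ →₀ ℕ).comapDomain
      Sum.inl Sum.inl_injective.injOn = m := by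
      ext i
      simp [Finsupp.mapDomain_apply Sum.inl_injective, Finsupp.mapDomain_of_notMem_range]
    have e2 : (Finsupp.mapDomain Sum.inl m + Finsupp.mapDomain Sum.inr n : σ ⊕ τ →₀ ℕ).comapDomain
      Sum.inr Sum.inr_injective.injOn = n := by
      ext i
      simp [Finsupp.mapDomain_apply Sum.inr_injective, Finsupp.mapDomain_of_notMem_range]
    rw [e1, e2]
  exact congrArg (fun F => F p q) h1

/-- Evaluation of the second group of variables. -/
def evalInr (ζ : τ → ℝ) : MvPolynomial (σ ⊕ τ) ℝ →ₐ[ℝ] MvPolynomial σ ℝ :=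
  aeval (Sum.elim X fun k => C (ζ k))

theorem evalInr_mul (ζ : τ → ℝ) (p : MvPolynomial σ ℝ) (q : MvPolynomial τ ℝ) :
    evalInr ζ (rename Sum.inl p * rename Sum.inr q) = eval ζ q • p := by
  rw [evalInr, map_mul, aeval_rename, aeval_rename]
  have e1 : ((Sum.elim (X : σ → MvPolynomial σ ℝ) fun k => C (ζ k)) ∘ Sum.inl) = X := rfl
  have e2 : ((Sum.elim (X : σ → MvPolynomial σ ℝ) fun k => C (ζ k)) ∘ Sum.inr)
      = algebraMap ℝ (MvPolynomial σ ℝ) ∘ ζ := rfl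
  rw [e1, e2, aeval_X_left_apply, aeval_algebraMap_apply, mul_comm, ← Algebra.smul_def,
    aeval_eq_eval]

theorem eval_liftFun (φ : MvPolynomial σ ℝ →ₗ[ℝ] ℝ) (F : MvPolynomial (σ ⊕ τ) ℝ) (ζ : τ → ℝ) :
    eval ζ (liftFun φ F) = φ (evalInr ζ F) := by
  have : (aeval (R := ℝ) ζ).toLinearMap.comp (liftFun (τ := τ) φ)
      = φ.comp (evalInr ζ).toLinearMap := by
    apply sum_linearMap_ext
    intro p q
    simp only [LinearMap.comp_apply, liftFun_mul, AlgHom.toLinearMap_apply, map_smul]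
    rw [evalInr_mul, map_smul, smul_eq_mul, smul_eq_mul, mul_comm, aeval_eq_eval]
  exact congrArg (fun G => G F) this

variable [DecidableEq σ] [DecidableEq τ]

/-- The multiplicity function of the product of two root systems. -/
def sumMult (c₁ : σ → σ → ℝ) (c₂ : τ → τ → ℝ) : σ ⊕ τ → σ ⊕ τ → ℝ
  | Sum.inl i, Sum.inl j => c₁ i j
  | Sum.inr i, Sum.inr j => c₂ i j
  | _, _ => 0

variable {c₁ : σ → σ → ℝ} {c₂ : τ → τ → ℝ}

theorem IsMult.sumMult (h₁ : IsMult c₁) (h₂ : IsMult c₂) : IsMult (sumMult c₁ c₂) where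
  symm := by
    rintro (i | i) (j | j) <;> simp only [MBFPieri.sumMult]
    · exact h₁.symm i j
    · exact h₂.symm i j
  inv := by
    have hl : ∀ (i j : σ) (k : τ), Equiv.swap (Sum.inl i) (Sum.inl j) (Sum.inr k)
      = (Sum.inr k : σ ⊕ τ) := fun i j k => Equiv.swap_apply_of_ne_of_ne (by simp) (by simp)
    have hr : ∀ (i j : τ) (k : σ), Equiv.swap (Sum.inr i) (Sum.inr j) (Sum.inl k)
      = (Sum.inl k : σ ⊕ τ) := fun i j k => Equiv.swap_apply_of_ne_of_ne (by simp) (by simp)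
    rintro (i | i) (j | j) hij (k | k) (l | l) <;>
      simp only [MBFPieri.sumMult, ne_eq, not_true_eq_false] at hij <;>
      simp only [Sum.inl_injective.swap_apply, Sum.inr_injective.swap_apply, hl, hr,
        MBFPieri.sumMult]
    · exact h₁.inv i j hij k l
    · exact h₂.inv i j hij k l

theorem tr_inl_rename_inr (i j : σ) (q : MvPolynomial τ ℝ) :
    tr (Sum.inl i) (Sum.inl j) (rename (Sum.inr : τ → σ ⊕ τ) q) = rename Sum.inr q := by
  rw [tr, rename_rename]; congr 2

theorem tr_inr_rename_inl (i j : τ) (p : MvPolynomial σ ℝ) :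
    tr (Sum.inr i) (Sum.inr j) (rename (Sum.inl : σ → σ ⊕ τ) p) = rename Sum.inl p := by
  rw [tr, rename_rename]; congr 2

theorem pderiv_inl_rename_inr {σ τ : Type*} (i : σ) (q : MvPolynomial τ ℝ) :
    pderiv (Sum.inl i) (rename (Sum.inr : τ → σ ⊕ τ) q) = 0 := by
  classical
  induction q using MvPolynomial.induction_on with
  | C a => simp
  | add p q hp hq => simp [hp, hq]
  | mul_X p k hp => simp [hp]

theorem pderiv_inr_rename_inl {σ τ : Type*} (i : τ) (q : MvPolynomial σ ℝ) :
    pderiv (Sum.inr i) (rename (Sum.inl : σ → σ ⊕ τ) q) = 0 := by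
  classical
  induction q using MvPolynomial.induction_on with
  | C a => simp
  | add p q hp hq => simp [hp, hq]
  | mul_X p k hp => simp [hp]

variable [Fintype σ] [Fintype τ]

theorem dunkl_inl_apply (i : σ) (F : MvPolynomial (σ ⊕ τ) ℝ) :
    dunkl (sumMult c₁ c₂) (Sum.inl i) F
      = pderiv (Sum.inl i) F + ∑ j, c₁ i j • dd (Sum.inl i) (Sum.inl j) F := by
  simp [dunkl_apply, Fintype.sum_sum_type, sumMult]

theorem dunkl_inr_apply (i : τ) (F : MvPolynomial (σ ⊕ τ) ℝ) :
    dunkl (sumMult c₁ c₂) (Sum.inr i) F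
      = pderiv (Sum.inr i) F + ∑ j, c₂ i j • dd (Sum.inr i) (Sum.inr j) F := by
  simp [dunkl_apply, Fintype.sum_sum_type, sumMult]

theorem dunkl_inl_mul (i : σ) (p : MvPolynomial σ ℝ) (q : MvPolynomial τ ℝ) :
    dunkl (sumMult c₁ c₂) (Sum.inl i) (rename Sum.inl p * rename Sum.inr q)
      = rename Sum.inl (dunkl c₁ i p) * rename Sum.inr q := by
  rw [dunkl_inl_apply, dunkl_apply, pderiv_mul, pderiv_inl_rename_inr, mul_zero, add_zero,
    pderiv_rename Sum.inl_injective, map_add, add_mul, map_sum, Finset.sum_mul]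
  refine congrArg _ (Finset.sum_congr rfl fun j _ => ?_)
  rw [dd_mul, tr_inl_rename_inr, dd_eq_zero (tr_inl_rename_inr i j q), mul_zero, zero_add,
    rename_dd_of_injective Sum.inl_injective, map_smul, smul_mul_assoc]

theorem dunkl_inr_mul (i : τ) (p : MvPolynomial σ ℝ) (q : MvPolynomial τ ℝ) :
    dunkl (sumMult c₁ c₂) (Sum.inr i) (rename Sum.inl p * rename Sum.inr q)
      = rename Sum.inl p * rename Sum.inr (dunkl c₂ i q) := by
  rw [dunkl_inr_apply, dunkl_apply, pderiv_mul, pderiv_inr_rename_inl, zero_mul, zero_add,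
    pderiv_rename Sum.inr_injective, map_add, mul_add, map_sum, Finset.mul_sum]
  refine congrArg _ (Finset.sum_congr rfl fun j _ => ?_)
  rw [dd_mul, dd_eq_zero (tr_inr_rename_inl i j p), zero_mul, add_zero,
    rename_dd_of_injective Sum.inr_injective, map_smul, mul_smul_comm]

theorem liftFun_dunkl (φ : MvPolynomial σ ℝ →ₗ[ℝ] ℝ) (k : τ) (F : MvPolynomial (σ ⊕ τ) ℝ) :
    liftFun φ (dunkl (sumMult c₁ c₂) (Sum.inr k) F) = dunkl c₂ k (liftFun φ F) := by
  have : (liftFun φ).comp (dunkl (sumMult c₁ c₂) (Sum.inr k))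
      = (dunkl c₂ k).comp (liftFun (τ := τ) φ) := by
    apply sum_linearMap_ext
    intro p q
    simp only [LinearMap.comp_apply, dunkl_inr_mul, liftFun_mul, map_smul]
  exact congrArg (fun G => G F) this

theorem liftFun_dunklHom (h₁ : IsMult c₁) (h₂ : IsMult c₂) (φ : MvPolynomial σ ℝ →ₗ[ℝ] ℝ)
    (p : MvPolynomial τ ℝ) (F : MvPolynomial (σ ⊕ τ) ℝ) :
    liftFun φ (dunklHom (h₁.sumMult h₂) (rename Sum.inr p) F)
      = dunklHom h₂ p (liftFun φ F) := by
  induction p using MvPolynomial.induction_on generalizing F with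
  | C a => rw [rename_C, dunklHom_C, dunklHom_C, map_smul]
  | add p q hp hq => simp only [map_add, LinearMap.add_apply, hp, hq]
  | mul_X p k hp =>
    rw [map_mul, dunklHom_mul, hp, dunklHom_mul, rename_X, dunklHom_X, dunklHom_X, liftFun_dunkl]

theorem evalInr_dunkl (ζ : τ → ℝ) (i : σ) (F : MvPolynomial (σ ⊕ τ) ℝ) :
    evalInr ζ (dunkl (sumMult c₁ c₂) (Sum.inl i) F) = dunkl c₁ i (evalInr ζ F) := by
  have : (evalInr ζ).toLinearMap.comp (dunkl (sumMult c₁ c₂) (Sum.inl i))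
      = (dunkl c₁ i).comp (evalInr (σ := σ) ζ).toLinearMap := by
    apply sum_linearMap_ext
    intro p q
    simp only [LinearMap.comp_apply, dunkl_inl_mul, AlgHom.toLinearMap_apply]
    rw [evalInr_mul, evalInr_mul, map_smul]
  exact congrArg (fun G => G F) this

theorem evalInr_dunklHom (h₁ : IsMult c₁) (h₂ : IsMult c₂) (ζ : τ → ℝ)
    (p : MvPolynomial σ ℝ) (F : MvPolynomial (σ ⊕ τ) ℝ) :
    evalInr ζ (dunklHom (h₁.sumMult h₂) (rename Sum.inl p) F)
      = dunklHom h₁ p (evalInr ζ F) := by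
  induction p using MvPolynomial.induction_on generalizing F with
  | C a => rw [rename_C, dunklHom_C, dunklHom_C, map_smul]
  | add p q hp hq => simp only [map_add, LinearMap.add_apply, hp, hq]
  | mul_X p k hp =>
    rw [map_mul, dunklHom_mul, hp, dunklHom_mul, rename_X, dunklHom_X, dunklHom_X, evalInr_dunkl]

end SumVars

end MBFPieri

namespace MBFPieri

open MvPolynomial

theorem isMult_const {σ : Type*} [DecidableEq σ] (t : ℝ) : IsMult fun _ _ : σ => t :=
  ⟨fun _ _ => rfl, fun _ _ _ _ _ => rfl⟩

section Kernel

variable {σ τ : Type*} [DecidableEq σ] [DecidableEq τ]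

/-- The linear factor `z_k - Y_i`. -/
def lf (p : σ × τ) : MvPolynomial (σ ⊕ τ) ℝ := X (Sum.inr p.2) - X (Sum.inl p.1)

/-- The product of linear factors over a finite set. -/
def kerP (s : Finset (σ × τ)) : MvPolynomial (σ ⊕ τ) ℝ := ∏ p ∈ s, lf p

theorem tr_inl_lf (i j : σ) (p : σ × τ) :
    tr (Sum.inl i) (Sum.inl j) (lf p) = lf (Equiv.swap i j p.1, p.2) := by
  rw [lf, map_sub, tr_X, tr_X, Sum.inl_injective.swap_apply, Equiv.swap_apply_of_ne_of_ne]
  · rfl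
  · simp
  · simp

theorem tr_inr_lf (i j : τ) (p : σ × τ) :
    tr (Sum.inr i) (Sum.inr j) (lf p) = lf (p.1, Equiv.swap i j p.2) := by
  rw [lf, map_sub, tr_X, tr_X, Sum.inr_injective.swap_apply,
    Equiv.swap_apply_of_ne_of_ne (x := Sum.inl p.1) (by simp) (by simp)]
  rfl

theorem kerP_erase {s : Finset (σ × τ)} {q : σ × τ} (h : q ∈ s) :
    kerP s = lf q * kerP (s.erase q) := (Finset.mul_prod_erase s lf h).symm

/-- The multiplicity `θ` on the first and `θ⁻¹` on the second group of variables. -/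
def dualMult (σ τ : Type*) (θ : ℝ) : σ ⊕ τ → σ ⊕ τ → ℝ :=
  sumMult (fun _ _ => θ) (fun _ _ => θ⁻¹)

theorem isMult_dualMult (θ : ℝ) : IsMult (dualMult σ τ θ) :=
  (isMult_const θ).sumMult (isMult_const θ⁻¹)

variable [Fintype σ] [Fintype τ]

theorem tr_inl_kerP (i j : σ) : tr (Sum.inl i) (Sum.inl j) (kerP (Finset.univ : Finset (σ × τ)))
    = kerP Finset.univ := by
  rw [kerP, map_prod]
  simp only [tr_inl_lf]
  exact Equiv.prod_comp ((Equiv.swap i j).prodCongr (Equiv.refl τ)) lf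

theorem tr_inr_kerP (i j : τ) : tr (Sum.inr i) (Sum.inr j) (kerP (Finset.univ : Finset (σ × τ)))
    = kerP Finset.univ := by
  rw [kerP, map_prod]
  simp only [tr_inr_lf]
  exact Equiv.prod_comp ((Equiv.refl σ).prodCongr (Equiv.swap i j)) lf

theorem tr_inl_kerP_erase (i j : σ) (p : σ × τ) :
    tr (Sum.inl i) (Sum.inl j) (kerP (Finset.univ.erase p))
      = kerP (Finset.univ.erase (Equiv.swap i j p.1, p.2)) := by
  rw [kerP, map_prod]
  simp only [tr_inl_lf]
  refine Finset.prod_equiv ((Equiv.swap i j).prodCongr (Equiv.refl τ)) ?_ (fun _ _ => rfl)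
  intro q
  simp [Prod.ext_iff]

theorem tr_inr_kerP_erase (i j : τ) (p : σ × τ) :
    tr (Sum.inr i) (Sum.inr j) (kerP (Finset.univ.erase p))
      = kerP (Finset.univ.erase (p.1, Equiv.swap i j p.2)) := by
  rw [kerP, map_prod]
  simp only [tr_inr_lf]
  refine Finset.prod_equiv ((Equiv.refl σ).prodCongr (Equiv.swap i j)) ?_ (fun _ _ => rfl)
  intro q
  simp [Prod.ext_iff]

theorem dd_inl_kerP_erase (i j : σ) (k : τ) (h : j ≠ i) :
    dd (Sum.inl i) (Sum.inl j) (kerP (Finset.univ.erase (i, k)))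
      = kerP ((Finset.univ.erase (i, k)).erase (j, k)) := by
  apply dd_unique (Sum.inl_injective.ne h.symm)
  rw [tr_inl_kerP_erase, Equiv.swap_apply_left,
    kerP_erase (s := Finset.univ.erase (i, k)) (q := (j, k)) (by simp [h]),
    kerP_erase (s := Finset.univ.erase (j, k)) (q := (i, k)) (by simp [h.symm]),
    Finset.erase_right_comm, lf, lf]
  ring

theorem dd_inr_kerP_erase (i : σ) (k l : τ) (h : l ≠ k) :
    dd (Sum.inr k) (Sum.inr l) (kerP (Finset.univ.erase (i, k)))
      = - kerP ((Finset.univ.erase (i, k)).erase (i, l)) := by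
  apply dd_unique (Sum.inr_injective.ne h.symm)
  rw [tr_inr_kerP_erase, Equiv.swap_apply_left,
    kerP_erase (s := Finset.univ.erase (i, k)) (q := (i, l)) (by simp [h]),
    kerP_erase (s := Finset.univ.erase (i, l)) (q := (i, k)) (by simp [h.symm]),
    Finset.erase_right_comm, lf, lf]
  ring

theorem pderiv_inl_kerP (i : σ) (s : Finset (σ × τ)) :
    pderiv (Sum.inl i) (kerP s) = - ∑ k, if (i, k) ∈ s then kerP (s.erase (i, k)) else 0 := by
  have h : ∀ p : σ × τ, pderiv (Sum.inl i) (lf p) = if p.1 = i then -1 else 0 := by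
    intro p
    rw [lf, map_sub, pderiv_X_of_ne (by simp), pderiv_X]
    simp [Pi.single_apply, Sum.inl_injective.eq_iff]
    split_ifs <;> simp
  rw [kerP, pderiv_prod]
  simp only [h, mul_ite, mul_neg, mul_one, mul_zero]
  have : ∀ p : σ × τ, p ∈ s → (if p.1 = i then - ∏ q ∈ s.erase p, lf q else 0)
    = (fun p => if p ∈ s then (if p.1 = i then - kerP (s.erase p) else 0) else 0) p := by
    intro p hp; simp [hp, kerP]
  rw [Finset.sum_congr rfl this, Finset.sum_subset (Finset.subset_univ s)
    (fun p _ hp => by simp [hp]), Fintype.sum_prod_type_right, ← Finset.sum_neg_distrib]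
  refine Finset.sum_congr rfl fun k _ => ?_
  rw [Finset.sum_eq_single i]
  · simp only [if_true]; split_ifs <;> simp
  · intro b _ hb; simp [hb]
  · simp

theorem pderiv_inr_kerP (k : τ) (s : Finset (σ × τ)) :
    pderiv (Sum.inr k) (kerP s) = ∑ i, if (i, k) ∈ s then kerP (s.erase (i, k)) else 0 := by
  have h : ∀ p : σ × τ, pderiv (Sum.inr k) (lf p) = if p.2 = k then 1 else 0 := by
    intro p
    rw [lf, map_sub, pderiv_X_of_ne (i := Sum.inr k) (j := Sum.inl p.1) (by simp), pderiv_X]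
    simp [Pi.single_apply, Sum.inr_injective.eq_iff]
  rw [kerP, pderiv_prod]
  simp only [h, mul_ite, mul_one, mul_zero]
  have : ∀ p : σ × τ, p ∈ s → (if p.2 = k then ∏ q ∈ s.erase p, lf q else 0)
    = (fun p => if p ∈ s then (if p.2 = k then kerP (s.erase p) else 0) else 0) p := by
    intro p hp; simp [hp, kerP]
  rw [Finset.sum_congr rfl this, Finset.sum_subset (Finset.subset_univ s)
    (fun p _ hp => by simp [hp]), Fintype.sum_prod_type]
  refine Finset.sum_congr rfl fun i _ => ?_
  rw [Finset.sum_eq_single k]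
  · simp only [if_true]
  · intro b _ hb; simp [hb]
  · simp

theorem dunkl_inl_kerP (θ : ℝ) (i : σ) :
    dunkl (dualMult σ τ θ) (Sum.inl i) (kerP Finset.univ)
      = - ∑ k, kerP (Finset.univ.erase (i, k)) := by
  rw [dualMult, dunkl_inl_apply, pderiv_inl_kerP]
  simp [dd_eq_zero (tr_inl_kerP _ _)]

theorem dunkl_inr_kerP (θ : ℝ) (k : τ) :
    dunkl (dualMult σ τ θ) (Sum.inr k) (kerP Finset.univ)
      = ∑ i, kerP (Finset.univ.erase (i, k)) := by
  rw [dualMult, dunkl_inr_apply, pderiv_inr_kerP]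
  simp [dd_eq_zero (tr_inr_kerP _ _)]

theorem dunkl_inl_kerP_erase {θ : ℝ} (hθ : θ ≠ 0) (i : σ) (k : τ) :
    dunkl (dualMult σ τ θ) (Sum.inl i) (kerP (Finset.univ.erase (i, k)))
      = θ • dunkl (dualMult σ τ θ) (Sum.inr k) (kerP (Finset.univ.erase (i, k))) := by
  rw [dualMult, dunkl_inl_apply, dunkl_inr_apply, pderiv_inr_kerP, pderiv_inl_kerP, smul_add,
    ← Finset.smul_sum, ← Finset.smul_sum, smul_smul, mul_inv_cancel₀ hθ, one_smul,
    ← Finset.sum_neg_distrib, add_comm]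
  congr 1
  · congr 1
    refine Finset.sum_congr rfl fun j _ => ?_
    rcases eq_or_ne j i with rfl | h
    · simp [dd_self]
    · rw [dd_inl_kerP_erase i j k h, if_pos (by simp [h])]
  · refine Finset.sum_congr rfl fun l _ => ?_
    rcases eq_or_ne l k with rfl | h
    · simp [dd_self]
    · rw [dd_inr_kerP_erase i k l h, if_pos (by simp [h])]

theorem dunklHom_psum_inl_kerP {θ : ℝ} (hθ : θ ≠ 0) (r : ℕ) :
    dunklHom (isMult_dualMult θ) (rename Sum.inl (psum σ ℝ (r + 1)))
        (kerP (Finset.univ : Finset (σ × τ)))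
      = - (θ ^ r • dunklHom (isMult_dualMult θ) (rename Sum.inr (psum τ ℝ (r + 1)))
        (kerP Finset.univ)) := by
  have key : ∀ (r : ℕ) (i : σ) (k : τ), dunklHom (isMult_dualMult θ) (X (Sum.inl i) ^ r)
      (kerP (Finset.univ.erase (i, k))) = θ ^ r • dunklHom (isMult_dualMult θ) (X (Sum.inr k) ^ r)
      (kerP (Finset.univ.erase (i, k))) := by
    intro r i k
    induction r with
    | zero => simp
    | succ r ih =>
      rw [pow_succ, pow_succ, pow_succ, dunklHom_mul, dunklHom_mul, dunklHom_X, dunklHom_X,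
        dunkl_inl_kerP_erase hθ, map_smul, ← dunklHom_X (isMult_dualMult θ), dunklHom_comm, ih,
        map_smul, smul_smul, dunklHom_comm, mul_comm]
  have h1 : ∀ i : σ, dunklHom (isMult_dualMult θ) (X (Sum.inl i) ^ (r + 1))
      (kerP (Finset.univ : Finset (σ × τ)))
      = - ∑ k, θ ^ r • dunklHom (isMult_dualMult θ) (X (Sum.inr k) ^ r)
      (kerP (Finset.univ.erase (i, k))) := by
    intro i
    rw [pow_succ, dunklHom_mul, dunklHom_X, dunkl_inl_kerP, map_neg, map_sum]
    simp only [key]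
  have h2 : ∀ k : τ, dunklHom (isMult_dualMult θ) (X (Sum.inr k) ^ (r + 1))
      (kerP (Finset.univ : Finset (σ × τ)))
      = ∑ i, dunklHom (isMult_dualMult θ) (X (Sum.inr k) ^ r)
      (kerP (Finset.univ.erase (i, k))) := by
    intro i
    rw [pow_succ, dunklHom_mul, dunklHom_X, dunkl_inr_kerP, map_sum]
  simp only [psum, map_sum, map_pow, rename_X, LinearMap.sum_apply]
  simp only [← map_pow, h1, h2, Finset.sum_neg_distrib, ← Finset.smul_sum]
  rw [Finset.sum_comm]

end Kernel

section GFun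

variable {σ : Type*} [Fintype σ]

/-- The coefficients of `∏ (1 - a_i x)^{-θ}`, defined by the Newton-type recursion. -/
def gPol (σ : Type*) [Fintype σ] (θ : ℝ) : ℕ → MvPolynomial σ ℝ
  | 0 => 1
  | r + 1 => (θ / (r + 1)) • ∑ j : Fin (r + 1), psum σ ℝ (r - j + 1) * gPol σ θ j

theorem gPol_zero (θ : ℝ) : gPol σ θ 0 = 1 := by rw [gPol]

theorem gPol_succ (θ : ℝ) (r : ℕ) : gPol σ θ (r + 1)
    = (θ / (r + 1)) • ∑ j ∈ Finset.range (r + 1), psum σ ℝ (r - j + 1) * gPol σ θ j := by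
  rw [gPol, Finset.sum_range]

theorem esymm_succ (r : ℕ) : esymm σ ℝ (r + 1) = (1 / (r + 1 : ℝ)) •
    ∑ j ∈ Finset.range (r + 1), (-1 : ℝ) ^ (r - j) • (psum σ ℝ (r - j + 1) * esymm σ ℝ j) := by
  have h := mul_esymm_eq_sum σ ℝ (r + 1)
  have h2 : ∑ a ∈ Finset.HasAntidiagonal.antidiagonal (r + 1) with a.1 < r + 1,
      (-1) ^ a.1 * esymm σ ℝ a.1 * psum σ ℝ a.2
      = ∑ j ∈ Finset.range (r + 1), (-1) ^ j * esymm σ ℝ j * psum σ ℝ (r - j + 1) := by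
    rw [Finset.sum_filter, Finset.Nat.sum_antidiagonal_eq_sum_range_succ_mk,
      Finset.sum_range_succ]
    simp only [lt_irrefl, if_false, add_zero]
    refine Finset.sum_congr rfl fun j hj => ?_
    have := Finset.mem_range.mp hj
    rw [if_pos this, show r + 1 - j = r - j + 1 by omega]
  rw [h2] at h
  have hr : ((r : ℝ) + 1) ≠ 0 := by positivity
  have h3 : ((r : ℝ) + 1) • esymm σ ℝ (r + 1) = ∑ j ∈ Finset.range (r + 1),
      (-1 : ℝ) ^ (r - j) • (psum σ ℝ (r - j + 1) * esymm σ ℝ j) := by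
    rw [smul_eq_C_mul]
    have : (C ((r : ℝ) + 1) : MvPolynomial σ ℝ) = ((r + 1 : ℕ) : MvPolynomial σ ℝ) := by simp
    rw [this, h, Finset.mul_sum]
    refine Finset.sum_congr rfl fun j hj => ?_
    have hj' := Finset.mem_range.mp hj
    have e : ((-1 : MvPolynomial σ ℝ)) ^ (r + 1 + 1) * (-1) ^ j = (-1) ^ (r - j) := by
      obtain ⟨d, rfl⟩ : ∃ d, r = j + d := ⟨r - j, by omega⟩
      rw [Nat.add_sub_cancel_left, ← pow_add, show j + d + 1 + 1 + j = 2 * (j + 1) + d by ring,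
        pow_add, pow_mul]
      simp
    rw [smul_eq_C_mul, C_pow, C_neg, C_1, ← e]
    ring
  rw [← h3, smul_smul, one_div, inv_mul_cancel₀ hr, one_smul]

variable {τ : Type*} [DecidableEq σ] [DecidableEq τ] [Fintype τ]

theorem dunklHom_gPol_inl_kerP {θ : ℝ} (hθ : θ ≠ 0) (r : ℕ) :
    dunklHom (isMult_dualMult θ) (rename Sum.inl (gPol σ θ r))
        (kerP (Finset.univ : Finset (σ × τ)))
      = (-θ) ^ r • dunklHom (isMult_dualMult θ) (rename Sum.inr (esymm τ ℝ r))
        (kerP Finset.univ) := by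
  induction r using Nat.strong_induction_on with
  | _ r ih =>
    rcases r with _ | r
    · simp [gPol_zero]
    · rw [gPol_succ, esymm_succ]
      simp only [map_smul, map_sum, LinearMap.smul_apply, LinearMap.sum_apply, map_mul]
      rw [smul_smul, Finset.smul_sum, Finset.smul_sum]
      refine Finset.sum_congr rfl fun j hj => ?_
      have hj' := Finset.mem_range.mp hj
      rw [← map_mul, dunklHom_mul, ih j hj', map_smul, dunklHom_comm, dunklHom_psum_inl_kerP hθ,
        ← map_mul, mul_comm (rename Sum.inr (psum τ ℝ (r - j + 1))), dunklHom_mul, map_neg,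
        map_smul, smul_neg, smul_neg, smul_smul, smul_smul, smul_smul, ← neg_smul]
      congr 1
      obtain ⟨d, rfl⟩ : ∃ d, r = j + d := ⟨r - j, by omega⟩
      rw [Nat.add_sub_cancel_left, neg_pow θ, neg_pow θ]
      have : ((-1 : ℝ)) ^ (j + d + 1) * (-1) ^ d = - (-1) ^ j := by
        rw [← pow_add, show j + d + 1 + d = 2 * d + 1 + j by ring, pow_add, pow_add, pow_mul]
        simp
      have e2 : (-1 : ℝ) ^ (j + d + 1) * θ ^ (j + d + 1) * (1 / (((j + d : ℕ) : ℝ) + 1)) * (-1) ^ d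
        = ((-1 : ℝ) ^ (j + d + 1) * (-1) ^ d) * θ ^ (j + d + 1) * (1 / (((j + d : ℕ) : ℝ) + 1)) := by
        ring
      rw [e2, this]
      ring

end GFun

end MBFPieri

namespace MBFPieri

open MvPolynomial

/-- The rising factorial. -/
def poch (t : ℝ) (n : ℕ) : ℝ := ∏ j ∈ Finset.range n, (t + j)

theorem poch_zero (t : ℝ) : poch t 0 = 1 := by simp [poch]

theorem poch_succ (t : ℝ) (n : ℕ) : poch t (n + 1) = poch t n * (t + n) :=
  Finset.prod_range_succ _ _

theorem poch_pos {t : ℝ} (ht : 0 < t) (n : ℕ) : 0 < poch t n :=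
  Finset.prod_pos fun _ _ => by positivity

section GammaFun

variable {ι τ : Type*} [Fintype ι]

/-- The formal moment functional of independent Gamma variables. -/
def gammaFun (t : ι → ℝ) : MvPolynomial ι ℝ →ₗ[ℝ] ℝ :=
  (basisMonomials ι ℝ).constr ℝ fun m => ∏ i, poch (t i) (m i)

theorem gammaFun_monomial (t : ι → ℝ) (m : ι →₀ ℕ) :
    gammaFun t (monomial m 1) = ∏ i, poch (t i) (m i) := by
  have := (basisMonomials ι ℝ).constr_basis ℝ (fun m => ∏ i, poch (t i) (m i)) m
  rwa [coe_basisMonomials] at this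

theorem gammaFun_one (t : ι → ℝ) : gammaFun t 1 = 1 := by
  have := gammaFun_monomial t 0
  simpa [poch_zero] using this

theorem gammaFun_X_mul (t : ι → ℝ) (i : ι) (f : MvPolynomial ι ℝ) :
    gammaFun t (X i * f) = gammaFun t (t i • f + X i * pderiv i f) := by
  classical
  have : (gammaFun t).comp (LinearMap.mulLeft ℝ (X i)) = (gammaFun t).comp
      (t i • LinearMap.id + (LinearMap.mulLeft ℝ (X i)).comp (pderiv i).toLinearMap) := by
    refine (basisMonomials ι ℝ).ext fun m => ?_
    simp only [coe_basisMonomials, LinearMap.comp_apply, LinearMap.mulLeft_apply,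
      LinearMap.add_apply, LinearMap.smul_apply, LinearMap.id_apply,
      Derivation.coeFn_coe]
    rw [X_mul_pderiv_monomial, ← Nat.cast_smul_eq_nsmul ℝ, map_add, map_smul, map_smul,
      ← add_smul, gammaFun_monomial, X, monomial_mul, one_mul, gammaFun_monomial,
      ← Finset.mul_prod_erase _ _ (Finset.mem_univ i),
      ← Finset.mul_prod_erase Finset.univ (fun i => poch (t i) (m i)) (Finset.mem_univ i)]
    have : ∏ x ∈ Finset.univ.erase i, poch (t x) ((Finsupp.single i 1 + m : ι →₀ ℕ) x)
      = ∏ x ∈ Finset.univ.erase i, poch (t x) (m x) := by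
      refine Finset.prod_congr rfl fun x hx => ?_
      simp [(Finset.ne_of_mem_erase hx).symm]
    rw [this]
    simp only [Finsupp.add_apply, Finsupp.single_eq_same, smul_eq_mul]
    rw [add_comm 1 (m i), poch_succ]
    ring
  exact congrArg (fun G => G f) this

theorem liftFun_gammaFun_X_mul (t : ι → ℝ) (i : ι) (F : MvPolynomial (ι ⊕ τ) ℝ) :
    liftFun (gammaFun t) (X (Sum.inl i) * F)
      = liftFun (gammaFun t) (t i • F + X (Sum.inl i) * pderiv (Sum.inl i) F) := by
  have : (liftFun (gammaFun t)).comp (LinearMap.mulLeft ℝ (X (Sum.inl i)))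
      = (liftFun (τ := τ) (gammaFun t)).comp (t i • LinearMap.id +
        (LinearMap.mulLeft ℝ (X (Sum.inl i))).comp (pderiv (Sum.inl i)).toLinearMap) := by
    apply sum_linearMap_ext
    intro p q
    simp only [LinearMap.comp_apply, LinearMap.mulLeft_apply,
      LinearMap.add_apply, LinearMap.smul_apply, LinearMap.id_apply,
      Derivation.coeFn_coe]
    rw [pderiv_mul, pderiv_inl_rename_inr, mul_zero, add_zero, pderiv_rename Sum.inl_injective,
      ← mul_assoc, ← mul_assoc, ← rename_X (R := ℝ) Sum.inl i, ← map_mul, ← map_mul, map_add,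
      map_smul, liftFun_mul, liftFun_mul, liftFun_mul, gammaFun_X_mul, map_add, map_smul, add_smul,
      smul_assoc]
  exact congrArg (fun G => G F) this

end GammaFun

section Residue

variable {ι τ : Type*}

theorem pderiv_aeval_X {σ : Type*} [DecidableEq σ] (l k : σ) (P : Polynomial ℝ) :
    pderiv l (Polynomial.aeval (X k : MvPolynomial σ ℝ) P)
      = if k = l then Polynomial.aeval (X k) (Polynomial.derivative P) else 0 := by
  rw [Derivation.map_aeval, pderiv_X]
  split_ifs with h
  · subst h; simp
  · simp [h]

theorem tr_aeval_X {σ : Type*} [DecidableEq σ] (i j k : σ) (P : Polynomial ℝ) :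
    tr i j (Polynomial.aeval (X k : MvPolynomial σ ℝ) P)
      = Polynomial.aeval (X (Equiv.swap i j k)) P := by
  rw [← tr_X, Polynomial.aeval_algHom_apply]

/-- The value at `z_k` of a one-variable polynomial. -/
def atz (ι : Type*) {τ : Type*} (P : Polynomial ℝ) (k : τ) : MvPolynomial (ι ⊕ τ) ℝ :=
  Polynomial.aeval (X (Sum.inr k)) P

variable [Fintype ι] [DecidableEq ι] [DecidableEq τ]

/-- The generic residue sum `∑ w_i χ⁽ⁱ⁾(z_k)`. -/
def resL (χi : ι → Polynomial ℝ) (k : τ) : MvPolynomial (ι ⊕ τ) ℝ :=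
  ∑ i, X (Sum.inl i) * atz ι (χi i) k

theorem tr_atz (a b k : τ) (P : Polynomial ℝ) :
    tr (Sum.inr a) (Sum.inr b) (atz ι P k) = atz ι P (Equiv.swap a b k) := by
  rw [atz, tr_aeval_X, Sum.inr_injective.swap_apply]; rfl

theorem tr_resL (χi : ι → Polynomial ℝ) (a b k : τ) :
    tr (Sum.inr a) (Sum.inr b) (resL χi k) = resL χi (Equiv.swap a b k) := by
  rw [resL, map_sum]
  refine Finset.sum_congr rfl fun i _ => ?_
  rw [map_mul, tr_atz, tr_X, Equiv.swap_apply_of_ne_of_ne (by simp) (by simp)]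

theorem pderiv_inl_atz (i : ι) (P : Polynomial ℝ) (k : τ) :
    pderiv (Sum.inl i) (atz ι P k) = 0 := by
  rw [atz, pderiv_aeval_X, if_neg (by simp)]

theorem pderiv_inr_atz (l : τ) (P : Polynomial ℝ) (k : τ) :
    pderiv (Sum.inr l) (atz ι P k) = if k = l then atz ι (Polynomial.derivative P) k else 0 := by
  rw [atz, pderiv_aeval_X]; simp only [Sum.inr_injective.eq_iff]; rfl

theorem pderiv_inl_resL (χi : ι → Polynomial ℝ) (i : ι) (k : τ) :
    pderiv (Sum.inl i) (resL χi k) = atz ι (χi i) k := by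
  rw [resL, map_sum, Finset.sum_eq_single i]
  · rw [pderiv_mul, pderiv_inl_atz, pderiv_X_self]; ring
  · intro j _ hj
    rw [pderiv_mul, pderiv_inl_atz, pderiv_X_of_ne (by simpa using hj)]; ring
  · simp

theorem pderiv_inr_resL (χi : ι → Polynomial ℝ) {k l : τ} (h : k ≠ l) :
    pderiv (Sum.inr l) (resL χi k) = 0 := by
  rw [resL, map_sum]
  refine Finset.sum_eq_zero fun i _ => ?_
  rw [pderiv_mul, pderiv_inr_atz, if_neg h, pderiv_X_of_ne (by simp)]; ring

variable [Fintype τ]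

theorem tr_prod_resL (χi : ι → Polynomial ℝ) {a b : τ} {S : Finset τ} (ha : a ∉ S) (hb : b ∉ S) :
    tr (Sum.inr a) (Sum.inr b) (∏ k ∈ S, resL χi k) = ∏ k ∈ S, resL χi k := by
  rw [map_prod]
  refine Finset.prod_congr rfl fun k hk => ?_
  rw [tr_resL, Equiv.swap_apply_of_ne_of_ne (by rintro rfl; exact ha hk)
    (by rintro rfl; exact hb hk)]

theorem tr_prod_atz (P : Polynomial ℝ) {a b : τ} {S : Finset τ} (ha : a ∉ S) (hb : b ∉ S) :
    tr (Sum.inr a) (Sum.inr b) (∏ k ∈ S, atz ι P k) = ∏ k ∈ S, atz ι P k := by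
  rw [map_prod]
  refine Finset.prod_congr rfl fun k hk => ?_
  rw [tr_atz, Equiv.swap_apply_of_ne_of_ne (by rintro rfl; exact ha hk)
    (by rintro rfl; exact hb hk)]

/-- Data of a polynomial with its cofactors: `(z - η_i) χ⁽ⁱ⁾ = χ` and `χ' = ∑ m_i χ⁽ⁱ⁾`. -/
structure IsCofactor (χ : Polynomial ℝ) (χi : ι → Polynomial ℝ) (η m : ι → ℝ) : Prop where
  mul : ∀ i, (Polynomial.X - Polynomial.C (η i)) * χi i = χ
  der : Polynomial.derivative χ = ∑ i, m i • χi i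

variable {χ : Polynomial ℝ} {χi : ι → Polynomial ℝ} {η m : ι → ℝ}

theorem atz_mul (h : IsCofactor χ χi η m) (i : ι) (k : τ) :
    (X (Sum.inr k) - C (η i)) * atz ι (χi i) k = atz ι χ k := by
  rw [← h.mul i, atz, atz, map_mul]; simp [algebraMap_eq]

theorem resL_mul_sub (h : IsCofactor χ χi η m) (k l : τ) :
    (X (Sum.inr l) - X (Sum.inr k)) * ∑ i, X (Sum.inl i) * (atz ι (χi i) k * atz ι (χi i) l)
      = resL χi k * atz ι χ l - resL χi l * atz ι χ k := by
  rw [resL, resL, Finset.sum_mul, Finset.sum_mul, ← Finset.sum_sub_distrib, Finset.mul_sum]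
  refine Finset.sum_congr rfl fun i _ => ?_
  rw [← atz_mul h i k, ← atz_mul h i l]
  ring

theorem dunkl_resL_prod (h : IsCofactor χ χi η m) (c₁ : ι → ι → ℝ) (κ : ℝ) {S : Finset τ} {l : τ}
    (hl : l ∉ S) :
    dunkl (sumMult c₁ fun _ _ => κ) (Sum.inr l)
        ((∏ k ∈ S, resL χi k) * ∏ k ∈ Sᶜ, atz ι χ k)
      = ((∏ k ∈ S, resL χi k) * atz ι (Polynomial.derivative χ) l
        + κ • ∑ k ∈ S, (∑ i, X (Sum.inl i) * (atz ι (χi i) k * atz ι (χi i) l))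
          * ∏ k' ∈ S.erase k, resL χi k') * ∏ k ∈ Sᶜ.erase l, atz ι χ k := by
  have hlc : l ∈ Sᶜ := by simpa using hl
  rw [dunkl_inr_apply, ← Finset.smul_sum, add_mul, smul_mul_assoc, Finset.sum_mul]
  congr 1
  · rw [pderiv_mul, pderiv_prod, pderiv_prod]
    rw [Finset.sum_eq_zero, zero_mul, zero_add, Finset.sum_eq_single l]
    · rw [pderiv_inr_atz, if_pos rfl]; ring
    · intro b _ hb; rw [pderiv_inr_atz, if_neg hb, mul_zero]
    · intro h; exact absurd hlc h
    · intro k hk; rw [pderiv_inr_resL, mul_zero]; rintro rfl; exact hl hk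
  · congr 1
    rw [← Finset.sum_subset (Finset.subset_univ S)]
    · refine Finset.sum_congr rfl fun k hk => ?_
      have hkl : k ≠ l := by rintro rfl; exact hl hk
      apply dd_unique (Sum.inr_injective.ne hkl.symm)
      rw [← Finset.mul_prod_erase S _ hk, ← Finset.mul_prod_erase Sᶜ _ hlc]
      simp only [map_mul]
      rw [tr_prod_resL _ (by simp [hl]) (by simp), tr_prod_atz _ (by simp) (by simp [hk]),
        tr_resL, tr_atz, Equiv.swap_apply_right, Equiv.swap_apply_left]
      linear_combination (∏ k ∈ S.erase k, resL χi k) * (∏ k ∈ Sᶜ.erase l, atz ι χ k)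
        * resL_mul_sub h k l
    · intro k _ hk
      apply dd_eq_zero
      rw [map_mul, tr_prod_resL _ hl hk, map_prod]
      congr 1
      simp only [tr_atz]
      refine Finset.prod_equiv (Equiv.swap l k) ?_ (fun _ _ => rfl)
      intro j
      simp only [Finset.mem_compl, not_iff_not]
      rcases eq_or_ne j l with rfl | h1
      · simp [hl, hk]
      rcases eq_or_ne j k with rfl | h2
      · simp [hl, hk]
      · rw [Equiv.swap_apply_of_ne_of_ne h1 h2]

theorem liftFun_resL_prod (h : IsCofactor χ χi η m) (θ : ℝ) {S : Finset τ} {l : τ} :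
    liftFun (gammaFun fun i => m i * θ)
        (resL χi l * ((∏ k ∈ S, resL χi k) * ∏ k ∈ Sᶜ.erase l, atz ι χ k))
      = liftFun (gammaFun fun i => m i * θ)
      ((θ • ((∏ k ∈ S, resL χi k) * atz ι (Polynomial.derivative χ) l)
        + ∑ k ∈ S, (∑ i, X (Sum.inl i) * (atz ι (χi i) k * atz ι (χi i) l))
          * ∏ k' ∈ S.erase k, resL χi k') * ∏ k ∈ Sᶜ.erase l, atz ι χ k) := by
  set G := ∏ k ∈ S, resL χi k with hG
  set P := ∏ k ∈ Sᶜ.erase l, atz ι χ k with hP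
  have hPd : ∀ i, pderiv (Sum.inl i) P = 0 := by
    intro i; rw [hP, pderiv_prod]; simp [pderiv_inl_atz]
  have hGd : ∀ i, pderiv (Sum.inl i) G
      = ∑ k ∈ S, (∏ k' ∈ S.erase k, resL χi k') * atz ι (χi i) k := by
    intro i; rw [hG, pderiv_prod]; simp only [pderiv_inl_resL]
  have h1 : resL χi l * (G * P) = ∑ i, X (Sum.inl i) * (atz ι (χi i) l * (G * P)) := by
    rw [resL, Finset.sum_mul]; exact Finset.sum_congr rfl fun i _ => by ring
  have hder : atz ι (τ := τ) (Polynomial.derivative χ) l = ∑ i, m i • atz ι (χi i) l := by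
    rw [h.der, atz, map_sum]; simp only [map_smul]; rfl
  rw [h1, map_sum]
  simp only [liftFun_gammaFun_X_mul]
  rw [← map_sum]
  congr 1
  rw [Finset.sum_add_distrib, add_mul]
  congr 1
  · rw [hder, Finset.mul_sum, Finset.smul_sum, Finset.sum_mul]
    refine Finset.sum_congr rfl fun i _ => ?_
    simp only [smul_eq_C_mul, C_mul]
    ring
  · simp only [pderiv_mul, pderiv_inl_atz, hPd, hGd, zero_mul, mul_zero, zero_add, add_zero]
    simp only [Finset.sum_mul, Finset.mul_sum]
    rw [Finset.sum_comm]
    refine Finset.sum_congr rfl fun k _ => Finset.sum_congr rfl fun i _ => ?_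
    ring

theorem dunklHom_prod_X_aeval (h : IsCofactor χ χi η m) {θ : ℝ} (hθ : θ ≠ 0) (S : Finset τ) :
    dunklHom (isMult_const θ⁻¹) (∏ k ∈ S, X k) (∏ k : τ, Polynomial.aeval (X k) χ)
      = θ⁻¹ ^ S.card • liftFun (gammaFun fun i => m i * θ)
        ((∏ k ∈ S, resL χi k) * ∏ k ∈ Sᶜ, atz ι χ k) := by
  induction S using Finset.induction_on with
  | empty =>
    have : (∏ k, atz ι χ k) = rename (Sum.inr : τ → ι ⊕ τ) (∏ k : τ, Polynomial.aeval (X k) χ) := by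
      rw [map_prod]
      refine Finset.prod_congr rfl fun k _ => ?_
      rw [atz, ← Polynomial.aeval_algHom_apply, rename_X]
    have h2 := liftFun_mul (gammaFun fun i => m i * θ) 1 (∏ k : τ, Polynomial.aeval (X k) χ)
    rw [map_one] at h2
    simp only [Finset.prod_empty, Finset.compl_empty, Finset.card_empty, pow_zero, one_smul, this,
      h2, gammaFun_one, map_one]
    rfl
  | insert l S hl ih =>
    rw [Finset.prod_insert hl, dunklHom_mul, ih, dunklHom_X, map_smul,
      ← liftFun_dunkl (c₁ := fun _ _ => θ), dunkl_resL_prod h _ _ hl, Finset.card_insert_of_notMem hl,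
      Finset.prod_insert hl, Finset.compl_insert, mul_assoc, liftFun_resL_prod h, pow_succ,
      ← smul_smul, ← map_smul (liftFun _) θ⁻¹, ← smul_mul_assoc θ⁻¹, smul_add θ⁻¹, smul_smul θ⁻¹ θ,
      inv_mul_cancel₀ hθ, one_smul]

theorem eval_dunklHom_prod_X_aeval (h : IsCofactor χ χi η m) {θ : ℝ} (hθ : θ ≠ 0) (S : Finset τ)
    (ζ : τ → ℝ) :
    eval ζ (dunklHom (isMult_const θ⁻¹) (∏ k ∈ S, X k) (∏ k : τ, Polynomial.aeval (X k) χ))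
      = θ⁻¹ ^ S.card * ((∏ k ∈ Sᶜ, χ.eval (ζ k)) * gammaFun (fun i => m i * θ)
        (∏ k ∈ S, ∑ i, C ((χi i).eval (ζ k)) * X i)) := by
  have e : ∀ (P : Polynomial ℝ) (k : τ), evalInr ζ (atz ι P k) = C (P.eval (ζ k)) := by
    intro P k
    rw [atz, ← Polynomial.aeval_algHom_apply, evalInr, aeval_X, Sum.elim_inr]
    have : (C (ζ k) : MvPolynomial ι ℝ) = algebraMap ℝ _ (ζ k) := rfl
    rw [this, Polynomial.aeval_algebraMap_apply, Polynomial.coe_aeval_eq_eval]; rfl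
  have e2 : ∀ k : τ, evalInr ζ (resL χi k) = ∑ i, C ((χi i).eval (ζ k)) * X i := by
    intro k
    rw [resL, map_sum]
    refine Finset.sum_congr rfl fun i _ => ?_
    rw [map_mul, e, evalInr, aeval_X, mul_comm]; rfl
  rw [dunklHom_prod_X_aeval h hθ, smul_eval, eval_liftFun, map_mul, map_prod, map_prod]
  simp only [e, e2]
  rw [← map_prod, mul_comm (∏ k ∈ S, _), ← smul_eq_C_mul, map_smul, smul_eq_mul]

end Residue

end MBFPieri

namespace MBFPieri

open MvPolynomial

section Span

variable {σ : Type*} [Fintype σ]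

theorem symm_mem_adjoin {s : Set (MvPolynomial σ ℝ)}
    (hs : ∀ r, esymm σ ℝ (r + 1) ∈ Algebra.adjoin ℝ s) {f : MvPolynomial σ ℝ}
    (hf : f.IsSymmetric) : f ∈ Algebra.adjoin ℝ s := by
  obtain ⟨p, hp⟩ := esymmAlgHom_surjective (σ := σ) ℝ le_rfl ⟨f, hf⟩
  have h2 := esymmAlgHom_apply (σ := σ) (R := ℝ) p
  rw [hp] at h2
  change f = _ at h2
  rw [h2, aeval_def, eval₂_eq]
  refine Subalgebra.sum_mem _ fun d _ => Subalgebra.mul_mem _ (Subalgebra.algebraMap_mem _ _)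
    (Subalgebra.prod_mem _ fun i _ => Subalgebra.pow_mem _ (hs i) _)

/-- Power sums generate the symmetric polynomials. -/
theorem symm_mem_adjoin_psum {f : MvPolynomial σ ℝ} (hf : f.IsSymmetric) :
    f ∈ Algebra.adjoin ℝ (Set.range fun r => psum σ ℝ (r + 1)) := by
  have key : ∀ r, esymm σ ℝ r ∈ Algebra.adjoin ℝ (Set.range fun r => psum σ ℝ (r + 1)) := by
    intro r
    induction r using Nat.strong_induction_on with
    | _ r ih =>
      rcases r with _ | r
      · rw [esymm_zero]; exact Subalgebra.one_mem _
      · rw [esymm_succ]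
        refine Subalgebra.smul_mem _ (Subalgebra.sum_mem _ fun j hj => Subalgebra.smul_mem _
          (Subalgebra.mul_mem _ (Algebra.subset_adjoin (Set.mem_range_self (r - j))) (ih j ?_)) _) _
        simpa using hj
  exact symm_mem_adjoin (fun r => key _) hf

/-- The product `∏ (ζ_k - x_i)`. -/
def phi (σ : Type*) [Fintype σ] {K : ℕ} (ζ : Fin K → ℝ) : MvPolynomial σ ℝ :=
  ∏ k, ∏ i, (C (ζ k) - X i)

theorem esymm_mem_adjoin_phi (r : ℕ) :
    esymm σ ℝ r ∈ Algebra.adjoin ℝ (Set.range fun t : ℝ => ∏ i : σ, (C t - X i)) := by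
  rcases lt_or_ge (Fintype.card σ) r with h | h
  · have : esymm σ ℝ r = 0 := by
      rw [esymm, Finset.powersetCard_eq_empty.2 (by simpa using h), Finset.sum_empty]
    rw [this]; exact Subalgebra.zero_mem _
  by_contra hc
  obtain ⟨φ, h1, h2⟩ := Submodule.exists_le_ker_of_notMem
    (p := Subalgebra.toSubmodule (Algebra.adjoin ℝ (Set.range fun t : ℝ => ∏ i : σ, (C t - X i))))
    (v := esymm σ ℝ r) hc
  apply h1
  let P : Polynomial ℝ := ∑ j ∈ Finset.range (Fintype.card σ + 1),
    Polynomial.C (φ (esymm σ ℝ j)) * Polynomial.X ^ (Fintype.card σ - j)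
  have hP : P = 0 := by
    apply Polynomial.funext
    intro t
    have h3 := congrArg (Polynomial.eval (C t)) (prod_C_add_X_eq_sum_esymm ℝ σ)
    rw [Polynomial.eval_prod, Polynomial.eval_finsetSum] at h3
    simp only [Polynomial.eval_add, Polynomial.eval_X, Polynomial.eval_C, Polynomial.eval_mul,
      Polynomial.eval_pow] at h3
    have h4 : ∏ i : σ, (C t + X i : MvPolynomial σ ℝ)
        = (-1 : ℝ) ^ (Fintype.card σ) • ∏ i : σ, (C (-t) - X i) := by
      rw [← Finset.card_univ, ← Finset.prod_const, ← Finset.prod_smul]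
      refine Finset.prod_congr rfl fun i _ => ?_
      simp [add_comm]
    have h5 : φ (∏ i : σ, (C t + X i : MvPolynomial σ ℝ)) = 0 := by
      rw [h4, map_smul]
      have : (∏ i : σ, (C (-t) - X i : MvPolynomial σ ℝ)) ∈ LinearMap.ker φ :=
        h2 (Algebra.subset_adjoin ⟨-t, rfl⟩)
      rw [LinearMap.mem_ker.1 this, smul_zero]
    rw [h3, map_sum] at h5
    rw [Polynomial.eval_zero, ← h5, Polynomial.eval_finsetSum]
    refine Finset.sum_congr rfl fun j _ => ?_
    rw [← C_pow, mul_comm (esymm σ ℝ j), ← smul_eq_C_mul, map_smul]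
    rw [Polynomial.eval_mul, Polynomial.eval_C, Polynomial.eval_pow, Polynomial.eval_X, smul_eq_mul,
      mul_comm]
  have h6 := congrArg (fun Q => Polynomial.coeff Q (Fintype.card σ - r)) hP
  simp only [P, Polynomial.finsetSum_coeff, Polynomial.coeff_C_mul_X_pow,
    Polynomial.coeff_zero] at h6
  rw [Finset.sum_eq_single r] at h6
  · simpa using h6
  · intro b hb hbr
    have : b < Fintype.card σ + 1 := by simpa using hb
    rw [if_neg (by omega)]
  · intro hr; simp at hr; omega

/-- Symmetric polynomials are spanned by the products `phi`. -/
theorem symm_induction {P : MvPolynomial σ ℝ → Prop} (hadd : ∀ f g, P f → P g → P (f + g))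
    (hsmul : ∀ (c : ℝ) f, P f → P (c • f)) (hphi : ∀ K (ζ : Fin K → ℝ), P (phi σ ζ))
    {f : MvPolynomial σ ℝ} (hf : f.IsSymmetric) : P f := by
  have h1 := symm_mem_adjoin (fun r => esymm_mem_adjoin_phi (r + 1)) hf
  rw [← Subalgebra.mem_toSubmodule, Algebra.adjoin_eq_span] at h1
  refine Submodule.span_induction (p := fun x _ => P x) ?_ ?_ (fun x y _ _ => hadd x y)
    (fun c x _ => hsmul c x) h1
  · intro x hx
    have : ∃ K, ∃ ζ : Fin K → ℝ, x = phi σ ζ := by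
      refine Submonoid.closure_induction (motive := fun x _ => ∃ K, ∃ ζ : Fin K → ℝ, x = phi σ ζ)
        ?_ ?_ ?_ hx
      · rintro _ ⟨t, rfl⟩
        exact ⟨1, fun _ => t, by simp [phi]⟩
      · exact ⟨0, Fin.elim0, by simp [phi]⟩
      · rintro _ _ _ _ ⟨K, ζ, rfl⟩ ⟨L, ξ, rfl⟩
        exact ⟨K + L, Fin.append ζ ξ, by simp [phi, Fin.prod_univ_add]⟩
    obtain ⟨K, ζ, rfl⟩ := this
    exact hphi K ζ
  · have := hsmul 0 _ (hphi 0 Fin.elim0)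
    rwa [zero_smul] at this

variable [DecidableEq σ]

theorem evalInr_kerP {K : ℕ} (ζ : Fin K → ℝ) :
    evalInr ζ (kerP (Finset.univ : Finset (σ × Fin K))) = phi σ ζ := by
  rw [kerP, map_prod, ← Finset.univ_product_univ, Finset.prod_product_right, phi]
  refine Finset.prod_congr rfl fun k _ => Finset.prod_congr rfl fun i _ => ?_
  simp [lf, evalInr]

/-- The monic polynomial with given roots. -/
def chi {σ : Type*} [Fintype σ] (a : σ → ℝ) : Polynomial ℝ :=
  ∏ i, (Polynomial.X - Polynomial.C (a i))

theorem eval_chi (a : σ → ℝ) (x : ℝ) : (chi a).eval x = ∏ i, (x - a i) := by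
  simp [chi, Polynomial.eval_prod]

theorem eval_phi {K : ℕ} (ζ : Fin K → ℝ) (a : σ → ℝ) :
    eval a (phi σ ζ) = ∏ k, (chi a).eval (ζ k) := by
  simp [phi, eval_chi]

/-- Evaluation as a linear functional. -/
def evalL (a : σ → ℝ) : MvPolynomial σ ℝ →ₗ[ℝ] ℝ := (aeval a).toLinearMap

theorem evalL_apply (a : σ → ℝ) (f : MvPolynomial σ ℝ) : evalL a f = eval a f := by
  simp [evalL, aeval_eq_eval]

theorem liftFun_evalL_kerP {K : ℕ} (a : σ → ℝ) :
    liftFun (evalL a) (kerP (Finset.univ : Finset (σ × Fin K)))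
      = ∏ k, Polynomial.aeval (X k) (chi a) := by
  apply MvPolynomial.funext
  intro ζ
  rw [eval_liftFun, evalInr_kerP, evalL_apply, eval_phi, map_prod]
  refine Finset.prod_congr rfl fun k _ => ?_
  rw [← aeval_eq_eval, ← Polynomial.aeval_algHom_apply]
  simp [Polynomial.coe_aeval_eq_eval]

/-- Dunkl operators in the second group of variables, evaluated at a point. -/
theorem eval_evalInr_dunklHom {K : ℕ} (θ : ℝ) (a : σ → ℝ) (ζ : Fin K → ℝ)
    (p : MvPolynomial (Fin K) ℝ) :
    eval a (evalInr ζ (dunklHom (isMult_dualMult θ) (rename Sum.inr p)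
        (kerP (Finset.univ : Finset (σ × Fin K)))))
      = eval ζ (dunklHom (isMult_const θ⁻¹) p (∏ k, Polynomial.aeval (X k) (chi a))) := by
  rw [← evalL_apply, ← eval_liftFun, ← liftFun_evalL_kerP]
  exact congrArg (eval ζ) (liftFun_dunklHom (isMult_const θ) (isMult_const θ⁻¹) _ _ _)

/-- The cofactors of the polynomial with distinct roots. -/
def chiC (a : σ → ℝ) (i : σ) : Polynomial ℝ :=
  ∏ j ∈ Finset.univ.erase i, (Polynomial.X - Polynomial.C (a j))

theorem isCofactor_chi (a : σ → ℝ) : IsCofactor (chi a) (chiC a) a fun _ => 1 where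
  mul i := Finset.mul_prod_erase _ _ (Finset.mem_univ i)
  der := by
    rw [chi, Polynomial.derivative_prod_finset]
    simp [chiC]

end Span

end MBFPieri

namespace MBFPieri

open MvPolynomial

section Corner

variable {σ ρ : Type*} [Fintype σ] [DecidableEq σ] [Fintype ρ] [DecidableEq ρ]

theorem chi_comp (a : σ → ℝ) (e : Equiv.Perm σ) : chi (a ∘ e) = chi a :=
  Equiv.prod_comp e fun i => Polynomial.X - Polynomial.C (a i)

theorem isSymmetric_of_eval {f : MvPolynomial σ ℝ}
    (h : ∀ (a : σ → ℝ) (e : Equiv.Perm σ), eval (a ∘ e) f = eval a f) : f.IsSymmetric := by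
  intro e
  apply MvPolynomial.funext
  intro a
  rw [eval_rename]
  exact h a e

/-- The functional `φ` integrates the products `phi` like the corners of a matrix with
eigenvalues `a`. -/
def CornerAt (θ : ℝ) (a : σ → ℝ) (φ : MvPolynomial ρ ℝ →ₗ[ℝ] ℝ) : Prop :=
  ∀ K (ζ : Fin K → ℝ), φ (phi ρ ζ) = gammaFun (fun _ : σ => 1 * θ)
    (∏ k, ∑ i, C ((chiC a i).eval (ζ k)) * X i) / poch (Fintype.card σ * θ) K

/-- The image of `phi` under the corner operator. -/
def cornerPhi (σ : Type*) [Fintype σ] [DecidableEq σ] (θ : ℝ) {K : ℕ} (ζ : Fin K → ℝ) :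
    MvPolynomial σ ℝ :=
  (θ ^ K / poch (Fintype.card σ * θ) K) •
    evalInr ζ (dunklHom (isMult_dualMult θ) (rename Sum.inr (∏ k : Fin K, X k)) (kerP Finset.univ))

theorem cornerPhi_isSymmetric (θ : ℝ) {K : ℕ} (ζ : Fin K → ℝ) :
    (cornerPhi σ θ ζ).IsSymmetric := by
  apply isSymmetric_of_eval
  intro a e
  rw [cornerPhi, smul_eval, smul_eval, eval_evalInr_dunklHom, eval_evalInr_dunklHom, chi_comp]

variable {θ : ℝ} {a : σ → ℝ} {φ : MvPolynomial ρ ℝ →ₗ[ℝ] ℝ}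

theorem eval_cornerPhi (hθ : θ ≠ 0) (h : CornerAt θ a φ) {K : ℕ} (ζ : Fin K → ℝ) :
    eval a (cornerPhi σ θ ζ) = φ (phi ρ ζ) := by
  rw [cornerPhi, smul_eval, eval_evalInr_dunklHom,
    eval_dunklHom_prod_X_aeval (isCofactor_chi a) hθ, h]
  simp only [Finset.compl_univ, Finset.prod_empty, one_mul, Finset.card_univ, Fintype.card_fin]
  rw [inv_pow]
  field_simp

theorem liftFun_corner (hθ : θ ≠ 0) (h : CornerAt θ a φ) (K : ℕ) :
    liftFun φ (kerP (Finset.univ : Finset (ρ × Fin K)))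
      = (θ ^ K / poch (Fintype.card σ * θ) K) • dunklHom (isMult_const θ⁻¹) (∏ k : Fin K, X k)
        (∏ k, Polynomial.aeval (X k) (chi a)) := by
  apply MvPolynomial.funext
  intro ζ
  rw [eval_liftFun, evalInr_kerP, ← eval_cornerPhi hθ h, cornerPhi, smul_eval,
    eval_evalInr_dunklHom, smul_eval]

theorem eval_psum_cornerPhi (hθ : θ ≠ 0) (h : CornerAt θ a φ) {K : ℕ} (ζ : Fin K → ℝ) (r : ℕ) :
    eval a (dunklHom (isMult_const θ) (psum σ ℝ (r + 1)) (cornerPhi σ θ ζ))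
      = φ (dunklHom (isMult_const θ) (psum ρ ℝ (r + 1)) (phi ρ ζ)) := by
  have e1 : dunklHom (isMult_const θ) (psum ρ ℝ (r + 1)) (phi ρ ζ)
      = - (θ ^ r • evalInr ζ (dunklHom (isMult_dualMult θ) (rename Sum.inr (psum (Fin K) ℝ (r + 1)))
        (kerP Finset.univ))) := by
    rw [← evalInr_kerP, ← evalInr_dunklHom (isMult_const θ) (isMult_const θ⁻¹), ← map_smul, ← map_neg]
    exact congrArg (evalInr ζ) (dunklHom_psum_inl_kerP hθ r)
  have e2 : dunklHom (isMult_const θ) (psum σ ℝ (r + 1)) (cornerPhi σ θ ζ)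
      = (θ ^ K / poch (Fintype.card σ * θ) K) • - (θ ^ r • evalInr ζ (dunklHom (isMult_dualMult θ)
        (rename Sum.inr (psum (Fin K) ℝ (r + 1) * ∏ k : Fin K, X k)) (kerP Finset.univ))) := by
    rw [cornerPhi, map_smul, ← evalInr_dunklHom (isMult_const θ) (isMult_const θ⁻¹),
      ← map_smul (evalInr ζ) (θ ^ r), ← map_neg]
    refine congrArg (fun F => (θ ^ K / poch (Fintype.card σ * θ) K) • evalInr ζ F) ?_
    refine (dunklHom_comm (isMult_dualMult θ) _ _ _).trans ?_
    rw [dunklHom_psum_inl_kerP hθ r, map_neg, map_smul, mul_comm (psum _ _ _), map_mul, dunklHom_mul]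
  rw [e1, e2, smul_eval, map_neg, smul_eval, eval_evalInr_dunklHom, map_neg, map_smul,
    ← eval_liftFun]
  erw [liftFun_dunklHom (isMult_const θ) (isMult_const θ⁻¹)]
  rw [liftFun_corner hθ h, map_smul, smul_eval, dunklHom_mul, smul_eq_mul]
  ring

theorem exists_corner (hθ : θ ≠ 0) {ι : Type*} (A : ι → σ → ℝ) (E : ι → MvPolynomial ρ ℝ →ₗ[ℝ] ℝ)
    (h : ∀ t, CornerAt θ (A t) (E t)) {f : MvPolynomial ρ ℝ} (hf : f.IsSymmetric) :
    ∃ g : MvPolynomial σ ℝ, g.IsSymmetric ∧ (∀ t, eval (A t) g = E t f) ∧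
      ∀ r t, eval (A t) (dunklHom (isMult_const θ) (psum σ ℝ (r + 1)) g)
        = E t (dunklHom (isMult_const θ) (psum ρ ℝ (r + 1)) f) := by
  refine symm_induction (P := fun f => ∃ g : MvPolynomial σ ℝ, g.IsSymmetric ∧
      (∀ t, eval (A t) g = E t f) ∧
      ∀ r t, eval (A t) (dunklHom (isMult_const θ) (psum σ ℝ (r + 1)) g)
        = E t (dunklHom (isMult_const θ) (psum ρ ℝ (r + 1)) f)) ?_ ?_ ?_ hf
  · rintro f g ⟨F, h1, h2, h3⟩ ⟨G, k1, k2, k3⟩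
    exact ⟨F + G, h1.add k1, by simp [h2, k2], by simp [h3, k3]⟩
  · rintro c f ⟨F, h1, h2, h3⟩
    refine ⟨c • F, h1.smul c, by simp [h2], by simp [h3]⟩
  · intro K ζ
    exact ⟨cornerPhi σ θ ζ, cornerPhi_isSymmetric θ ζ, fun t => eval_cornerPhi hθ (h t) ζ,
      fun r t => eval_psum_cornerPhi hθ (h t) ζ r⟩

/-- Rescaling of the variables. -/
def scale (c : ℝ) : MvPolynomial σ ℝ →ₐ[ℝ] MvPolynomial σ ℝ := aeval fun i => C c * X i

theorem eval_scale (c : ℝ) (f : MvPolynomial σ ℝ) (a : σ → ℝ) :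
    eval a (scale c f) = eval (fun i => c * a i) f := by
  have : (aeval a).comp (scale c) = aeval (fun i => c * a i) := by
    apply MvPolynomial.algHom_ext
    intro i
    simp [scale]
  have := congrArg (fun F => F f) this
  simpa [aeval_eq_eval] using this

theorem scale_monomial (c : ℝ) (m : σ →₀ ℕ) (x : ℝ) :
    scale c (monomial m x) = c ^ m.degree • monomial m x := by
  apply MvPolynomial.funext
  intro a
  rw [eval_scale, smul_eval, eval_monomial, eval_monomial]
  simp only [mul_pow, Finsupp.prod, Finset.prod_mul_distrib, Finset.prod_pow_eq_pow_sum,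
    Finsupp.degree_apply]
  ring

theorem coeff_scale (c : ℝ) (f : MvPolynomial σ ℝ) (m : σ →₀ ℕ) :
    coeff m (scale c f) = c ^ m.degree * coeff m f := by
  induction f using MvPolynomial.induction_on' with
  | monomial u x =>
    rw [scale_monomial, coeff_smul, coeff_monomial]
    split_ifs with h
    · rw [h, smul_eq_mul]
    · simp
  | add p q hp hq => rw [map_add, coeff_add, coeff_add, hp, hq, mul_add]

theorem scale_of_isHomogeneous (c : ℝ) {f : MvPolynomial σ ℝ} {k : ℕ} (hf : f.IsHomogeneous k) :
    scale c f = c ^ k • f := by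
  ext m
  rw [coeff_scale, coeff_smul, smul_eq_mul]
  by_cases h : coeff m f = 0
  · simp [h]
  · have := hf h
    rw [← this, Finsupp.degree_eq_weight_one]
    rfl

theorem isHomogeneous_of_scale {f : MvPolynomial σ ℝ} {k : ℕ} (hf : scale 2 f = (2 : ℝ) ^ k • f) :
    f.IsHomogeneous k := by
  intro m hm
  have := congrArg (coeff m) hf
  rw [coeff_scale, coeff_smul, smul_eq_mul] at this
  have h2 := mul_right_cancel₀ hm this
  have h3 := pow_right_injective₀ (a := (2 : ℝ)) (by norm_num) (by norm_num) h2
  rw [← h3, Finsupp.degree_eq_weight_one]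
  rfl

theorem corner_scale {b : σ → ℝ} {ψ : MvPolynomial ρ ℝ →ₗ[ℝ] ℝ} {c : ℝ} (hc : c ≠ 0)
    (hcard : Fintype.card σ = Fintype.card ρ + 1) (h : CornerAt θ a φ) (hb : b = fun i => c * a i)
    (h' : CornerAt θ b ψ) {f : MvPolynomial ρ ℝ} (hf : f.IsSymmetric) : ψ f = φ (scale c f) := by
  refine symm_induction (P := fun f => ψ f = φ (scale c f)) ?_ ?_ ?_ hf
  · intro f g h1 h2; simp [h1, h2]
  · intro x f h1; simp [h1]
  · intro K ζ
    have h1 : scale c (phi ρ ζ) = ((c ^ Fintype.card ρ) ^ K) • phi ρ (fun k => ζ k / c) := by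
      apply MvPolynomial.funext
      intro x
      rw [eval_scale, smul_eval, eval_phi, eval_phi]
      simp only [eval_chi]
      have : ∀ k i, ζ k - c * x i = c * (ζ k / c - x i) := by intro k i; field_simp
      simp only [this, Finset.prod_mul_distrib, Finset.prod_const, Finset.card_univ,
        Fintype.card_fin]
    have h2 : ∀ k i, (chiC b i).eval (ζ k) = c ^ Fintype.card ρ * (chiC a i).eval (ζ k / c) := by
      intro k i
      simp only [chiC, Polynomial.eval_prod, Polynomial.eval_sub, Polynomial.eval_X,
        Polynomial.eval_C, hb]
      have : ∀ i, ζ k - c * a i = c * (ζ k / c - a i) := by intro i; field_simp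
      simp only [this, Finset.prod_mul_distrib, Finset.prod_const]
      rw [Finset.card_erase_of_mem (Finset.mem_univ i), Finset.card_univ, hcard,
        Nat.add_sub_cancel]
    rw [h1, map_smul, h, h', smul_eq_mul, ← mul_div_assoc]
    congr 1
    refine Eq.trans ?_ (map_smul (gammaFun fun _ : σ => 1 * θ) ((c ^ Fintype.card ρ) ^ K) _)
    congr 1
    simp only [h2, C_mul, mul_assoc, ← Finset.mul_sum, Finset.prod_mul_distrib, Finset.prod_const,
      Finset.card_univ, Fintype.card_fin]
    rw [smul_eq_C_mul]; simp only [C_pow]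

end Corner

end MBFPieri

namespace MBFPieri

open MvPolynomial

section QOperator

variable {σ ι : Type*} [Fintype σ] [DecidableEq σ] [Fintype ι] [DecidableEq ι]

theorem eval_gPol_phi {θ : ℝ} (hθ : θ ≠ 0) (Y : σ → ℝ) {χi : ι → Polynomial ℝ} {η m : ι → ℝ}
    (h : IsCofactor (chi Y) χi η m) {K : ℕ} (ζ : Fin K → ℝ) (r : ℕ) :
    eval Y (dunklHom (isMult_const θ) (gPol σ θ r) (phi σ ζ))
      = (-1) ^ r * ∑ S ∈ Finset.powersetCard r (Finset.univ : Finset (Fin K)),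
        (∏ k ∈ Sᶜ, (chi Y).eval (ζ k)) * gammaFun (fun i => m i * θ)
          (∏ k ∈ S, ∑ i, C ((χi i).eval (ζ k)) * X i) := by
  rw [← evalInr_kerP, ← evalInr_dunklHom (isMult_const θ) (isMult_const θ⁻¹)]
  have := dunklHom_gPol_inl_kerP (σ := σ) (τ := Fin K) hθ r
  rw [show dunklHom ((isMult_const θ).sumMult (isMult_const θ⁻¹)) (rename Sum.inl (gPol σ θ r))
    (kerP (Finset.univ : Finset (σ × Fin K))) = _ from this, map_smul, smul_eval,
    eval_evalInr_dunklHom, esymm, map_sum, LinearMap.sum_apply, map_sum, Finset.mul_sum,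
    Finset.mul_sum]
  refine Finset.sum_congr rfl fun S hS => ?_
  rw [eval_dunklHom_prod_X_aeval h hθ, (Finset.mem_powersetCard.1 hS).2, neg_pow, inv_pow]
  generalize gammaFun (fun i => m i * θ) _ = G
  field_simp

theorem expectation_eq_sum_gPol {θ : ℝ} (hθ : θ ≠ 0) (Y : σ → ℝ) {χi : ι → Polynomial ℝ}
    {η m : ι → ℝ} (h : IsCofactor (chi Y) χi η m) (T y : ℝ) (E : MvPolynomial σ ℝ →ₗ[ℝ] ℝ)
    (hE : ∀ K (ζ : Fin K → ℝ), E (phi σ ζ) = ∑ S : Finset (Fin K), (-y) ^ S.card *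
      ((∏ k ∈ Sᶜ, (chi Y).eval (ζ k)) * gammaFun (fun i => m i * θ)
          (∏ k ∈ S, ∑ i, C ((χi i).eval (ζ k)) * X i)) / poch T S.card)
    {f : MvPolynomial σ ℝ} (hf : f.IsSymmetric) :
    ∃ R₀, ∀ R ≥ R₀, E f = ∑ r ∈ Finset.range R,
      y ^ r / poch T r * eval Y (dunklHom (isMult_const θ) (gPol σ θ r) f) := by
  refine symm_induction (P := fun f => ∃ R₀, ∀ R ≥ R₀, E f = ∑ r ∈ Finset.range R,
      y ^ r / poch T r * eval Y (dunklHom (isMult_const θ) (gPol σ θ r) f)) ?_ ?_ ?_ hf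
  · rintro f g ⟨R, hR⟩ ⟨S, hS⟩
    refine ⟨max R S, fun T hT => ?_⟩
    rw [map_add, hR T (le_of_max_le_left hT), hS T (le_of_max_le_right hT),
      ← Finset.sum_add_distrib]
    simp only [map_add, mul_add]
  · rintro c f ⟨R, hR⟩
    refine ⟨R, fun T hT => ?_⟩
    rw [map_smul, hR T hT, smul_eq_mul, Finset.mul_sum]
    refine Finset.sum_congr rfl fun r _ => ?_
    rw [map_smul, smul_eval]; ring
  · intro K ζ
    refine ⟨K + 1, fun R hR => ?_⟩
    rw [hE, ← Finset.powerset_univ, Finset.sum_powerset, Finset.card_univ, Fintype.card_fin]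
    rw [Finset.sum_subset (Finset.range_subset_range.2 hR)]
    · refine Finset.sum_congr rfl fun r _ => ?_
      rw [eval_gPol_phi hθ Y h, Finset.mul_sum, Finset.mul_sum]
      refine Finset.sum_congr rfl fun S hS => ?_
      rw [(Finset.mem_powersetCard.1 hS).2, neg_pow]
      ring
    · intro r _ hr
      rw [Finset.powersetCard_eq_empty.2 (by simpa using hr), Finset.sum_empty]

end QOperator

end MBFPieri

namespace MBFPieri

open MvPolynomial

section CommEval

variable {σ V : Type*} [Fintype σ] [DecidableEq σ] [AddCommGroup V] [Module ℝ V]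

theorem commute_commEval {A : Type*} [Ring A] [Algebra ℝ A] {E : σ → A} {d : A}
    (hE : ∀ i j, E i * E j = E j * E i) (hd : ∀ j, Commute d (E j)) (q : MvPolynomial σ ℝ) :
    Commute d (commEval E hE q) := by
  induction q using MvPolynomial.induction_on with
  | C a =>
    rw [show (C a : MvPolynomial σ ℝ) = algebraMap ℝ _ a from rfl, AlgHom.commutes]
    exact (Algebra.commutes _ _).symm
  | add p p' hp hp' => rw [map_add]; exact hp.add_right hp'
  | mul_X p k hp => rw [map_mul, commEval_X]; exact hp.mul_right (hd k)

theorem commEval_commute {A : Type*} [Ring A] [Algebra ℝ A] {D E : σ → A}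
    (hD : ∀ i j, D i * D j = D j * D i) (hE : ∀ i j, E i * E j = E j * E i)
    (hDE : ∀ i j, D i * E j = E j * D i) (p q : MvPolynomial σ ℝ) :
    Commute (commEval D hD p) (commEval E hE q) :=
  commute_commEval hE (fun j => (commute_commEval hD (fun i => (hDE i j).symm) p).symm) q

theorem commEval_psum {A : Type*} [Ring A] [Algebra ℝ A] {D : σ → A}
    (hD : ∀ i j, D i * D j = D j * D i) (r : ℕ) :
    commEval D hD (psum σ ℝ r) = ∑ i, D i ^ r := by
  simp [psum, commEval_X]

theorem commEval_apply_eq_of_psum {D E : σ → Module.End ℝ V}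
    (hD : ∀ i j, D i * D j = D j * D i) (hE : ∀ i j, E i * E j = E j * E i)
    (hDE : ∀ i j, D i * E j = E j * D i) {v : V}
    (h : ∀ r : ℕ, (∑ i, D i ^ (r + 1)) v = (∑ i, E i ^ (r + 1)) v)
    {p : MvPolynomial σ ℝ} (hp : p.IsSymmetric) : commEval D hD p v = commEval E hE p v := by
  refine Algebra.adjoin_induction ?_ ?_ ?_ ?_ (symm_mem_adjoin_psum hp)
  · rintro _ ⟨r, rfl⟩
    rw [commEval_psum, commEval_psum, h]
  · intro r
    rw [AlgHom.commutes, AlgHom.commutes]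
  · intro p q _ _ h1 h2
    rw [map_add, map_add, LinearMap.add_apply, LinearMap.add_apply, h1, h2]
  · intro p q _ _ h1 h2
    rw [map_mul, Module.End.mul_apply, h2, mul_comm p q, map_mul, Module.End.mul_apply, ← h1,
      ← Module.End.mul_apply, (commEval_commute hD hE hDE p q).eq, Module.End.mul_apply]

end CommEval

section Seq

variable {σ : Type*} [Fintype σ] [DecidableEq σ]

/-- The shift on sequences. -/
def shift (V : Type*) [AddCommGroup V] [Module ℝ V] : Module.End ℝ (ℕ → V) where
  toFun β := fun k => Nat.casesOn k 0 β
  map_add' β γ := by funext k; cases k <;> simp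
  map_smul' c β := by funext k; cases k <;> simp

variable {V : Type*} [AddCommGroup V] [Module ℝ V]

@[simp] theorem shift_zero (β : ℕ → V) : shift V β 0 = 0 := rfl
@[simp] theorem shift_succ (β : ℕ → V) (k : ℕ) : shift V β (k + 1) = β k := rfl

theorem shift_pow_apply (d : ℕ) (β : ℕ → V) (k : ℕ) :
    (shift V ^ d) β k = if d ≤ k then β (k - d) else 0 := by
  induction d generalizing k with
  | zero => simp
  | succ d ih =>
    rw [pow_succ', Module.End.mul_apply]
    cases k with
    | zero => simp
    | succ k => rw [shift_succ, ih]; simp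

/-- Termwise application of a linear map to a sequence. -/
def seqMap : Module.End ℝ V →ₐ[ℝ] Module.End ℝ (ℕ → V) where
  toFun f := f.compLeft ℕ
  map_one' := rfl
  map_mul' _ _ := rfl
  map_zero' := rfl
  map_add' _ _ := rfl
  commutes' _ := rfl

@[simp] theorem seqMap_apply (f : Module.End ℝ V) (β : ℕ → V) (k : ℕ) : seqMap f β k = f (β k) := rfl

theorem seqMap_shift (f : Module.End ℝ V) : seqMap f * shift V = shift V * seqMap f := by
  refine LinearMap.ext fun β => funext fun k => ?_
  cases k <;> simp

theorem smul_shift_comm (Y : σ → ℝ) (i j : σ) :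
    (Y i • shift V) * (Y j • shift V) = (Y j • shift V) * (Y i • shift V) := by
  simp only [smul_mul_smul_comm, mul_comm]

theorem commEval_smul_shift (Y : σ → ℝ) {p : MvPolynomial σ ℝ} {d : ℕ} (hp : p.IsHomogeneous d) :
    commEval (fun i => Y i • shift V) (smul_shift_comm Y) p = eval Y p • shift V ^ d := by
  have key : ∀ m : σ →₀ ℕ, commEval (fun i => Y i • shift V) (smul_shift_comm Y) (monomial m 1)
      = eval Y (monomial m 1) • shift V ^ m.degree := by
    intro m
    induction m using Finsupp.induction_linear with
    | zero => simp
    | add m n hm hn =>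
      rw [show (monomial (m + n) (1 : ℝ)) = monomial m 1 * monomial n 1 by simp, map_mul, hm, hn,
        map_mul, smul_mul_smul_comm, map_add, pow_add]
    | single i n =>
      rw [← X_pow_eq_monomial, map_pow, commEval_X, map_pow, eval_X, smul_pow]
      simp
  conv_lhs => rw [p.as_sum]
  conv_rhs => rw [p.as_sum]
  rw [map_sum, map_sum, Finset.sum_smul]
  refine Finset.sum_congr rfl fun m hm => ?_
  have hd : m.degree = d := by
    have := hp (mem_support_iff.1 hm)
    rwa [Finsupp.degree_eq_weight_one]
  rw [show monomial m (coeff m p) = coeff m p • monomial m (1 : ℝ) by simp [smul_monomial], map_smul,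
    key, smul_eval, hd, smul_smul]

end Seq

section Bessel

variable {σ : Type*} [Fintype σ] [DecidableEq σ]

/-- The homogeneous components of a symmetric joint eigenfunction of the Dunkl power sums. -/
structure IsBessel (θ : ℝ) (Y : σ → ℝ) (β : ℕ → MvPolynomial σ ℝ) : Prop where
  symm : ∀ k, (β k).IsSymmetric
  homog : ∀ k, (β k).IsHomogeneous k
  zero : β 0 = 1
  eig : ∀ r k, dunklHom (isMult_const θ) (psum σ ℝ (r + 1)) (β k)
    = eval Y (psum σ ℝ (r + 1)) • (shift _ ^ (r + 1)) β k

theorem seqDunkl_comm (θ : ℝ) (i j : σ) :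
    seqMap (dunkl (fun _ _ : σ => θ) i) * seqMap (dunkl (fun _ _ : σ => θ) j)
      = seqMap (dunkl (fun _ _ : σ => θ) j) * seqMap (dunkl (fun _ _ : σ => θ) i) := by
  have : dunkl (fun _ _ : σ => θ) i * dunkl (fun _ _ : σ => θ) j
      = dunkl (fun _ _ : σ => θ) j * dunkl (fun _ _ : σ => θ) i :=
    LinearMap.ext fun f => dunkl_comm (isMult_const θ) i j f
  rw [← map_mul, this, map_mul]

theorem commEval_seqDunkl (θ : ℝ) (p : MvPolynomial σ ℝ) :
    commEval (fun i => seqMap (dunkl (fun _ _ : σ => θ) i)) (seqDunkl_comm θ) p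
      = seqMap (dunklHom (isMult_const θ) p) := by
  have : commEval (fun i => seqMap (dunkl (fun _ _ : σ => θ) i)) (seqDunkl_comm θ)
      = seqMap.comp (dunklHom (isMult_const θ)) := by
    refine MvPolynomial.algHom_ext fun i => ?_
    rw [commEval_X, AlgHom.comp_apply, dunklHom_X]
  rw [this, AlgHom.comp_apply]

theorem seqDunkl_smul_shift (θ : ℝ) (Y : σ → ℝ) (i j : σ) :
    seqMap (dunkl (fun _ _ : σ => θ) i) * (Y j • shift _)
      = (Y j • shift _) * seqMap (dunkl (fun _ _ : σ => θ) i) := by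
  rw [mul_smul_comm, seqMap_shift, smul_mul_assoc]

theorem IsBessel.sum_pow {θ : ℝ} {Y : σ → ℝ} {β : ℕ → MvPolynomial σ ℝ} (h : IsBessel θ Y β)
    (r : ℕ) : (∑ i, seqMap (dunkl (fun _ _ : σ => θ) i) ^ (r + 1)) β
      = (∑ i, (Y i • shift _) ^ (r + 1)) β := by
  have := commEval_seqDunkl θ (psum σ ℝ (r + 1))
  rw [commEval_psum] at this
  rw [this]
  funext k
  rw [seqMap_apply, h.eig]
  simp only [smul_pow, ← Finset.sum_smul, LinearMap.smul_apply, Pi.smul_apply]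
  simp [psum]

theorem IsBessel.dunklHom_apply {θ : ℝ} {Y : σ → ℝ} {β : ℕ → MvPolynomial σ ℝ}
    (h : IsBessel θ Y β) {p : MvPolynomial σ ℝ} {d : ℕ} (hs : p.IsSymmetric)
    (hp : p.IsHomogeneous d) (k : ℕ) :
    dunklHom (isMult_const θ) p (β k) = eval Y p • (shift _ ^ d) β k := by
  have := commEval_apply_eq_of_psum (seqDunkl_comm θ) (smul_shift_comm Y)
    (seqDunkl_smul_shift θ Y) (v := β) h.sum_pow hs
  rw [commEval_smul_shift Y hp, commEval_seqDunkl] at this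
  exact congrFun this k

theorem IsBessel.eval_comm {θ : ℝ} {X Y : σ → ℝ} {β γ : ℕ → MvPolynomial σ ℝ}
    (hβ : IsBessel θ X β) (hγ : IsBessel θ Y γ) (k : ℕ) : eval Y (β k) = eval X (γ k) := by
  have h := pair_symm (isMult_const θ) (β k) (γ k)
  rw [pair, pair, hβ.dunklHom_apply (hγ.symm k) (hγ.homog k),
    hγ.dunklHom_apply (hβ.symm k) (hβ.homog k), shift_pow_apply, shift_pow_apply] at h
  simpa [hβ.zero, hγ.zero, smul_eq_C_mul] using h

/-- Multiplication of a sequence by `exp (c (x₁ + ⋯ + x_N))`, degree by degree. -/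
def expMul (c : ℝ) : Module.End ℝ (ℕ → MvPolynomial σ ℝ) where
  toFun β := fun k => ∑ p ∈ Finset.HasAntidiagonal.antidiagonal k,
    (c ^ p.1 / p.1.factorial) • ((∑ i, X i) ^ p.1 * β p.2)
  map_add' β γ := by
    funext k; simp [mul_add, Finset.sum_add_distrib]
  map_smul' a β := by
    funext k; simp [Finset.smul_sum, smul_comm a]

theorem expMul_apply (c : ℝ) (β : ℕ → MvPolynomial σ ℝ) (k : ℕ) :
    expMul c β k = ∑ p ∈ Finset.HasAntidiagonal.antidiagonal k,
    (c ^ p.1 / p.1.factorial) • ((∑ i, X i) ^ p.1 * β p.2) := rfl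

theorem dunkl_psum_one_pow_mul (c : σ → σ → ℝ) (i : σ) (n : ℕ) (f : MvPolynomial σ ℝ) :
    dunkl c i ((∑ k, X k) ^ (n + 1) * f)
      = (∑ k, X k) ^ (n + 1) * dunkl c i f + ((n : ℝ) + 1) • ((∑ k, X k) ^ n * f) := by
  induction n with
  | zero => simp [dunkl_psum_one_mul]
  | succ n ih =>
    rw [pow_succ', mul_assoc, dunkl_psum_one_mul, ih, smul_eq_C_mul, smul_eq_C_mul]
    push_cast
    simp only [C_add, C_1]
    ring

theorem seqDunkl_expMul (θ c : ℝ) (i : σ) :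
    seqMap (dunkl (fun _ _ : σ => θ) i) * expMul c
      = expMul c * (seqMap (dunkl (fun _ _ : σ => θ) i) + c • shift _) := by
  refine LinearMap.ext fun β => funext fun k => ?_
  rw [Module.End.mul_apply, Module.End.mul_apply, LinearMap.add_apply, map_add, Pi.add_apply,
    seqMap_apply, expMul_apply, expMul_apply, LinearMap.smul_apply, map_smul, Pi.smul_apply,
    expMul_apply]
  cases k with
  | zero => simp
  | succ k =>
    rw [Finset.Nat.sum_antidiagonal_succ, Finset.Nat.sum_antidiagonal_succ,
      Finset.Nat.sum_antidiagonal_succ' (f := fun p : ℕ × ℕ =>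
        (c ^ p.1 / (p.1.factorial : ℝ)) • ((∑ i, X i) ^ p.1 * shift _ β p.2))]
    simp only [map_add, map_sum, map_smul, dunkl_psum_one_pow_mul, smul_add,
      Finset.sum_add_distrib, shift_succ, shift_zero, seqMap_apply, mul_zero, smul_zero]
    simp only [pow_zero, one_mul, add_assoc]
    congr 2
    rw [Finset.smul_sum]
    simp only [zero_add]
    refine Finset.sum_congr rfl fun p _ => ?_
    rw [smul_smul, smul_smul]
    congr 1
    rw [Nat.factorial_succ]
    push_cast
    field_simp
    ring

theorem shift_expMul (c : ℝ) : shift _ * expMul (σ := σ) c = expMul c * shift _ := by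
  refine LinearMap.ext fun β => funext fun k => ?_
  rw [Module.End.mul_apply, Module.End.mul_apply]
  cases k with
  | zero => simp [expMul_apply]
  | succ k =>
    rw [shift_succ, expMul_apply, expMul_apply, Finset.Nat.sum_antidiagonal_succ']
    simp

theorem pow_mul_comm_of {A : Type*} [Ring A] {D D' M : A} (h : D * M = M * D') (n : ℕ) :
    D ^ n * M = M * D' ^ n := by
  induction n with
  | zero => simp
  | succ n ih => rw [pow_succ, mul_assoc, h, ← mul_assoc, ih, mul_assoc, ← pow_succ]

theorem IsBessel.expMul {θ : ℝ} {Y : σ → ℝ} {β : ℕ → MvPolynomial σ ℝ}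
    (h : IsBessel θ Y β) (c : ℝ) : IsBessel θ (fun i => Y i + c) (expMul c β) := by
  have hp1 : (∑ i, X i : MvPolynomial σ ℝ).IsSymmetric := by
    simpa [psum] using psum_isSymmetric σ ℝ 1
  have hp2 : (∑ i, X i : MvPolynomial σ ℝ).IsHomogeneous 1 :=
    IsHomogeneous.sum _ _ _ fun i _ => isHomogeneous_X _ _
  refine ⟨fun k => ?_, fun k => ?_, ?_, fun r k => ?_⟩
  · rw [expMul_apply, ← mem_symmetricSubalgebra]
    refine Subalgebra.sum_mem _ fun p _ => Subalgebra.smul_mem _ (Subalgebra.mul_mem _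
      (Subalgebra.pow_mem _ ?_ _) ?_) _
    · rwa [mem_symmetricSubalgebra]
    · rw [mem_symmetricSubalgebra]; exact h.symm _
  · rw [expMul_apply]
    refine IsHomogeneous.sum _ _ _ fun p hp => ?_
    rw [smul_eq_C_mul, ← Finset.HasAntidiagonal.mem_antidiagonal.1 hp]
    have := (isHomogeneous_C σ (c ^ p.1 / (p.1.factorial : ℝ))).mul ((hp2.pow p.1).mul (h.homog p.2))
    simpa using this
  · simpa [expMul_apply] using h.zero
  · have h1 : (∑ i, seqMap (dunkl (fun _ _ : σ => θ) i) ^ (r + 1)) (MBFPieri.expMul c β)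
        = (∑ i, ((Y i + c) • shift _) ^ (r + 1)) (MBFPieri.expMul c β) := by
      rw [← Module.End.mul_apply, ← Module.End.mul_apply, Finset.sum_mul, Finset.sum_mul]
      have e1 : ∀ i : σ, seqMap (dunkl (fun _ _ : σ => θ) i) ^ (r + 1) * MBFPieri.expMul (σ := σ) c
        = MBFPieri.expMul c * (seqMap (dunkl (fun _ _ : σ => θ) i) + c • shift _) ^ (r + 1) :=
        fun i => pow_mul_comm_of (seqDunkl_expMul θ c i) _
      have e2 : ∀ i : σ, ((Y i + c) • shift _) ^ (r + 1) * MBFPieri.expMul (σ := σ) c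
        = MBFPieri.expMul c * (Y i • shift _ + c • shift _) ^ (r + 1) := by
        intro i
        refine pow_mul_comm_of ?_ _
        rw [← add_smul, smul_mul_assoc, shift_expMul, mul_smul_comm]
      simp only [e1, e2, ← Finset.mul_sum, Module.End.mul_apply]
      congr 1
      have c1 : ∀ i : σ, Commute (seqMap (dunkl (fun _ _ : σ => θ) i)) (c • shift _) := fun i => by
        rw [Commute, SemiconjBy, mul_smul_comm, seqMap_shift, smul_mul_assoc]
      have c2 : ∀ i : σ, Commute (Y i • shift (MvPolynomial σ ℝ)) (c • shift _) := fun i =>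
        ((Commute.refl _).smul_right c).smul_left (Y i)
      simp only [(c1 _).add_pow, (c2 _).add_pow]
      rw [Finset.sum_comm, Finset.sum_comm (γ := σ)]
      rw [LinearMap.sum_apply, LinearMap.sum_apply]
      refine Finset.sum_congr rfl fun l _ => ?_
      have c1' : ∀ i : σ, seqMap (dunkl (fun _ _ : σ => θ) i) ^ l
          * (c • shift _) ^ (r + 1 - l) * (((r + 1).choose l : ℕ) : Module.End ℝ _)
          = (c • shift _) ^ (r + 1 - l) * (((r + 1).choose l : ℕ) : Module.End ℝ _)
           * seqMap (dunkl (fun _ _ : σ => θ) i) ^ l := fun i => by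
        rw [((c1 i).pow_pow _ _).eq, mul_assoc, mul_assoc, (Nat.cast_commute _ _).eq]
      have c2' : ∀ i : σ, (Y i • shift (MvPolynomial σ ℝ)) ^ l
          * (c • shift _) ^ (r + 1 - l) * (((r + 1).choose l : ℕ) : Module.End ℝ _)
          = (c • shift _) ^ (r + 1 - l) * (((r + 1).choose l : ℕ) : Module.End ℝ _)
           * (Y i • shift _) ^ l := fun i => by
        rw [((c2 i).pow_pow _ _).eq, mul_assoc, mul_assoc, (Nat.cast_commute _ _).eq]
      simp only [c1', c2', ← Finset.mul_sum, Module.End.mul_apply]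
      congr 2
      cases l with
      | zero => simp
      | succ l => exact h.sum_pow l
    have := commEval_seqDunkl θ (psum σ ℝ (r + 1))
    rw [commEval_psum] at this
    rw [this] at h1
    have h2 := congrFun h1 k
    rw [seqMap_apply] at h2
    rw [h2]
    simp only [smul_pow, ← Finset.sum_smul, LinearMap.smul_apply, Pi.smul_apply]
    simp [psum]

end Bessel

end MBFPieri

namespace MBFPieri

open MvPolynomial

section Density

theorem eq_of_eval_strictAnti {N : ℕ} {f g : MvPolynomial (Fin N) ℝ}
    (h : ∀ a : Fin N → ℝ, StrictAnti a → eval a f = eval a g) : f = g := by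
  refine funext_set (fun i : Fin N => Set.Ioo (-(i : ℝ) - 1) (-(i : ℝ)))
    (fun i => Set.Ioo_infinite (by linarith)) fun x hx => h x ?_
  intro i j hij
  have hi := hx i (Set.mem_univ _)
  have hj := hx j (Set.mem_univ _)
  have : (i : ℝ) + 1 ≤ j := by exact_mod_cast hij
  linarith [hi.1, hj.2]

end Density

section GPol

variable {σ : Type*} [Fintype σ]

theorem psum_isHomogeneous (n : ℕ) : (psum σ ℝ n).IsHomogeneous n :=
  IsHomogeneous.sum _ _ _ fun i _ => by simpa using (isHomogeneous_X ℝ i).pow n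

theorem gPol_isSymmetric (θ : ℝ) (r : ℕ) : (gPol σ θ r).IsSymmetric := by
  induction r using Nat.strong_induction_on with
  | _ r ih =>
    cases r with
    | zero => rw [gPol]; exact IsSymmetric.one
    | succ r =>
      rw [gPol_succ, ← mem_symmetricSubalgebra]
      refine Subalgebra.smul_mem _ (Subalgebra.sum_mem _ fun j hj => Subalgebra.mul_mem _ ?_ ?_) _
      · exact (mem_symmetricSubalgebra _).2 (psum_isSymmetric _ _ _)
      · exact (mem_symmetricSubalgebra _).2 (ih j (Finset.mem_range.1 hj))

theorem gPol_isHomogeneous (θ : ℝ) (r : ℕ) : (gPol σ θ r).IsHomogeneous r := by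
  induction r using Nat.strong_induction_on with
  | _ r ih =>
    cases r with
    | zero => rw [gPol]; exact isHomogeneous_one _ _
    | succ r =>
      rw [gPol_succ, smul_eq_C_mul]
      have : (∑ j ∈ Finset.range (r + 1), psum σ ℝ (r - j + 1) * gPol σ θ j).IsHomogeneous (r + 1) := by
        refine IsHomogeneous.sum _ _ _ fun j hj => ?_
        have hj' := Finset.mem_range.1 hj
        have := (psum_isHomogeneous (σ := σ) (r - j + 1)).mul (ih j hj')
        rwa [show r - j + 1 + j = r + 1 by omega] at this
      simpa using (isHomogeneous_C σ (θ / (r + 1))).mul this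

end GPol

section Dirichlet

variable {ι : Type*} [Fintype ι]

/-- `φ` has the moments of the Dirichlet distribution with parameters `t` and total mass `T`. -/
def IsDirichlet (t : ι → ℝ) (T : ℝ) (φ : MvPolynomial ι ℝ →ₗ[ℝ] ℝ) : Prop :=
  ∀ m : ι →₀ ℕ, φ (monomial m 1) = (∏ i, poch (t i) (m i)) / poch T m.degree

theorem IsDirichlet.apply {t : ι → ℝ} {T : ℝ} {φ : MvPolynomial ι ℝ →ₗ[ℝ] ℝ}
    (h : IsDirichlet t T φ) {p : MvPolynomial ι ℝ} {d : ℕ} (hp : p.IsHomogeneous d) :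
    φ p = gammaFun t p / poch T d := by
  conv_lhs => rw [p.as_sum]
  conv_rhs => rw [p.as_sum]
  rw [map_sum, map_sum, Finset.sum_div]
  refine Finset.sum_congr rfl fun m hm => ?_
  have hd : m.degree = d := by
    have := hp (mem_support_iff.1 hm)
    rwa [Finsupp.degree_eq_weight_one]
  rw [show monomial m (coeff m p) = coeff m p • monomial m (1 : ℝ) by simp [smul_monomial], map_smul,
    map_smul, h, gammaFun_monomial, hd, smul_eq_mul, smul_eq_mul, mul_div_assoc]

theorem isHomogeneous_prod_linear {κ : Type*} (S : Finset κ) (u : κ → ι → ℝ) :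
    (∏ k ∈ S, ∑ i, C (u k i) * X i : MvPolynomial ι ℝ).IsHomogeneous S.card := by
  have := IsHomogeneous.prod S (fun k => ∑ i, C (u k i) * X i : κ → MvPolynomial ι ℝ) (fun _ => 1)
    (fun k _ => IsHomogeneous.sum _ _ _ fun i _ => by
      simpa using (isHomogeneous_C ι (u k i)).mul (isHomogeneous_X ℝ i))
  simpa using this

end Dirichlet

section Apply

variable {θ : ℝ}

theorem exists_bessel_corner (hθ : 0 < θ) {n : ℕ} {Y' : Fin n → ℝ}
    {β' : ℕ → MvPolynomial (Fin n) ℝ} (h' : IsBessel θ Y' β')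
    (E : {a : Fin (n + 1) → ℝ // StrictAnti a} → MvPolynomial (Fin n) ℝ →ₗ[ℝ] ℝ)
    (hE1 : ∀ a, E a 1 = 1) (hE : ∀ a, CornerAt θ a.1 (E a)) :
    ∃ β, IsBessel θ (Fin.snoc Y' 0 : Fin (n + 1) → ℝ) β ∧ ∀ a k, eval a.1 (β k) = E a (β' k) := by
  choose β hs he hd using fun k => exists_corner hθ.ne' (fun a : {a : Fin (n + 1) → ℝ // StrictAnti a}
    => a.1) E hE (h'.symm k)
  refine ⟨β, ⟨hs, fun k => ?_, ?_, fun r k => ?_⟩, fun a k => he k a⟩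
  · refine isHomogeneous_of_scale (eq_of_eval_strictAnti fun a ha => ?_)
    have ha2 : StrictAnti fun i => 2 * a i := fun i j hij => by
      have := ha hij; simp only; linarith
    rw [eval_scale, smul_eval, he k ⟨_, ha2⟩, he k ⟨a, ha⟩,
      corner_scale (c := 2) two_ne_zero (by simp) (hE ⟨a, ha⟩) rfl (hE ⟨_, ha2⟩) (h'.symm k),
      scale_of_isHomogeneous _ (h'.homog k), map_smul, smul_eq_mul]
  · refine eq_of_eval_strictAnti fun a ha => ?_
    rw [he 0 ⟨a, ha⟩, h'.zero, hE1, map_one]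
  · refine eq_of_eval_strictAnti fun a ha => ?_
    rw [hd k r ⟨a, ha⟩, h'.eig, map_smul, smul_eval, smul_eq_mul, shift_pow_apply, shift_pow_apply]
    congr 1
    · simp [psum, Fin.sum_univ_castSucc]
    · split_ifs with hk
      · exact (he _ ⟨a, ha⟩).symm
      · simp

variable {N : ℕ} {a : Fin N → ℝ} {γ : ℕ → MvPolynomial (Fin N) ℝ}

theorem IsBessel.eval_gPol (h : IsBessel θ a γ) (Y : Fin N → ℝ) (y T : ℝ) {k R : ℕ} (hR : k < R) :
    ∑ r ∈ Finset.range R, y ^ r / poch T r *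
        eval Y (dunklHom (isMult_const θ) (gPol (Fin N) θ r) (γ k))
      = ∑ p ∈ Finset.HasAntidiagonal.antidiagonal k,
        (y ^ p.1 / poch T p.1 * eval a (gPol (Fin N) θ p.1)) * eval Y (γ p.2) := by
  rw [Finset.Nat.sum_antidiagonal_eq_sum_range_succ_mk,
    ← Finset.sum_subset (Finset.range_subset_range.2 (Nat.succ_le_of_lt hR))]
  · refine Finset.sum_congr rfl fun r hr => ?_
    have hk := Finset.mem_range.1 hr
    rw [h.dunklHom_apply (gPol_isSymmetric θ r) (gPol_isHomogeneous θ r), smul_eval,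
      shift_pow_apply, if_pos (by omega)]
    ring
  · intro r _ hr
    have hk : ¬ r ≤ k := by simpa using hr
    rw [h.dunklHom_apply (gPol_isSymmetric θ r) (gPol_isHomogeneous θ r), smul_eval,
      shift_pow_apply, if_neg hk]
    simp

theorem IsBessel.eval_zero_fun (h : IsBessel θ a γ) (k : ℕ) :
    eval (0 : Fin N → ℝ) (γ k) = if k = 0 then 1 else 0 := by
  split_ifs with hk
  · rw [hk, h.zero, map_one]
  · rw [eval_zero, constantCoeff_eq]
    by_contra hc
    have := h.homog k hc
    simp at this
    exact hk this.symm

theorem isCofactor_pow (hN : 1 ≤ N) : IsCofactor (chi (0 : Fin N → ℝ))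
    (fun _ : Unit => Polynomial.X ^ (N - 1)) (fun _ => 0) (fun _ => (N : ℝ)) where
  mul i := by
    simp only [chi, Pi.zero_apply, map_zero, sub_zero, Finset.prod_const, Finset.card_univ,
      Fintype.card_fin]
    rw [← pow_succ', Nat.sub_add_cancel hN]
  der := by
    simp [chi, Polynomial.smul_eq_C_mul, Polynomial.derivative_X_pow]

theorem gammaFun_unit (t : Unit → ℝ) {K : ℕ} (S : Finset (Fin K)) (c : Fin K → ℝ) :
    gammaFun t (∏ k ∈ S, ∑ i : Unit, C (c k) * X i) = (∏ k ∈ S, c k) * poch (t ()) S.card := by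
  simp only [Finset.univ_unique, Finset.sum_singleton, Finset.prod_mul_distrib, Finset.prod_const]
  rw [← map_prod, ← smul_eq_C_mul, map_smul, X_pow_eq_monomial, gammaFun_monomial]
  simp

theorem IsBessel.eval_single (hθ : 0 < θ) (h : IsBessel θ a γ) (i₀ : Fin N) (y : ℝ) (k : ℕ) :
    eval (Pi.single i₀ y) (γ k) = y ^ k / poch (N * θ) k * eval a (gPol (Fin N) θ k) := by
  have hN : 1 ≤ N := i₀.pos
  have hT : 0 < (N : ℝ) * θ := by positivity
  obtain ⟨R₀, hR⟩ := expectation_eq_sum_gPol hθ.ne' (0 : Fin N → ℝ) (isCofactor_pow hN) (N * θ) y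
    (evalL (Pi.single i₀ y)) (fun K ζ => by
      have h1 : evalL (Pi.single i₀ y) (phi (Fin N) ζ) = eval (Pi.single i₀ y) (phi (Fin N) ζ) := by
        rw [evalL, AlgHom.toLinearMap_apply, aeval_eq_eval]
      rw [h1, eval_phi]
      have h2 : ∀ k, (chi (Pi.single i₀ y : Fin N → ℝ)).eval (ζ k)
          = -y * ζ k ^ (N - 1) + ζ k ^ N := by
        intro k
        rw [eval_chi, ← Finset.mul_prod_erase _ _ (Finset.mem_univ i₀),
          Finset.prod_congr rfl (g := fun _ => ζ k) (fun i hi => by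
            rw [Pi.single_eq_of_ne (Finset.ne_of_mem_erase hi), sub_zero])]
        simp only [Pi.single_eq_same, Finset.prod_const, Finset.card_erase_of_mem,
          Finset.mem_univ, Finset.card_univ, Fintype.card_fin]
        conv_rhs => rw [← Nat.sub_add_cancel hN, pow_succ]
        simp only [Nat.add_sub_cancel]
        ring
      simp only [h2]
      rw [Finset.prod_add, ← Finset.powerset_univ]
      refine Finset.sum_congr rfl fun S _ => ?_
      rw [gammaFun_unit, Finset.prod_mul_distrib, Finset.prod_const, ← Finset.compl_eq_univ_sdiff]
      have := (poch_pos hT S.card).ne'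
      simp only [eval_chi, Pi.zero_apply, sub_zero, Finset.prod_const, Finset.card_univ,
        Fintype.card_fin, Polynomial.eval_pow, Polynomial.eval_X]
      field_simp) (h.symm k)
  have h1 := hR (max R₀ (k + 1)) (le_max_left _ _)
  rw [h.eval_gPol _ _ _ (by omega), evalL, AlgHom.toLinearMap_apply, aeval_eq_eval] at h1
  simp only [h.eval_zero_fun] at h1
  rw [Finset.Nat.sum_antidiagonal_eq_sum_range_succ_mk, Finset.sum_range_succ,
    Finset.sum_eq_zero] at h1
  · simpa using h1
  · intro r hr
    have := Finset.mem_range.1 hr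
    rw [if_neg (by omega), mul_zero]

theorem IsBessel.expectation (hθ : 0 < θ) (h : IsBessel θ a γ) (i₀ : Fin N) (Y : Fin N → ℝ)
    {ι : Type*} [Fintype ι] [DecidableEq ι] {χi : ι → Polynomial ℝ}
    {η m : ι → ℝ} (hχ : IsCofactor (chi Y) χi η m) (y : ℝ) (E : MvPolynomial (Fin N) ℝ →ₗ[ℝ] ℝ)
    (φ : MvPolynomial ι ℝ →ₗ[ℝ] ℝ) (hφ : IsDirichlet (fun i => m i * θ) (N * θ) φ)
    (hE : ∀ K (ζ : Fin K → ℝ), E (phi (Fin N) ζ) =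
      φ (∏ k, (C ((chi Y).eval (ζ k)) - C y * ∑ i, C ((χi i).eval (ζ k)) * X i))) (k : ℕ) :
    E (γ k) = ∑ p ∈ Finset.HasAntidiagonal.antidiagonal k,
        eval (Pi.single i₀ y) (γ p.1) * eval Y (γ p.2) := by
  obtain ⟨R₀, hR⟩ := expectation_eq_sum_gPol hθ.ne' Y hχ (N * θ) y E (fun K ζ => by
    rw [hE]
    have : ∀ k, (C ((chi Y).eval (ζ k)) - C y * ∑ i, C ((χi i).eval (ζ k)) * X i : MvPolynomial ι ℝ)
      = C (-y) * (∑ i, C ((χi i).eval (ζ k)) * X i) + C ((chi Y).eval (ζ k)) := fun k => by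
      rw [C_neg]; ring
    simp only [this]
    rw [Finset.prod_add, ← Finset.powerset_univ, map_sum]
    refine Finset.sum_congr rfl fun S _ => ?_
    rw [Finset.prod_mul_distrib, Finset.prod_const, ← Finset.compl_eq_univ_sdiff, ← map_prod,
      mul_comm, ← C_pow, ← smul_eq_C_mul, ← smul_eq_C_mul, map_smul, map_smul,
      hφ.apply (isHomogeneous_prod_linear S _), smul_eq_mul, smul_eq_mul]
    ring) (h.symm k)
  rw [hR (max R₀ (k + 1)) (le_max_left _ _), h.eval_gPol _ _ _ (by omega)]
  refine Finset.sum_congr rfl fun p _ => ?_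
  rw [h.eval_single hθ]

end Apply

end MBFPieri

namespace MBFPieri

section Dirichlet

theorem lintegral_beta_scaled {p q c : ℝ} (hp : 0 < p) (hq : 0 < q) (hc : 0 < c) :
    ∫⁻ x in Set.Ioo 0 c, ENNReal.ofReal (x ^ (p - 1) * (c - x) ^ (q - 1))
      = ENNReal.ofReal (c ^ (p + q - 1) * ProbabilityTheory.beta p q) := by
  have hb := ProbabilityTheory.beta_pos hp hq
  have h1 := ProbabilityTheory.lintegral_betaPDF_eq_one hp hq
  rw [ProbabilityTheory.lintegral_betaPDF] at h1
  have h2 : (fun x : ℝ => c * x) '' Set.Ioo 0 1 = Set.Ioo 0 c := by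
    rw [Set.image_mul_left_Ioo hc]; simp
  rw [← h2, lintegral_image_eq_lintegral_abs_deriv_mul measurableSet_Ioo (f' := fun _ => c)
    (fun x _ => by simpa using ((hasDerivAt_id x).const_mul c).hasDerivWithinAt)
    (fun x _ y _ h => mul_left_cancel₀ hc.ne' h)]
  calc _ = ∫⁻ x in Set.Ioo (0:ℝ) 1, ENNReal.ofReal (c ^ (p + q - 1) * ProbabilityTheory.beta p q) *
        ENNReal.ofReal (1 / ProbabilityTheory.beta p q * x ^ (p - 1) * (1 - x) ^ (q - 1)) := by
        refine setLIntegral_congr_fun measurableSet_Ioo fun x hx => ?_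
        rw [← ENNReal.ofReal_mul (abs_nonneg _), ← ENNReal.ofReal_mul (by positivity)]
        congr 1
        rw [abs_of_pos hc, show c - c * x = c * (1 - x) by ring,
          Real.mul_rpow hc.le hx.1.le, Real.mul_rpow hc.le (by linarith [hx.2]),
          show p + q - 1 = 1 + (p - 1) + (q - 1) by ring, Real.rpow_add hc, Real.rpow_add hc,
          Real.rpow_one]
        field_simp
    _ = _ := by
        rw [lintegral_const_mul _ (by fun_prop), h1, mul_one]

/-- The open corner simplex of size `c`. -/
def simp0 (n : ℕ) (c : ℝ) : Set (Fin n → ℝ) := {u | (∀ i, 0 < u i) ∧ ∑ i, u i < c}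

theorem measurableSet_simp0 (n : ℕ) (c : ℝ) : MeasurableSet (simp0 n c) := by
  have : simp0 n c = (⋂ i, {u | 0 < u i}) ∩ {u | ∑ i, u i < c} := by ext u; simp [simp0]
  rw [this]
  exact (MeasurableSet.iInter fun i => measurableSet_lt measurable_const
    (measurable_pi_apply i)).inter (measurableSet_lt (by fun_prop) measurable_const)

/-- The unnormalized Dirichlet density. -/
def dirWt {n : ℕ} (t : Fin n → ℝ) (s c : ℝ) (u : Fin n → ℝ) : ℝ :=
  (∏ i, u i ^ (t i - 1)) * (c - ∑ i, u i) ^ (s - 1)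

@[fun_prop]
theorem measurable_dirWt {n : ℕ} (t : Fin n → ℝ) (s c : ℝ) : Measurable (dirWt t s c) := by
  unfold dirWt; fun_prop

theorem lintegral_dirWt {n : ℕ} (t : Fin n → ℝ) (ht : ∀ i, 0 < t i) {s c : ℝ} (hs : 0 < s)
    (hc : 0 < c) : ∫⁻ u in simp0 n c, ENNReal.ofReal (dirWt t s c u)
      = ENNReal.ofReal (c ^ (∑ i, t i + s - 1) *
        ((∏ i, Real.Gamma (t i)) * Real.Gamma s / Real.Gamma (∑ i, t i + s))) := by
  induction n generalizing c with
  | zero =>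
    have : simp0 0 c = Set.univ := by
      ext u; simp [simp0, hc]
    rw [this, Measure.restrict_univ, lintegral_unique]
    have := (Real.Gamma_pos_of_pos hs).ne'
    simp [dirWt, this, Measure.volume_pi_eq_dirac (0 : Fin 0 → ℝ)]
  | succ n ih =>
    rw [← lintegral_indicator (measurableSet_simp0 _ _),
      ← (volume_preserving_piFinSuccAbove (fun _ : Fin (n + 1) => ℝ) 0).symm.lintegral_comp
        ((by fun_prop : Measurable _).indicator (measurableSet_simp0 _ _)),
      Measure.volume_eq_prod, lintegral_prod _ (by
        refine Measurable.aemeasurable (Measurable.comp (g := (simp0 (n + 1) c).indicator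
          fun u => ENNReal.ofReal (dirWt t s c u)) ?_ (MeasurableEquiv.measurable _))
        exact (by fun_prop : Measurable _).indicator (measurableSet_simp0 _ _))]
    have hT : 0 < ∑ i : Fin n, t i.succ + s :=
      add_pos_of_nonneg_of_pos (Finset.sum_nonneg fun i _ => (ht _).le) hs
    set K := (∏ i : Fin n, Real.Gamma (t i.succ)) * Real.Gamma s / Real.Gamma (∑ i : Fin n, t i.succ + s)
    have hK : 0 ≤ K := div_nonneg (mul_nonneg (Finset.prod_nonneg fun i _ =>
      (Real.Gamma_pos_of_pos (ht _)).le) (Real.Gamma_pos_of_pos hs).le) (Real.Gamma_pos_of_pos hT).le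
    have key : ∀ x : ℝ, ∫⁻ u : Fin n → ℝ, (simp0 (n + 1) c).indicator
        (fun u => ENNReal.ofReal (dirWt t s c u))
        ((MeasurableEquiv.piFinSuccAbove (fun _ : Fin (n + 1) => ℝ) 0).symm (x, u))
        = (Set.Ioo 0 c).indicator (fun x => ENNReal.ofReal K *
          ENNReal.ofReal (x ^ (t 0 - 1) * (c - x) ^ (∑ i : Fin n, t i.succ + s - 1))) x := by
      intro x
      have e : ∀ u : Fin n → ℝ, (MeasurableEquiv.piFinSuccAbove (fun _ : Fin (n + 1) => ℝ) 0).symm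
          (x, u) = Fin.cons x u := fun u => by
        simp [MeasurableEquiv.piFinSuccAbove, Fin.insertNthEquiv]
      simp only [e]
      by_cases hx : x ∈ Set.Ioo 0 c
      · rw [Set.indicator_of_mem hx]
        have : ∀ u : Fin n → ℝ, (simp0 (n + 1) c).indicator
            (fun u => ENNReal.ofReal (dirWt t s c u)) (Fin.cons x u)
            = ENNReal.ofReal (x ^ (t 0 - 1)) * (simp0 n (c - x)).indicator
              (fun u => ENNReal.ofReal (dirWt (fun i => t i.succ) s (c - x) u)) u := by
          intro u
          have hiff : (Fin.cons x u : Fin (n + 1) → ℝ) ∈ simp0 (n + 1) c ↔ u ∈ simp0 n (c - x) := by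
            simp only [simp0, Set.mem_ofPred_eq, Fin.forall_fin_succ, Fin.cons_zero, Fin.cons_succ,
              Fin.sum_univ_succ, hx.1, true_and]
            refine and_congr_right fun _ => ?_
            constructor <;> intro h <;> linarith
          by_cases hu : u ∈ simp0 n (c - x)
          · rw [Set.indicator_of_mem hu, Set.indicator_of_mem (hiff.2 hu), ← ENNReal.ofReal_mul
              (Real.rpow_nonneg hx.1.le _)]
            congr 1
            simp only [dirWt, Fin.prod_univ_succ, Fin.sum_univ_succ, Fin.cons_zero, Fin.cons_succ]
            rw [mul_assoc, sub_add_eq_sub_sub]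
          · rw [Set.indicator_of_notMem hu, Set.indicator_of_notMem (fun h => hu (hiff.1 h)), mul_zero]
        simp only [this]
        rw [lintegral_const_mul _ ((by fun_prop : Measurable _).indicator (measurableSet_simp0 _ _)),
          lintegral_indicator (measurableSet_simp0 _ _), ih _ (fun i => ht _) (sub_pos.2 hx.2),
          ← ENNReal.ofReal_mul (Real.rpow_nonneg hx.1.le _), ← ENNReal.ofReal_mul hK]
        congr 1
        ring
      · rw [Set.indicator_of_notMem hx]
        have : ∀ u : Fin n → ℝ, (simp0 (n + 1) c).indicator
            (fun u => ENNReal.ofReal (dirWt t s c u)) (Fin.cons x u) = 0 := by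
          intro u
          refine Set.indicator_of_notMem (fun h => hx ?_) _
          simp only [simp0, Set.mem_ofPred_eq, Fin.forall_fin_succ, Fin.cons_zero, Fin.cons_succ,
              Fin.sum_univ_succ] at h
          exact ⟨h.1.1, by linarith [Finset.sum_nonneg fun i (_ : i ∈ Finset.univ) => (h.1.2 i).le]⟩
        simp only [this, lintegral_zero]
    simp only [key]
    rw [lintegral_indicator measurableSet_Ioo, lintegral_const_mul _ (by fun_prop),
      lintegral_beta_scaled (ht 0) hT hc, ← ENNReal.ofReal_mul hK]
    congr 1
    rw [ProbabilityTheory.beta, Fin.sum_univ_succ, Fin.prod_univ_succ, ← add_assoc]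
    have := (Real.Gamma_pos_of_pos hT).ne'
    simp only [K]
    field_simp

end Dirichlet

end MBFPieri

namespace MBFPieri

open MvPolynomial

theorem Gamma_add_nat {t : ℝ} (ht : 0 < t) (n : ℕ) :
    Real.Gamma (t + n) = poch t n * Real.Gamma t := by
  induction n with
  | zero => simp [poch_zero]
  | succ n ih =>
    rw [poch_succ, Nat.cast_succ, ← add_assoc, Real.Gamma_add_one (by positivity), ih]; ring

section CoV

variable {n : ℕ}

theorem lintegral_dirichlet_of_cov {t : Fin (n + 1) → ℝ} (ht : ∀ i, 0 < t i)
    {s : Set (Fin n → ℝ)} (hs : MeasurableSet s) {w : (Fin n → ℝ) → Fin (n + 1) → ℝ}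
    (hsum : ∀ x ∈ s, ∑ i, w x i = 1) (hpos : ∀ x ∈ s, ∀ i, 0 < w x i)
    {T' : (Fin n → ℝ) → (Fin n → ℝ) →L[ℝ] (Fin n → ℝ)}
    (hT' : ∀ x ∈ s, HasFDerivWithinAt (fun x (i : Fin n) => w x i.castSucc) (T' x) s x)
    (hinj : Set.InjOn (fun x (i : Fin n) => w x i.castSucc) s)
    (hsurj : ∀ u ∈ simp0 n 1, ∃ x ∈ s, (fun i : Fin n => w x i.castSucc) = u)
    {e : (Fin n → ℝ) → ℝ}
    (he : ∀ x ∈ s, e x = Real.Gamma (∑ i, t i) / (∏ i, Real.Gamma (t i)) * |(T' x).det| *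
      ∏ i, w x i ^ (t i - 1)) (m : Fin (n + 1) → ℕ) :
    ∫⁻ x in s, ENNReal.ofReal (e x * ∏ i, w x i ^ m i)
      = ENNReal.ofReal ((∏ i, poch (t i) (m i)) / poch (∑ i, t i) (∑ i, m i)) := by
  set C := Real.Gamma (∑ i, t i) / (∏ i, Real.Gamma (t i)) with hC
  have hts : 0 < ∑ i, t i := Finset.sum_pos (fun i _ => ht i) Finset.univ_nonempty
  have hC0 : 0 < C := div_pos (Real.Gamma_pos_of_pos hts)
    (Finset.prod_pos fun i _ => Real.Gamma_pos_of_pos (ht i))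
  set t' : Fin (n + 1) → ℝ := fun i => t i + m i with ht'
  have ht'0 : ∀ i, 0 < t' i := fun i => add_pos_of_pos_of_nonneg (ht i) (Nat.cast_nonneg _)
  have himg : (fun x (i : Fin n) => w x i.castSucc) '' s = simp0 n 1 := by
    ext u
    constructor
    · rintro ⟨x, hx, rfl⟩
      refine ⟨fun i => hpos x hx _, ?_⟩
      have := hsum x hx
      rw [Fin.sum_univ_castSucc] at this
      have := hpos x hx (Fin.last n)
      simp only; linarith
    · intro hu
      obtain ⟨x, hx, h⟩ := hsurj u hu
      exact ⟨x, hx, h⟩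
  have h1 := lintegral_image_eq_lintegral_abs_det_fderiv_mul volume hs hT' hinj
    (fun u => ENNReal.ofReal (dirWt (fun i : Fin n => t' i.castSucc) (t' (Fin.last n)) 1 u))
  rw [himg, lintegral_dirWt _ (fun i => ht'0 _) (ht'0 _) one_pos, Real.one_rpow, one_mul] at h1
  have h2 : ∀ x ∈ s, ENNReal.ofReal (e x * ∏ i, w x i ^ m i) = ENNReal.ofReal C *
      (ENNReal.ofReal |(T' x).det| * ENNReal.ofReal (dirWt (fun i : Fin n => t' i.castSucc)
        (t' (Fin.last n)) 1 (fun i => w x i.castSucc))) := by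
    intro x hx
    rw [← ENNReal.ofReal_mul (abs_nonneg _), ← ENNReal.ofReal_mul hC0.le, he x hx]
    congr 1
    have h3 : 1 - ∑ i : Fin n, w x i.castSucc = w x (Fin.last n) := by
      have := hsum x hx
      rw [Fin.sum_univ_castSucc] at this
      linarith
    have h4 : dirWt (fun i : Fin n => t' i.castSucc) (t' (Fin.last n)) 1 (fun i => w x i.castSucc)
        = ∏ i, w x i ^ (t' i - 1) := by
      rw [dirWt, h3, Fin.prod_univ_castSucc]
    rw [h4, mul_assoc, mul_assoc, ← Finset.prod_mul_distrib]
    congr 2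
    refine Finset.prod_congr rfl fun i _ => ?_
    rw [← Real.rpow_natCast, ← Real.rpow_add (hpos x hx i), ht']
    congr 1; ring
  rw [setLIntegral_congr_fun hs h2, lintegral_const_mul' _ _ ENNReal.ofReal_ne_top, ← h1,
    ← ENNReal.ofReal_mul hC0.le, ← Fin.sum_univ_castSucc, ← Fin.prod_univ_castSucc
      (fun i => Real.Gamma (t' i))]
  congr 1
  have h5 : ∑ i, t' i = ∑ i, t i + ((∑ i, m i : ℕ) : ℝ) := by
    simp [ht', Finset.sum_add_distrib]
  rw [h5, Gamma_add_nat hts]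
  simp only [ht', Gamma_add_nat (ht _), Finset.prod_mul_distrib, hC]
  have := (Real.Gamma_pos_of_pos hts).ne'
  have := (Finset.prod_pos fun i (_ : i ∈ Finset.univ) => Real.Gamma_pos_of_pos (ht i)).ne'
  have := (poch_pos hts (∑ i, m i)).ne'
  field_simp

end CoV

section PolyExp

variable {Ω σ : Type*} [MeasurableSpace Ω] [Fintype σ]

/-- The expectation of polynomials in a random vector, as a linear functional. -/
def polyExp (μ : Measure Ω) (W : Ω → σ → ℝ) : MvPolynomial σ ℝ →ₗ[ℝ] ℝ :=
  (basisMonomials σ ℝ).constr ℝ fun m => ∫ x, eval (W x) (monomial m 1) ∂μ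

theorem polyExp_monomial (μ : Measure Ω) (W : Ω → σ → ℝ) (m : σ →₀ ℕ) :
    polyExp μ W (monomial m 1) = ∫ x, eval (W x) (monomial m 1) ∂μ := by
  have := (basisMonomials σ ℝ).constr_basis ℝ (fun m => ∫ x, eval (W x) (monomial m 1) ∂μ) m
  rwa [coe_basisMonomials] at this

theorem measurable_eval_comp {W : Ω → σ → ℝ} (hW : Measurable W) (p : MvPolynomial σ ℝ) :
    Measurable fun x => eval (W x) p := by
  induction p using MvPolynomial.induction_on with
  | C a => simp
  | add p q hp hq => simp only [map_add]; exact hp.add hq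
  | mul_X p i hp => simp only [map_mul, eval_X]; exact hp.mul ((measurable_pi_apply i).comp hW)

theorem abs_eval_le (p : MvPolynomial σ ℝ) (R : ℝ) :
    ∃ M, ∀ x : σ → ℝ, (∀ i, |x i| ≤ R) → |eval x p| ≤ M := by
  induction p using MvPolynomial.induction_on with
  | C a => exact ⟨|a|, fun x _ => by simp⟩
  | add p q hp hq =>
    obtain ⟨M, hM⟩ := hp
    obtain ⟨M', hM'⟩ := hq
    refine ⟨M + M', fun x hx => ?_⟩
    rw [map_add]
    exact (abs_add_le _ _).trans (add_le_add (hM x hx) (hM' x hx))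
  | mul_X p i hp =>
    obtain ⟨M, hM⟩ := hp
    refine ⟨M * R, fun x hx => ?_⟩
    rw [map_mul, eval_X, abs_mul]
    exact mul_le_mul (hM x hx) (hx i) (abs_nonneg _) ((abs_nonneg _).trans (hM x hx))

variable {μ : Measure Ω} [IsFiniteMeasure μ] {W : Ω → σ → ℝ}

theorem integrable_eval (hW : Measurable W) {R : ℝ} (hR : ∀ᵐ x ∂μ, ∀ i, |W x i| ≤ R)
    (p : MvPolynomial σ ℝ) : Integrable (fun x => eval (W x) p) μ := by
  obtain ⟨M, hM⟩ := abs_eval_le p R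
  exact Integrable.of_bound (measurable_eval_comp hW p).aestronglyMeasurable M
    (hR.mono fun x hx => hM _ hx)

theorem polyExp_apply (hW : Measurable W) {R : ℝ} (hR : ∀ᵐ x ∂μ, ∀ i, |W x i| ≤ R)
    (p : MvPolynomial σ ℝ) : polyExp μ W p = ∫ x, eval (W x) p ∂μ := by
  conv_lhs => rw [p.as_sum]
  have : ∀ x, eval (W x) p = ∑ m ∈ p.support, coeff m p * eval (W x) (monomial m 1) := by
    intro x
    have h := congrArg (eval (W x)) p.as_sum
    rw [map_sum] at h
    refine h.trans (Finset.sum_congr rfl fun m _ => ?_)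
    rw [eval_monomial, eval_monomial, one_mul]
  simp only [this]
  rw [integral_finsetSum _ fun m _ => (integrable_eval hW hR _).const_mul _, map_sum]
  refine Finset.sum_congr rfl fun m _ => ?_
  rw [show monomial m (coeff m p) = coeff m p • monomial m (1 : ℝ) by simp [smul_monomial], map_smul,
    polyExp_monomial, integral_const_mul, smul_eq_mul]

end PolyExp

section DirMeasure

variable {n : ℕ}

/-- The measure with density `e` on the set `s`. -/
def densOn (s : Set (Fin n → ℝ)) (e : (Fin n → ℝ) → ℝ) : Measure (Fin n → ℝ) :=
  (volume.restrict s).withDensity fun x => ENNReal.ofReal (e x)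

theorem ae_densOn {s : Set (Fin n → ℝ)} (hs : MeasurableSet s) {e : (Fin n → ℝ) → ℝ} :
    ∀ᵐ x ∂densOn s e, x ∈ s :=
  (withDensity_absolutelyContinuous _ _).ae_le (ae_restrict_mem hs)

theorem isProbabilityMeasure_densOn {t : Fin (n + 1) → ℝ} {s : Set (Fin n → ℝ)}
    {w : (Fin n → ℝ) → Fin (n + 1) → ℝ} {e : (Fin n → ℝ) → ℝ}
    (h : ∀ m : Fin (n + 1) → ℕ, ∫⁻ x in s, ENNReal.ofReal (e x * ∏ i, w x i ^ m i)
      = ENNReal.ofReal ((∏ i, poch (t i) (m i)) / poch (∑ i, t i) (∑ i, m i))) :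
    IsProbabilityMeasure (densOn s e) := by
  refine ⟨?_⟩
  rw [densOn, withDensity_apply _ MeasurableSet.univ, Measure.restrict_univ]
  simpa [poch_zero] using h 0

theorem isDirichlet_densOn {t : Fin (n + 1) → ℝ} (ht : ∀ i, 0 < t i) {s : Set (Fin n → ℝ)}
    (hs : MeasurableSet s)
    {w : (Fin n → ℝ) → Fin (n + 1) → ℝ} (hw : Measurable w) {e : (Fin n → ℝ) → ℝ}
    (he : Measurable e) (he0 : ∀ x ∈ s, 0 ≤ e x)
    (hpos : ∀ x ∈ s, ∀ i, 0 < w x i)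
    (h : ∀ m : Fin (n + 1) → ℕ, ∫⁻ x in s, ENNReal.ofReal (e x * ∏ i, w x i ^ m i)
      = ENNReal.ofReal ((∏ i, poch (t i) (m i)) / poch (∑ i, t i) (∑ i, m i))) :
    IsDirichlet t (∑ i, t i) (polyExp (densOn s e) w) := by
  intro m
  have hts : 0 < ∑ i, t i := Finset.sum_pos (fun i _ => ht i) Finset.univ_nonempty
  rw [polyExp_monomial, integral_eq_lintegral_of_nonneg_ae
    ((ae_densOn hs).mono fun x hx => by
      simp only [eval_monomial, one_mul, Pi.zero_apply]
      exact Finset.prod_nonneg fun i _ => pow_nonneg (hpos x hx i).le _)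
    (measurable_eval_comp hw _).aestronglyMeasurable, densOn, lintegral_withDensity_eq_lintegral_mul _
      (by fun_prop) (by have := measurable_eval_comp hw (monomial m 1); fun_prop)]
  have := h m
  rw [setLIntegral_congr_fun hs (g := (fun x => ENNReal.ofReal (e x)) *
    fun x => ENNReal.ofReal (eval (w x) (monomial m 1))) (fun x hx => by
      simp only [Pi.mul_apply]
      rw [← ENNReal.ofReal_mul (he0 x hx), eval_monomial, one_mul, Finsupp.prod_fintype _ _ (by simp)])]
    at this
  rw [this, ENNReal.toReal_ofReal, Finsupp.degree_eq_sum]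
  exact div_nonneg (Finset.prod_nonneg fun i _ => (poch_pos (ht i) _).le) (poch_pos hts _).le

end DirMeasure

end MBFPieri

namespace MBFPieri

section Interp

open Polynomial

variable {n : ℕ}

theorem chiC_eq (a : Fin (n + 1) → ℝ) (i : Fin (n + 1)) :
    chiC a i = chi fun j : Fin n => a (i.succAbove j) := by
  rw [chiC, chi, Finset.univ.erase_eq, ← Finset.compl_eq_univ_sdiff, ← Fin.image_succAbove_univ,
    Finset.prod_image Fin.succAbove_right_injective.injOn]

theorem eval_chiC (a : Fin (n + 1) → ℝ) (i : Fin (n + 1)) (x : ℝ) :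
    (chiC a i).eval x = ∏ j : Fin n, (x - a (i.succAbove j)) := by
  rw [chiC_eq, eval_chi]

theorem eval_chiC_of_ne (a : Fin (n + 1) → ℝ) {i j : Fin (n + 1)} (h : j ≠ i) :
    (chiC a i).eval (a j) = 0 := by
  obtain ⟨k, rfl⟩ := Fin.exists_succAbove_eq h
  rw [eval_chiC]
  exact Finset.prod_eq_zero (Finset.mem_univ k) (sub_self _)

theorem eval_chiC_self_ne {a : Fin (n + 1) → ℝ} (ha : Function.Injective a) (i : Fin (n + 1)) :
    (chiC a i).eval (a i) ≠ 0 := by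
  rw [eval_chiC]
  exact Finset.prod_ne_zero_iff.2 fun j _ => sub_ne_zero.2 fun h =>
    Fin.succAbove_ne i j (ha h).symm

theorem monic_chi {k : ℕ} (a : Fin k → ℝ) : (chi a).Monic := monic_prod_X_sub_C _ _

theorem natDegree_chi {k : ℕ} (a : Fin k → ℝ) : (chi a).natDegree = k := by
  simp [chi, natDegree_prod_of_monic, monic_X_sub_C]

theorem degree_chi {k : ℕ} (a : Fin k → ℝ) : (chi a).degree = k := by
  rw [degree_eq_natDegree (monic_chi a).ne_zero, natDegree_chi]

theorem eval_sum_chiC (a : Fin (n + 1) → ℝ) (w : Fin (n + 1) → ℝ) (i : Fin (n + 1)) :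
    (∑ j, C (w j) * chiC a j).eval (a i) = w i * (chiC a i).eval (a i) := by
  rw [eval_finsetSum, Finset.sum_eq_single i]
  · simp
  · intro j _ hj
    rw [eval_mul, eval_chiC_of_ne a hj.symm, mul_zero]
  · simp

theorem degree_sum_chiC_lt (a : Fin (n + 1) → ℝ) (w : Fin (n + 1) → ℝ) :
    (∑ j, C (w j) * chiC a j).degree < (n + 1 : ℕ) := by
  refine (degree_sum_le _ _).trans_lt ((Finset.sup_lt_iff (WithBot.bot_lt_coe _)).2 fun j _ => ?_)
  refine (degree_mul_le _ _).trans_lt ?_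
  rw [chiC_eq, degree_chi]
  calc (C (w j)).degree + n ≤ 0 + (n : WithBot ℕ) := by gcongr; exact degree_C_le
    _ < (n + 1 : ℕ) := by rw [zero_add]; exact_mod_cast Nat.lt_succ_self n

theorem coeff_sum_chiC (a : Fin (n + 1) → ℝ) (w : Fin (n + 1) → ℝ) :
    (∑ j, C (w j) * chiC a j).coeff n = ∑ j, w j := by
  rw [finsetSum_coeff]
  refine Finset.sum_congr rfl fun j _ => ?_
  have := (monic_chi fun k : Fin n => a (j.succAbove k)).coeff_natDegree
  rw [natDegree_chi] at this
  rw [coeff_C_mul, chiC_eq, this, mul_one]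

/-- Lagrange interpolation. -/
theorem eq_sum_chiC {a : Fin (n + 1) → ℝ} (ha : Function.Injective a) {p : ℝ[X]}
    (hp : p.degree < (n + 1 : ℕ)) {w : Fin (n + 1) → ℝ}
    (hw : ∀ i, p.eval (a i) = w i * (chiC a i).eval (a i)) :
    p = ∑ j, C (w j) * chiC a j := by
  refine eq_of_degrees_lt_of_eval_index_eq Finset.univ ha.injOn (by simpa using hp)
    (by simpa using degree_sum_chiC_lt a w) fun i _ => ?_
  rw [hw, eval_sum_chiC]

theorem eq_chi_of_roots {k : ℕ} {p : ℝ[X]} (hp : p.Monic) (hd : p.natDegree = k) {b : Fin k → ℝ}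
    (hb : Function.Injective b) (h : ∀ j, p.eval (b j) = 0) : p = chi b := by
  have hd' : p.degree = k := by rw [degree_eq_natDegree hp.ne_zero, hd]
  refine eq_of_degree_le_of_eval_index_eq Finset.univ hb.injOn (by simp [hd'])
    (by rw [hd', degree_chi]) (by rw [hp.leadingCoeff, (monic_chi b).leadingCoeff]) fun j _ => ?_
  rw [h, eval_chi, Finset.prod_eq_zero (Finset.mem_univ j) (sub_self _)]

theorem chi_injOn {k : ℕ} {f g : Fin k → ℝ} (hf : StrictAnti f) (hg : StrictAnti g)
    (h : chi f = chi g) : f = g := by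
  refine (hf.range_inj hg).1 ?_
  ext x
  have key : ∀ f : Fin k → ℝ, x ∈ Set.range f ↔ (chi f).eval x = 0 := by
    intro f
    rw [eval_chi, Finset.prod_eq_zero_iff]
    simp [sub_eq_zero, eq_comm]
  rw [key, key, h]

theorem neg_one_pow_mul_eval_chiC_pos {a : Fin (n + 1) → ℝ} (ha : StrictAnti a)
    (i : Fin (n + 1)) : 0 < (-1) ^ i.1 * (chiC a i).eval (a i) := by
  have h1 : ((-1 : ℝ)) ^ i.1 = ∏ j : Fin n, if j.castSucc < i then -1 else 1 := by
    rw [Finset.prod_ite, Finset.prod_const, Finset.prod_const_one, mul_one]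
    congr 1
    have := Fin.card_filter_val_lt (n := n) (m := i.1)
    have hi : i.1 ≤ n := Nat.lt_succ_iff.1 i.2
    rw [min_eq_right hi] at this
    rw [← this]
    rfl
  rw [h1, eval_chiC, ← Finset.prod_mul_distrib]
  refine Finset.prod_pos fun j _ => ?_
  split_ifs with h
  · rw [Fin.succAbove_of_castSucc_lt _ _ h]
    have := ha h
    linarith
  · rw [Fin.succAbove_of_le_castSucc _ _ (not_lt.1 h)]
    have := ha (Fin.castSucc_lt_succ_iff.2 le_rfl |>.trans_le' (not_lt.1 h) : i < j.succ)
    linarith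

/-- Alternating signs force interlacing roots. -/
theorem exists_interlacing_roots {a : Fin (n + 1) → ℝ} (ha : StrictAnti a) {f : ℝ → ℝ}
    (hf : Continuous f) (h : ∀ i, 0 < (-1) ^ i.1 * f (a i)) :
    ∃ b : Fin n → ℝ, (∀ j, b j < a j.castSucc ∧ a j.succ < b j) ∧ ∀ j, f (b j) = 0 := by
  have key : ∀ j : Fin n, ∃ x, (x < a j.castSucc ∧ a j.succ < x) ∧ f x = 0 := by
    intro j
    have h1 := h j.castSucc
    have h2 := h j.succ
    rw [Fin.val_castSucc] at h1
    rw [Fin.val_succ, pow_succ] at h2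
    have hlt : a j.succ < a j.castSucc := ha (Fin.castSucc_lt_succ)
    have := intermediate_value_Ioo hlt.le
      (f := fun x => (-1 : ℝ) ^ j.1 * f x) (by fun_prop)
    obtain ⟨x, hx, hx0⟩ := this (show (0 : ℝ) ∈ _ from ⟨by linarith, h1⟩)
    refine ⟨x, ⟨hx.2, hx.1⟩, ?_⟩
    simpa using hx0
  choose b hb using key
  exact ⟨b, fun j => (hb j).1, fun j => (hb j).2⟩

theorem strictAnti_of_interlaces {a : Fin (n + 1) → ℝ} {b : Fin n → ℝ} (ha : Antitone a)
    (h : ∀ j, b j < a j.castSucc ∧ a j.succ < b j) : StrictAnti b := by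
  intro i j hij
  have : a j.castSucc ≤ a i.succ := ha (by
    rw [Fin.le_def]; simp only [Fin.val_succ, Fin.val_castSucc]; exact hij)
  linarith [(h i).2, (h j).1]

end Interp

section Cauchy

open Matrix

variable {n : ℕ}

/-- The product of `f i j` over pairs `i < j`. -/
def pairProd (n : ℕ) (f : Fin n → Fin n → ℝ) : ℝ := ∏ i, ∏ j, if i < j then f i j else 1

theorem pairProd_mul (f g : Fin n → Fin n → ℝ) :
    pairProd n (fun i j => f i j * g i j) = pairProd n f * pairProd n g := by
  simp only [pairProd, ← Finset.prod_mul_distrib]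
  refine Finset.prod_congr rfl fun i _ => Finset.prod_congr rfl fun j _ => ?_
  split_ifs <;> simp

theorem pairProd_pos {f : Fin n → Fin n → ℝ} (h : ∀ i j, i < j → 0 < f i j) : 0 < pairProd n f :=
  Finset.prod_pos fun i _ => Finset.prod_pos fun j _ => by
    split_ifs with hij
    exacts [h i j hij, one_pos]

theorem pairProd_rpow {f : Fin n → Fin n → ℝ} (h : ∀ i j, i < j → 0 ≤ f i j) (r : ℝ) :
    pairProd n (fun i j => f i j ^ r) = pairProd n f ^ r := by
  rw [pairProd, pairProd, ← Real.finsetProd_rpow]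
  · refine Finset.prod_congr rfl fun i _ => ?_
    rw [← Real.finsetProd_rpow]
    · refine Finset.prod_congr rfl fun j _ => ?_
      split_ifs <;> simp
    · intro j _
      split_ifs with hij
      exacts [h i j hij, zero_le_one]
  · intro i _
    refine Finset.prod_nonneg fun j _ => ?_
    split_ifs with hij
    exacts [h i j hij, zero_le_one]

theorem pairProd_congr {f g : Fin n → Fin n → ℝ} (h : ∀ i j, i < j → f i j = g i j) :
    pairProd n f = pairProd n g :=
  Finset.prod_congr rfl fun i _ => Finset.prod_congr rfl fun j _ => by
    split_ifs with hij
    exacts [h i j hij, rfl]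

theorem pairProd_succ (f : Fin (n + 1) → Fin (n + 1) → ℝ) :
    pairProd (n + 1) f = pairProd n (fun i j => f i.castSucc j.castSucc) *
      ∏ i : Fin n, f i.castSucc (Fin.last n) := by
  rw [pairProd, Fin.prod_univ_castSucc]
  have h1 : ∏ j, (if Fin.last n < j then f (Fin.last n) j else 1) = 1 :=
    Finset.prod_eq_one fun j _ => by rw [if_neg (not_lt.2 (Fin.le_last j))]
  rw [h1, mul_one, pairProd, ← Finset.prod_mul_distrib]
  refine Finset.prod_congr rfl fun i _ => ?_
  rw [Fin.prod_univ_castSucc, if_pos (Fin.castSucc_lt_last i)]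
  rfl

theorem prod_succAbove (f : Fin (n + 1) → Fin (n + 1) → ℝ) (i : Fin (n + 1)) :
    ∏ j, (if j = i then 1 else f i j) = ∏ j : Fin n, f i (i.succAbove j) := by
  rw [Fin.prod_univ_succAbove _ i, if_pos rfl, one_mul]
  exact Finset.prod_congr rfl fun j _ => if_neg (Fin.succAbove_ne i j)

theorem prod_offdiag (f : Fin n → Fin n → ℝ) (hf : ∀ i j, f i j = f j i) :
    ∏ i, ∏ j, (if j = i then 1 else f i j) = pairProd n f ^ 2 := by
  have h1 : pairProd n f = ∏ i, ∏ j, if j < i then f i j else 1 := by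
    rw [pairProd, Finset.prod_comm]
    refine Finset.prod_congr rfl fun i _ => Finset.prod_congr rfl fun j _ => ?_
    rw [hf]
  rw [sq]
  nth_rw 2 [h1]
  rw [pairProd, ← Finset.prod_mul_distrib]
  refine Finset.prod_congr rfl fun i _ => ?_
  rw [← Finset.prod_mul_distrib]
  refine Finset.prod_congr rfl fun j _ => ?_
  rcases lt_trichotomy i j with h | h | h
  · simp [h, h.ne', h.not_gt]
  · simp [h]
  · simp [h, h.ne, h.not_gt]

theorem abs_det_vandermonde (x : Fin n → ℝ) :
    |(vandermonde x).det| = pairProd n fun i j => |x i - x j| := by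
  rw [det_vandermonde, Finset.abs_prod, pairProd]
  refine Finset.prod_congr rfl fun i _ => ?_
  rw [Finset.abs_prod, Finset.prod_ite, Finset.prod_const_one, mul_one]
  refine Finset.prod_congr (by ext; simp) fun j _ => abs_sub_comm _ _

theorem eval_matrix_eq (x : Fin n → ℝ) (p : Fin n → Polynomial ℝ) (hp : ∀ j, (p j).natDegree < n) :
    (Matrix.of fun i j => (p j).eval (x i)) =
      vandermonde x * Matrix.of fun i j : Fin n => (p j).coeff i := by
  ext i j
  rw [mul_apply, of_apply, Polynomial.eval_eq_sum_range' (hp j), ← Fin.sum_univ_eq_sum_range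
    (fun k => (p j).coeff k * x i ^ k)]
  refine Finset.sum_congr rfl fun k _ => ?_
  rw [vandermonde_apply, of_apply, mul_comm]

/-- The absolute value of the Cauchy determinant. -/
theorem abs_det_cauchy {x y : Fin n → ℝ} (hy : Function.Injective y) (h : ∀ i j, x i ≠ y j) :
    |(Matrix.of fun i j => (x i - y j)⁻¹).det| =
      (pairProd n fun i j => |x i - x j|) * (pairProd n fun i j => |y i - y j|) /
        ∏ i, ∏ j, |x i - y j| := by
  rcases n with _ | n
  · simp [pairProd]
  set V := pairProd (n + 1) fun i j => |y i - y j| with hV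
  have hV0 : 0 < V := pairProd_pos fun i j hij => abs_pos.2 (sub_ne_zero.2 (hy.ne hij.ne))
  have hdeg : ∀ j, (chiC y j).natDegree < n + 1 := fun j => by
    rw [chiC_eq, natDegree_chi]; exact Nat.lt_succ_self n
  set K := (Matrix.of fun i j : Fin (n + 1) => (chiC y j).coeff i).det with hK
  have h1 : V ^ 2 = V * |K| := by
    have := congrArg (fun M => |det M|) (eval_matrix_eq y (chiC y) hdeg)
    simp only [det_mul, abs_mul, abs_det_vandermonde] at this
    rw [← this]
    have hd : (Matrix.of fun i j => (chiC y j).eval (y i)) =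
        diagonal fun i => (chiC y i).eval (y i) := by
      ext i j
      rcases eq_or_ne i j with rfl | hij
      · simp
      · rw [diagonal_apply_ne _ hij, of_apply, eval_chiC_of_ne y hij]
    rw [hd, det_diagonal, Finset.abs_prod, ← prod_offdiag _ fun i j => abs_sub_comm _ _]
    refine Finset.prod_congr rfl fun i _ => ?_
    rw [prod_succAbove (fun i j => |y i - y j|), eval_chiC, Finset.abs_prod]
  have h2 : |K| = V := by
    have : V * (V - |K|) = 0 := by rw [mul_sub, ← h1]; ring
    rcases mul_eq_zero.1 this with h | h
    · exact absurd h hV0.ne'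
    · linarith
  have h3 := congrArg (fun M => |det M|) (eval_matrix_eq x (chiC y) hdeg)
  simp only [det_mul, abs_mul, abs_det_vandermonde] at h3
  rw [← hK, h2] at h3
  rw [← h3]
  have h4 : (Matrix.of fun i j => (chiC y j).eval (x i)) =
      Matrix.of fun i j => (∏ k, (x i - y k)) * (Matrix.of fun i j => (x i - y j)⁻¹) i j := by
    ext i j
    rw [of_apply, of_apply, of_apply, eval_chiC, Fin.prod_univ_succAbove _ j]
    have := sub_ne_zero.2 (h i j)
    field_simp
  rw [h4, det_mul_column, abs_mul, Finset.abs_prod]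
  simp only [Finset.abs_prod]
  rw [mul_div_cancel_left₀]
  exact Finset.prod_ne_zero_iff.2 fun i _ => Finset.prod_ne_zero_iff.2 fun j _ =>
    abs_ne_zero.2 (sub_ne_zero.2 (h i j))

end Cauchy

end MBFPieri

namespace MBFPieri

theorem hasFDerivAt_prod_sub {E ι : Type*} [NormedAddCommGroup E] [NormedSpace ℝ E] [Fintype ι]
    (c e : ℝ) {W : E → ι → ℝ} {W' : ι → E →L[ℝ] ℝ} {x : E}
    (hW : ∀ j, HasFDerivAt (fun x => W x j) (W' j) x) (hne : ∀ j, e ≠ W x j) :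
    HasFDerivAt (fun x => c * ∏ j, (e - W x j))
      ((c * ∏ j, (e - W x j)) • ∑ j, (-(e - W x j)⁻¹) • W' j) x := by
  classical
  have h := (HasFDerivAt.finsetProd (u := Finset.univ)
    (fun j _ => (hW j).const_sub e)).const_mul c
  refine h.congr_fderiv ?_
  rw [mul_smul, Finset.smul_sum, Finset.smul_sum, Finset.smul_sum]
  refine Finset.sum_congr rfl fun j _ => ?_
  rw [← Finset.mul_prod_erase _ _ (Finset.mem_univ j), smul_smul, smul_smul,
    smul_smul, smul_neg, ← neg_smul]
  congr 1
  have := sub_ne_zero.2 (hne j)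
  field_simp

section Corner

variable {n : ℕ}

/-- The set of points interlacing with `a`. -/
def cornerBox (a : Fin (n + 1) → ℝ) : Set (Fin n → ℝ) :=
  {x | ∀ j, x j < a j.castSucc ∧ a j.succ < x j}

theorem measurableSet_cornerBox (a : Fin (n + 1) → ℝ) : MeasurableSet (cornerBox a) := by
  rw [cornerBox, Set.ofPred_forall]
  refine MeasurableSet.iInter fun j => ?_
  exact (measurableSet_lt (measurable_pi_apply j) measurable_const).inter
    (measurableSet_lt measurable_const (measurable_pi_apply j))

/-- The coefficients of the partial fraction expansion of `∏ (ζ - x_j) / ∏ (ζ - a_i)`. -/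
def cornerW (a : Fin (n + 1) → ℝ) (x : Fin n → ℝ) (i : Fin (n + 1)) : ℝ :=
  ((chiC a i).eval (a i))⁻¹ * ∏ j, (a i - x j)

/-- The Dixon–Anderson density. -/
def cornerDens (θ : ℝ) (a : Fin (n + 1) → ℝ) (x : Fin n → ℝ) : ℝ :=
  Real.Gamma ((n + 1 : ℕ) * θ) / Real.Gamma θ ^ (n + 1) *
    (pairProd (n + 1) fun i j => |a i - a j|) ^ (1 - 2 * θ) *
    (pairProd n fun i j => |x i - x j|) * (∏ i, ∏ j, |a i - x j|) ^ (θ - 1)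

variable {a : Fin (n + 1) → ℝ} {x : Fin n → ℝ}

theorem succ_le_of_castSucc_lt {j : Fin n} {i : Fin (n + 1)} (h : j.castSucc < i) : j.succ ≤ i := by
  rw [Fin.le_def, Fin.val_succ]
  exact Fin.lt_def.1 h

theorem interlace_ne (ha : StrictAnti a) (hx : x ∈ cornerBox a) (i : Fin (n + 1)) (j : Fin n) :
    a i ≠ x j := by
  rcases lt_or_ge j.castSucc i with h | h
  · have := ha.antitone (succ_le_of_castSucc_lt h : j.succ ≤ i)
    have := (hx j).2
    intro h'; linarith
  · have := ha.antitone h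
    have := (hx j).1
    intro h'; linarith

theorem cornerW_pos (ha : StrictAnti a) (hx : x ∈ cornerBox a) (i : Fin (n + 1)) :
    0 < cornerW a x i := by
  rw [cornerW, eval_chiC, ← Finset.prod_inv_distrib, ← Finset.prod_mul_distrib]
  refine Finset.prod_pos fun j _ => ?_
  rw [inv_mul_eq_div]
  rcases lt_or_ge j.castSucc i with h | h
  · have h1 := ha.antitone (succ_le_of_castSucc_lt h : j.succ ≤ i)
    rw [Fin.succAbove_of_castSucc_lt _ _ h]
    exact div_pos_of_neg_of_neg (by linarith [(hx j).2]) (by linarith [ha h])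
  · have h1 := ha.antitone h
    rw [Fin.succAbove_of_le_castSucc _ _ h]
    exact div_pos (by linarith [(hx j).1]) (by linarith [(hx j).1, (hx j).2])

theorem chi_eq_sum_cornerW (ha : StrictAnti a) (x : Fin n → ℝ) :
    chi x = ∑ i, Polynomial.C (cornerW a x i) * chiC a i := by
  refine eq_sum_chiC ha.injective ?_ fun i => ?_
  · rw [degree_chi]; exact_mod_cast Nat.lt_succ_self n
  · rw [cornerW, eval_chi, mul_comm, mul_inv_cancel_left₀ (eval_chiC_self_ne ha.injective i)]

theorem sum_cornerW (ha : StrictAnti a) (x : Fin n → ℝ) : ∑ i, cornerW a x i = 1 := by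
  rw [← coeff_sum_chiC a, ← chi_eq_sum_cornerW ha]
  have := (monic_chi x).coeff_natDegree
  rwa [natDegree_chi] at this

theorem cornerW_injOn (ha : StrictAnti a) :
    Set.InjOn (fun x (i : Fin n) => cornerW a x i.castSucc) (cornerBox a) := by
  intro x hx x' hx' h
  have h1 : ∀ i, cornerW a x i = cornerW a x' i := by
    have h0 : ∀ i : Fin n, cornerW a x i.castSucc = cornerW a x' i.castSucc := congrFun h
    intro i
    induction i using Fin.lastCases with
    | cast i => exact h0 i
    | last =>
      have e1 := sum_cornerW ha x
      have e2 := sum_cornerW ha x'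
      rw [Fin.sum_univ_castSucc] at e1 e2
      simp only [h0] at e1
      linarith
  refine chi_injOn (strictAnti_of_interlaces ha.antitone hx)
    (strictAnti_of_interlaces ha.antitone hx') ?_
  rw [chi_eq_sum_cornerW ha, chi_eq_sum_cornerW ha]
  simp only [h1]

theorem cornerW_surj (ha : StrictAnti a) {u : Fin n → ℝ} (hu : u ∈ simp0 n 1) :
    ∃ x ∈ cornerBox a, (fun i : Fin n => cornerW a x i.castSucc) = u := by
  set w : Fin (n + 1) → ℝ := Fin.snoc u (1 - ∑ i, u i) with hw
  have hw0 : ∀ i, 0 < w i := by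
    intro i
    induction i using Fin.lastCases with
    | cast i => simpa [hw] using hu.1 i
    | last => simpa [hw] using hu.2
  have hw1 : ∑ i, w i = 1 := by rw [Fin.sum_univ_castSucc]; simp [hw]
  set P := ∑ i, Polynomial.C (w i) * chiC a i with hP
  have hdeg : P.natDegree ≤ n := by
    rcases eq_or_ne P 0 with h | h
    · simp [h]
    · have := degree_sum_chiC_lt a w
      rw [← hP, Polynomial.degree_eq_natDegree h] at this
      exact Nat.lt_succ_iff.1 (by exact_mod_cast this)
  have hc : P.coeff n = 1 := by rw [hP, coeff_sum_chiC, hw1]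
  have hmonic : P.Monic := Polynomial.monic_of_natDegree_le_of_coeff_eq_one n hdeg hc
  have hdeg' : P.natDegree = n := le_antisymm hdeg (Polynomial.le_natDegree_of_ne_zero (by simp [hc]))
  obtain ⟨b, hb, hb0⟩ := exists_interlacing_roots ha (f := fun x => P.eval x) P.continuous (by
    intro i
    rw [hP, eval_sum_chiC, mul_left_comm]
    exact mul_pos (hw0 i) (neg_one_pow_mul_eval_chiC_pos ha i))
  refine ⟨b, hb, ?_⟩
  have hPb := eq_chi_of_roots hmonic hdeg' (strictAnti_of_interlaces ha.antitone hb).injective hb0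
  ext i
  rw [cornerW, ← eval_chi, ← hPb, hP, eval_sum_chiC, mul_comm (w _),
    inv_mul_cancel_left₀ (eval_chiC_self_ne ha.injective _)]
  simp [hw]

/-- The Jacobian matrix of `cornerW`. -/
def cornerJac (a : Fin (n + 1) → ℝ) (x : Fin n → ℝ) : Matrix (Fin n) (Fin n) ℝ :=
  Matrix.of fun i j => (-cornerW a x i.castSucc) *
    (Matrix.of fun i j => (a i.castSucc - x j)⁻¹) i j

theorem hasFDerivAt_cornerW (ha : StrictAnti a) (hx : x ∈ cornerBox a) :
    HasFDerivAt (fun x (i : Fin n) => cornerW a x i.castSucc)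
      (Matrix.toLin' (cornerJac a x)).toContinuousLinearMap x := by
  rw [hasFDerivAt_pi']
  intro i
  have h := hasFDerivAt_prod_sub (((chiC a i.castSucc).eval (a i.castSucc))⁻¹) (a i.castSucc)
    (W := fun x : Fin n → ℝ => x) (W' := fun j => ContinuousLinearMap.proj j) (x := x)
    (fun j => hasFDerivAt_apply j x) (fun j => interlace_ne ha hx _ j)
  refine h.congr_fderiv ?_
  ext v
  simp [cornerJac, Matrix.mulVec, dotProduct, Finset.mul_sum, cornerW, mul_assoc]

theorem abs_det_cornerJac (ha : StrictAnti a) (hx : x ∈ cornerBox a) :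
    |(cornerJac a x).det| =
      (pairProd n fun i j => |x i - x j|) / (pairProd (n + 1) fun i j => |a i - a j|) := by
  set V := pairProd (n + 1) fun i j => |a i - a j| with hV
  have hV0 : 0 < V := pairProd_pos fun i j hij => abs_pos.2 (sub_ne_zero.2 (ha.injective.ne hij.ne))
  have hD : ∀ i, 0 < |(chiC a i).eval (a i)| := fun i =>
    abs_pos.2 (eval_chiC_self_ne ha.injective i)
  have hV2 : (∏ i : Fin n, |(chiC a i.castSucc).eval (a i.castSucc)|) *
      |(chiC a (Fin.last n)).eval (a (Fin.last n))| = V ^ 2 := by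
    rw [← Fin.prod_univ_castSucc (fun i => |(chiC a i).eval (a i)|),
      ← prod_offdiag _ fun i j => abs_sub_comm _ _]
    refine Finset.prod_congr rfl fun i _ => ?_
    rw [prod_succAbove (fun i j => |a i - a j|), eval_chiC, Finset.abs_prod]
  have hVl : V = (pairProd n fun i j => |a i.castSucc - a j.castSucc|) *
      |(chiC a (Fin.last n)).eval (a (Fin.last n))| := by
    rw [hV, pairProd_succ, eval_chiC, Finset.abs_prod]
    congr 1
    refine Finset.prod_congr rfl fun i _ => ?_
    rw [Fin.succAbove_last, abs_sub_comm]
  have hP : ∀ i : Fin n, 0 < ∏ j, |a i.castSucc - x j| := fun i =>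
    Finset.prod_pos fun j _ => abs_pos.2 (sub_ne_zero.2 (interlace_ne ha hx _ _))
  have hw : ∏ i : Fin n, |cornerW a x i.castSucc| =
      (∏ i : Fin n, ∏ j, |a i.castSucc - x j|) /
        ∏ i : Fin n, |(chiC a i.castSucc).eval (a i.castSucc)| := by
    rw [← Finset.prod_div_distrib]
    refine Finset.prod_congr rfl fun i _ => ?_
    rw [cornerW, abs_mul, abs_inv, Finset.abs_prod, inv_mul_eq_div]
  rw [cornerJac, Matrix.det_mul_column, abs_mul, Finset.abs_prod,
    abs_det_cauchy (strictAnti_of_interlaces ha.antitone hx).injective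
      (fun i j => interlace_ne ha hx _ _)]
  simp only [abs_neg]
  rw [hw]
  have h1 := (Finset.prod_pos fun i (_ : i ∈ Finset.univ) => hP i).ne'
  have h2 := (Finset.prod_pos fun (i : Fin n) (_ : i ∈ Finset.univ) => hD i.castSucc).ne'
  have h3 := (hD (Fin.last n)).ne'
  rw [eq_div_iff hV0.ne']
  field_simp
  apply mul_right_cancel₀ h3
  linear_combination (-(pairProd n fun i j => |x i - x j|)) * hV2 -
    V * (pairProd n fun i j => |x i - x j|) * hVl

theorem cornerDens_eq {θ : ℝ} (ha : StrictAnti a) (hx : x ∈ cornerBox a) :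
    cornerDens θ a x = Real.Gamma (∑ _i : Fin (n + 1), θ) / (∏ _i : Fin (n + 1), Real.Gamma θ) *
      |(Matrix.toLin' (cornerJac a x)).toContinuousLinearMap.det| *
        ∏ i, cornerW a x i ^ (θ - 1) := by
  set V := pairProd (n + 1) fun i j => |a i - a j| with hV
  have hV0 : 0 < V := pairProd_pos fun i j hij => abs_pos.2 (sub_ne_zero.2 (ha.injective.ne hij.ne))
  have hP : 0 < ∏ i, ∏ j, |a i - x j| := Finset.prod_pos fun i _ =>
    Finset.prod_pos fun j _ => abs_pos.2 (sub_ne_zero.2 (interlace_ne ha hx _ _))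
  have hw : ∏ i, cornerW a x i = (∏ i, ∏ j, |a i - x j|) / V ^ 2 := by
    rw [← prod_offdiag _ fun i j => abs_sub_comm _ _, ← Finset.prod_div_distrib]
    refine Finset.prod_congr rfl fun i _ => ?_
    rw [← abs_of_pos (cornerW_pos ha hx i), cornerW, abs_mul, abs_inv, Finset.abs_prod,
      inv_mul_eq_div, prod_succAbove (fun i j => |a i - a j|), eval_chiC, Finset.abs_prod]
  rw [Real.finsetProd_rpow _ _ fun i _ => (cornerW_pos ha hx i).le, hw,
    Real.div_rpow hP.le (by positivity), ContinuousLinearMap.det,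
    LinearMap.coe_toContinuousLinearMap, LinearMap.det_toLin', abs_det_cornerJac ha hx, cornerDens,
    ← hV]
  have hr : V ^ (1 - 2 * θ) = V⁻¹ / (V ^ 2) ^ (θ - 1) := by
    rw [← Real.rpow_natCast, ← Real.rpow_mul hV0.le, ← Real.rpow_neg_one, ← Real.rpow_sub hV0]
    congr 1; push_cast; ring
  rw [hr]
  simp only [Finset.sum_const, Finset.prod_const, Finset.card_univ, Fintype.card_fin, nsmul_eq_mul]
  ring

theorem cornerDens_nonneg {θ : ℝ} (hθ : 0 < θ) (a : Fin (n + 1) → ℝ) (x : Fin n → ℝ) :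
    0 ≤ cornerDens θ a x := by
  have h : ∀ {k : ℕ} (f : Fin k → ℝ), 0 ≤ pairProd k fun i j => |f i - f j| := fun f =>
    Finset.prod_nonneg fun i _ => Finset.prod_nonneg fun j _ => by split_ifs <;> positivity
  have h1 := Real.Gamma_pos_of_pos hθ
  have h2 : 0 < Real.Gamma ((n + 1 : ℕ) * θ) := Real.Gamma_pos_of_pos (by positivity)
  have := h a
  have := h x
  unfold cornerDens
  positivity

theorem measurable_pairProd {Ω : Type*} [MeasurableSpace Ω] {k : ℕ} {f : Ω → Fin k → Fin k → ℝ}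
    (hf : ∀ i j, Measurable fun x => f x i j) : Measurable fun x => pairProd k (f x) := by
  unfold pairProd
  refine Finset.measurable_prod _ fun i _ => Finset.measurable_prod _ fun j _ => ?_
  split_ifs
  exacts [hf i j, measurable_const]

theorem measurable_cornerDens (θ : ℝ) (a : Fin (n + 1) → ℝ) :
    Measurable (cornerDens θ a) := by
  unfold cornerDens
  have h2 : Measurable fun x : Fin n → ℝ => pairProd n fun i j => |x i - x j| :=
    measurable_pairProd fun i j => by fun_prop
  fun_prop

theorem measurable_cornerW (a : Fin (n + 1) → ℝ) : Measurable (cornerW a) := by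
  refine measurable_pi_iff.2 fun i => ?_
  unfold cornerW
  fun_prop

theorem lintegral_cornerDens {θ : ℝ} (hθ : 0 < θ) (ha : StrictAnti a) (m : Fin (n + 1) → ℕ) :
    ∫⁻ x in cornerBox a, ENNReal.ofReal (cornerDens θ a x * ∏ i, cornerW a x i ^ m i)
      = ENNReal.ofReal ((∏ i, poch θ (m i)) / poch (∑ _i : Fin (n + 1), θ) (∑ i, m i)) :=
  lintegral_dirichlet_of_cov (t := fun _ => θ) (fun _ => hθ) (measurableSet_cornerBox a)
    (fun x _ => sum_cornerW ha x) (fun _ hx i => cornerW_pos ha hx i)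
    (fun _ hx => (hasFDerivAt_cornerW ha hx).hasFDerivWithinAt) (cornerW_injOn ha)
    (fun _ hu => cornerW_surj ha hu) (fun _ hx => cornerDens_eq ha hx) m

/-- The Dixon–Anderson measure. -/
def cornerMeas (θ : ℝ) (a : Fin (n + 1) → ℝ) : Measure (Fin n → ℝ) :=
  densOn (cornerBox a) (cornerDens θ a)

theorem isProbabilityMeasure_cornerMeas {θ : ℝ} (hθ : 0 < θ) (ha : StrictAnti a) :
    IsProbabilityMeasure (cornerMeas θ a) :=
  isProbabilityMeasure_densOn (lintegral_cornerDens hθ ha)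

theorem ae_cornerMeas (θ : ℝ) (a : Fin (n + 1) → ℝ) : ∀ᵐ x ∂cornerMeas θ a, x ∈ cornerBox a :=
  ae_densOn (measurableSet_cornerBox a)

theorem abs_le_of_mem_cornerBox {ρ : ℝ} (hρ : ∀ i, |a i| ≤ ρ) (hx : x ∈ cornerBox a) (j : Fin n) :
    |x j| ≤ ρ :=
  abs_le.2 ⟨by linarith [(hx j).2, (abs_le.1 (hρ j.succ)).1],
    by linarith [(hx j).1, (abs_le.1 (hρ j.castSucc)).2]⟩

theorem exists_abs_le {k : ℕ} (a : Fin k → ℝ) : ∃ ρ, 0 ≤ ρ ∧ ∀ i, |a i| ≤ ρ :=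
  ⟨∑ i, |a i|, Finset.sum_nonneg fun _ _ => abs_nonneg _, fun i =>
    Finset.single_le_sum (f := fun i => |a i|) (fun _ _ => abs_nonneg _) (Finset.mem_univ i)⟩

open MvPolynomial in
theorem cornerAt_cornerMeas {θ : ℝ} (hθ : 0 < θ) (ha : StrictAnti a) :
    CornerAt θ a (polyExp (cornerMeas θ a) id) := by
  have := isProbabilityMeasure_cornerMeas hθ ha
  have hdir := isDirichlet_densOn (t := fun _ => θ) (fun _ => hθ) (measurableSet_cornerBox a)
    (measurable_cornerW a) (e := cornerDens θ a)
    (measurable_cornerDens θ a)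
    (fun x _ => cornerDens_nonneg hθ a x) (fun _ hx i => cornerW_pos ha hx i)
    (lintegral_cornerDens hθ ha)
  rw [← cornerMeas] at hdir
  obtain ⟨ρ, -, hρ⟩ := exists_abs_le a
  have hb : ∀ᵐ x ∂cornerMeas θ a, ∀ i, |x i| ≤ ρ :=
    (ae_cornerMeas θ a).mono fun x hx j => abs_le_of_mem_cornerBox hρ hx j
  have hb' : ∀ᵐ x ∂cornerMeas θ a, ∀ i, |cornerW a x i| ≤ 1 :=
    (ae_cornerMeas θ a).mono fun x hx i => by
      rw [abs_of_pos (cornerW_pos ha hx i), ← sum_cornerW ha x]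
      exact Finset.single_le_sum (f := cornerW a x) (fun i _ => (cornerW_pos ha hx i).le)
        (Finset.mem_univ i)
  intro K ζ
  have h1 := hdir.apply (isHomogeneous_prod_linear Finset.univ
    (fun (k : Fin K) i => (chiC a i).eval (ζ k)))
  rw [polyExp_apply (measurable_cornerW a) hb'] at h1
  rw [polyExp_apply measurable_id hb]
  simp only [one_mul, Fintype.card_fin]
  simp only [Finset.sum_const, Finset.card_univ, Fintype.card_fin, nsmul_eq_mul] at h1
  rw [← h1]
  refine integral_congr_ae (.of_forall fun x => ?_)
  simp only [id]
  rw [eval_phi, map_prod]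
  refine Finset.prod_congr rfl fun k _ => ?_
  rw [chi_eq_sum_cornerW ha, Polynomial.eval_finsetSum, map_sum]
  simp [mul_comm]

end Corner

end MBFPieri

namespace MBFPieri

section Upper

variable {n : ℕ} {η W : Fin (n + 1) → ℝ} {y : ℝ}

/-- `W` interlaces with `η` from above: `W_1 > η_1 > W_2 > η_2 > ⋯`. -/
def UpInt (η W : Fin (n + 1) → ℝ) : Prop :=
  (∀ i, η i < W i) ∧ ∀ j : Fin n, W j.succ < η j.castSucc

theorem UpInt.lt_of_lt (h : UpInt η W) (hη : StrictAnti η) {i j : Fin (n + 1)} (hij : i < j) :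
    W j < η i := by
  obtain ⟨k, rfl⟩ := Fin.exists_succ_eq.2 (Fin.ne_zero_of_lt hij)
  have : i ≤ k.castSucc := by
    rw [Fin.lt_def, Fin.val_succ] at hij
    rw [Fin.le_def, Fin.val_castSucc]
    exact Nat.lt_succ_iff.1 hij
  exact (h.2 k).trans_le (hη.antitone this)

theorem UpInt.strictAnti (h : UpInt η W) (hη : StrictAnti η) : StrictAnti W := fun i _ hij =>
  (h.lt_of_lt hη hij).trans (h.1 i)

theorem UpInt.ne (h : UpInt η W) (hη : StrictAnti η) (i j : Fin (n + 1)) : η i ≠ W j := by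
  rcases lt_or_ge i j with hij | hij
  · exact (h.lt_of_lt hη hij).ne'
  · exact ((hη.antitone hij).trans_lt (h.1 j)).ne

/-- The partial fraction coefficients of `(1 - ∏ (ζ - W_j) / ∏ (ζ - η_i)) / y`. -/
def pieriV (η : Fin (n + 1) → ℝ) (y : ℝ) (W : Fin (n + 1) → ℝ) (i : Fin (n + 1)) : ℝ :=
  -(y * (chiC η i).eval (η i))⁻¹ * ∏ j, (η i - W j)

theorem UpInt.pieriV_pos (h : UpInt η W) (hη : StrictAnti η) (hy : 0 < y) (i : Fin (n + 1)) :
    0 < pieriV η y W i := by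
  have e : pieriV η y W i = (W i - η i) / y *
      ∏ j : Fin n, ((η i - W (i.succAbove j)) / (η i - η (i.succAbove j))) := by
    rw [pieriV, eval_chiC, Fin.prod_univ_succAbove _ i, Finset.prod_div_distrib, mul_inv]
    ring
  rw [e]
  refine mul_pos (div_pos (by linarith [h.1 i]) hy) (Finset.prod_pos fun j _ => ?_)
  rcases lt_or_gt_of_ne (Fin.succAbove_ne i j) with hj | hj
  · have := h.1 (i.succAbove j)
    exact div_pos_of_neg_of_neg (by linarith [hη hj]) (by linarith [hη hj])
  · exact div_pos (by linarith [h.lt_of_lt hη hj]) (by linarith [hη hj])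

theorem chi_eq_sub_pieriV (hη : StrictAnti η) (hy : y ≠ 0) (W : Fin (n + 1) → ℝ) :
    chi W = chi η - Polynomial.C y * ∑ i, Polynomial.C (pieriV η y W i) * chiC η i := by
  have h := eq_sum_chiC hη.injective (p := chi W - chi η) (w := fun i => -y * pieriV η y W i) ?_ ?_
  · rw [eq_sub_iff_add_eq, ← eq_sub_iff_add_eq', ← neg_inj, neg_sub, h, Finset.mul_sum,
      ← Finset.sum_neg_distrib]
    exact Finset.sum_congr rfl fun i _ => by simp [mul_assoc]
  · have := Polynomial.degree_sub_lt_left (p := chi W) (q := chi η) (by simp [degree_chi])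
      (monic_chi W).ne_zero (by rw [(monic_chi W).leadingCoeff, (monic_chi η).leadingCoeff])
    rwa [degree_chi] at this
  · intro i
    have h1 : (chi η).eval (η i) = 0 := by
      rw [eval_chi, Finset.prod_eq_zero (Finset.mem_univ i) (sub_self _)]
    have := eval_chiC_self_ne hη.injective i
    rw [Polynomial.eval_sub, h1, sub_zero, eval_chi, pieriV]
    field_simp

theorem coeff_chi (f : Fin (n + 1) → ℝ) : (chi f).coeff n = -∑ i, f i := by
  have := Polynomial.prod_X_sub_C_coeff_card_pred Finset.univ f (by simp)
  simpa [chi] using this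

theorem mul_sum_pieriV (hη : StrictAnti η) (hy : y ≠ 0) (W : Fin (n + 1) → ℝ) :
    y * ∑ i, pieriV η y W i = ∑ i, W i - ∑ i, η i := by
  have := congrArg (fun p => p.coeff n) (chi_eq_sub_pieriV hη hy W)
  simp only [Polynomial.coeff_sub, Polynomial.coeff_C_mul, coeff_sum_chiC, coeff_chi] at this
  linarith

/-- Every weight vector is realised by some `W`. -/
theorem exists_upInt (hη : StrictAnti η) (hy : 0 < y) {v : Fin (n + 1) → ℝ} (hv : ∀ i, 0 < v i) :
    ∃ W, UpInt η W ∧ pieriV η y W = v := by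
  set Q := ∑ i, Polynomial.C (v i) * chiC η i with hQ
  set P := chi η - Polynomial.C y * Q with hP
  have hdQ : (Polynomial.C y * Q).degree < (chi η).degree := by
    rw [degree_chi]
    refine lt_of_le_of_lt ?_ (degree_sum_chiC_lt η v)
    rw [← hQ, Polynomial.degree_C_mul hy.ne']
  have hmonic : P.Monic := (monic_chi η).sub_of_left hdQ
  have hdeg : P.natDegree = n + 1 := by
    rw [hP, Polynomial.natDegree_sub_eq_left_of_natDegree_lt, natDegree_chi]
    by_cases hQ0 : Polynomial.C y * Q = 0
    · simp [hQ0, natDegree_chi]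
    · exact Polynomial.natDegree_lt_natDegree hQ0 hdQ
  have hev : ∀ i, P.eval (η i) = -(y * (v i * (chiC η i).eval (η i))) := by
    intro i
    have h1 : (chi η).eval (η i) = 0 := by
      rw [eval_chi, Finset.prod_eq_zero (Finset.mem_univ i) (sub_self _)]
    rw [hP, Polynomial.eval_sub, h1, Polynomial.eval_mul, hQ, eval_sum_chiC, Polynomial.eval_C,
      zero_sub]
  obtain ⟨b, hb, hb0⟩ := exists_interlacing_roots hη (f := fun x => (-P).eval x)
    (-P).continuous (by
      intro i
      have := mul_pos (mul_pos hy (hv i)) (neg_one_pow_mul_eval_chiC_pos hη i)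
      rw [Polynomial.eval_neg, hev]
      linarith)
  have hb0' : ∀ j, P.eval (b j) = 0 := fun j => by simpa using hb0 j
  obtain ⟨c, hc, hc0⟩ : ∃ c, η 0 < c ∧ P.eval c = 0 := by
    have h0 : P.eval (η 0) < 0 := by
      have := mul_pos (mul_pos hy (hv 0)) (neg_one_pow_mul_eval_chiC_pos hη 0)
      simp only [Fin.val_zero, pow_zero, one_mul] at this
      rw [hev]
      linarith
    have ht := P.tendsto_atTop_of_leadingCoeff_nonneg
      (by rw [Polynomial.degree_eq_natDegree hmonic.ne_zero, hdeg]; exact_mod_cast Nat.succ_pos n)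
      (by rw [hmonic.leadingCoeff]; exact zero_le_one)
    obtain ⟨x, hx1, hx2⟩ := ((ht.eventually_gt_atTop 0).and (eventually_gt_atTop (η 0))).exists
    obtain ⟨c, hc, hc0⟩ := intermediate_value_Ioo hx2.le P.continuous.continuousOn ⟨h0, hx1⟩
    exact ⟨c, hc.1, hc0⟩
  set W : Fin (n + 1) → ℝ := Fin.cons c b with hW
  have hup : UpInt η W := by
    refine ⟨fun i => ?_, fun j => by simpa [hW] using (hb j).1⟩
    induction i using Fin.cases with
    | zero => simpa [hW] using hc
    | succ j => simpa [hW] using (hb j).2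
  refine ⟨W, hup, ?_⟩
  have hroots : ∀ i, P.eval (W i) = 0 := by
    intro i
    induction i using Fin.cases with
    | zero => simpa [hW] using hc0
    | succ j => simpa [hW] using hb0' j
  have hPW := eq_chi_of_roots hmonic hdeg (hup.strictAnti hη).injective hroots
  ext i
  have := eval_chiC_self_ne hη.injective i
  rw [pieriV, ← eval_chi, ← hPW, hev]
  field_simp

end Upper

section Pieri

variable {n : ℕ}

/-- Admissible parameters of the Pieri formula. -/
structure PieriData (ys : Fin n → ℝ) (y : ℝ) : Prop where
  pos : 0 < y
  gap : ∀ i j, i < j → y + ys j < ys i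
  low : ∀ i, y < ys i

/-- The nodes `(y_1, …, y_n, 0)`. -/
def pieriEta (ys : Fin n → ℝ) : Fin (n + 1) → ℝ := Fin.snoc ys 0

/-- The points `(y_1 + z_1, …, y_n + z_n, y - ∑ z_i)`. -/
def pieriPt (ys : Fin n → ℝ) (y : ℝ) (z : Fin n → ℝ) : Fin (n + 1) → ℝ :=
  Fin.snoc (fun i => ys i + z i) (y - ∑ i, z i)

@[simp] theorem pieriEta_castSucc (ys : Fin n → ℝ) (i : Fin n) :
    pieriEta ys i.castSucc = ys i := by simp [pieriEta]

@[simp] theorem pieriEta_last (ys : Fin n → ℝ) : pieriEta ys (Fin.last n) = 0 := by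
  simp [pieriEta]

@[simp] theorem pieriPt_castSucc (ys : Fin n → ℝ) (y : ℝ) (z : Fin n → ℝ) (i : Fin n) :
    pieriPt ys y z i.castSucc = ys i + z i := by simp [pieriPt]

@[simp] theorem pieriPt_last (ys : Fin n → ℝ) (y : ℝ) (z : Fin n → ℝ) :
    pieriPt ys y z (Fin.last n) = y - ∑ i, z i := by simp [pieriPt]

variable {ys : Fin n → ℝ} {y : ℝ} {z : Fin n → ℝ}

theorem PieriData.strictAnti_ys (h : PieriData ys y) : StrictAnti ys := fun i j hij => by
  linarith [h.gap i j hij, h.pos]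

theorem PieriData.strictAnti (h : PieriData ys y) : StrictAnti (pieriEta ys) := by
  intro i j hij
  induction j using Fin.lastCases with
  | last =>
    obtain ⟨k, rfl⟩ := Fin.exists_castSucc_eq.2 hij.ne
    simpa using h.pos.trans (h.low k)
  | cast j =>
    obtain ⟨k, rfl⟩ := Fin.exists_castSucc_eq.2 (hij.trans (Fin.castSucc_lt_last j)).ne
    simpa using h.strictAnti_ys (Fin.castSucc_lt_castSucc_iff.1 hij)

theorem PieriData.upInt (h : PieriData ys y) (hz : z ∈ simp0 n y) :
    UpInt (pieriEta ys) (pieriPt ys y z) := by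
  have hzy : ∀ i, z i < y := fun i => (Finset.single_le_sum (f := z) (fun i _ => (hz.1 i).le)
    (Finset.mem_univ i)).trans_lt hz.2
  have hs : 0 ≤ ∑ i, z i := Finset.sum_nonneg fun i _ => (hz.1 i).le
  constructor
  · intro i
    induction i using Fin.lastCases with
    | last => simpa using hz.2
    | cast i => simpa using hz.1 i
  · intro j
    have hj : j.castSucc < j.succ := Fin.castSucc_lt_succ
    rw [pieriEta_castSucc]
    rcases eq_or_ne j.succ (Fin.last n) with e | e
    · rw [e, pieriPt_last]
      linarith [h.low j]
    · obtain ⟨k, hk⟩ := Fin.exists_castSucc_eq.2 e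
      rw [← hk] at hj ⊢
      rw [pieriPt_castSucc]
      linarith [h.gap j k (Fin.castSucc_lt_castSucc_iff.1 hj), hzy k]

theorem sum_pieriPt_sub (ys : Fin n → ℝ) (y : ℝ) (z : Fin n → ℝ) :
    ∑ i, pieriPt ys y z i - ∑ i, pieriEta ys i = y := by
  rw [Fin.sum_univ_castSucc, Fin.sum_univ_castSucc]
  simp [Finset.sum_add_distrib]

/-- The Dirichlet weights attached to a point of the simplex. -/
def pieriW (ys : Fin n → ℝ) (y : ℝ) (z : Fin n → ℝ) : Fin (n + 1) → ℝ :=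
  pieriV (pieriEta ys) y (pieriPt ys y z)

theorem PieriData.sum_pieriW (h : PieriData ys y) (z : Fin n → ℝ) : ∑ i, pieriW ys y z i = 1 := by
  have := mul_sum_pieriV h.strictAnti h.pos.ne' (pieriPt ys y z)
  rw [sum_pieriPt_sub] at this
  exact (mul_eq_left₀ h.pos.ne').1 this

theorem PieriData.pieriW_pos (h : PieriData ys y) (hz : z ∈ simp0 n y) (i : Fin (n + 1)) :
    0 < pieriW ys y z i := (h.upInt hz).pieriV_pos h.strictAnti h.pos i

theorem PieriData.injOn (h : PieriData ys y) :
    Set.InjOn (fun z (i : Fin n) => pieriW ys y z i.castSucc) (simp0 n y) := by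
  intro z hz z' hz' e
  have h1 : ∀ i, pieriW ys y z i = pieriW ys y z' i := by
    have h0 : ∀ i : Fin n, pieriW ys y z i.castSucc = pieriW ys y z' i.castSucc := congrFun e
    intro i
    induction i using Fin.lastCases with
    | cast i => exact h0 i
    | last =>
      have e1 := h.sum_pieriW z
      have e2 := h.sum_pieriW z'
      rw [Fin.sum_univ_castSucc] at e1 e2
      simp only [h0] at e1
      linarith
  have h2 : pieriPt ys y z = pieriPt ys y z' := by
    refine chi_injOn ((h.upInt hz).strictAnti h.strictAnti) ((h.upInt hz').strictAnti h.strictAnti) ?_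
    rw [chi_eq_sub_pieriV h.strictAnti h.pos.ne' (pieriPt ys y z),
      chi_eq_sub_pieriV h.strictAnti h.pos.ne' (pieriPt ys y z')]
    simp only [pieriW] at h1
    simp only [h1]
  ext i
  have := congrFun h2 i.castSucc
  simpa using this

theorem PieriData.surj (h : PieriData ys y) {u : Fin n → ℝ} (hu : u ∈ simp0 n 1) :
    ∃ z ∈ simp0 n y, (fun i : Fin n => pieriW ys y z i.castSucc) = u := by
  set w : Fin (n + 1) → ℝ := Fin.snoc u (1 - ∑ i, u i) with hw
  have hw0 : ∀ i, 0 < w i := by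
    intro i
    induction i using Fin.lastCases with
    | cast i => simpa [hw] using hu.1 i
    | last => simpa [hw] using hu.2
  have hw1 : ∑ i, w i = 1 := by rw [Fin.sum_univ_castSucc]; simp [hw]
  obtain ⟨W, hW, hWw⟩ := exists_upInt h.strictAnti h.pos hw0
  have hs := mul_sum_pieriV h.strictAnti h.pos.ne' W
  rw [hWw, hw1, mul_one, Fin.sum_univ_castSucc, Fin.sum_univ_castSucc] at hs
  simp only [pieriEta_castSucc, pieriEta_last] at hs
  set z : Fin n → ℝ := fun i => W i.castSucc - ys i with hz
  have hzs : ∑ i, z i = y - W (Fin.last n) := by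
    rw [hz, Finset.sum_sub_distrib]; linarith
  have hWz : pieriPt ys y z = W := by
    ext i
    induction i using Fin.lastCases with
    | cast i => simp [hz]
    | last => rw [pieriPt_last, hzs]; ring
  refine ⟨z, ⟨fun i => ?_, ?_⟩, ?_⟩
  · have := hW.1 i.castSucc
    rw [pieriEta_castSucc] at this
    simp only [hz]; linarith
  · have := hW.1 (Fin.last n)
    rw [pieriEta_last] at this
    linarith
  · ext i
    rw [pieriW, hWz, hWw]
    simp [hw]

/-- The Jacobian matrix of `pieriW`. -/
def pieriJac (ys : Fin n → ℝ) (y : ℝ) (z : Fin n → ℝ) : Matrix (Fin n) (Fin n) ℝ :=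
  Matrix.of fun i j => (pieriW ys y z i.castSucc * (ys i - (y - ∑ i, z i))⁻¹) *
    (Matrix.of fun i j => (y - ∑ i, z i - (ys j + z j)) *
      (Matrix.of fun i j => (ys i - (ys j + z j))⁻¹) i j) i j

theorem PieriData.hasFDerivAt (h : PieriData ys y) (hz : z ∈ simp0 n y) :
    HasFDerivAt (fun z (i : Fin n) => pieriW ys y z i.castSucc)
      (Matrix.toLin' (pieriJac ys y z)).toContinuousLinearMap z := by
  rw [hasFDerivAt_pi']
  intro i
  have hne := fun j => (h.upInt hz).ne h.strictAnti i.castSucc j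
  have hd := hasFDerivAt_prod_sub
    (-(y * (chiC (pieriEta ys) i.castSucc).eval (pieriEta ys i.castSucc))⁻¹)
    (pieriEta ys i.castSucc) (W := pieriPt ys y)
    (W' := Fin.snoc (fun j => (ContinuousLinearMap.proj j : (Fin n → ℝ) →L[ℝ] ℝ))
      (-∑ j, ContinuousLinearMap.proj j)) (x := z)
    (fun j => by
      induction j using Fin.lastCases with
      | cast j =>
        simp only [pieriPt_castSucc, Fin.snoc_castSucc]
        exact (hasFDerivAt_apply j z).const_add _
      | last =>
        simp only [pieriPt_last, Fin.snoc_last]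
        exact (HasFDerivAt.fun_sum fun j _ => hasFDerivAt_apply j z).const_sub _) hne
  refine hd.congr_fderiv ?_
  ext v
  have hl := hne (Fin.last n)
  rw [pieriEta_castSucc, pieriPt_last] at hl
  have hl' := sub_ne_zero.2 hl
  rw [← pieriV, ← pieriW]
  simp only [Fin.sum_univ_castSucc, Fin.snoc_castSucc, Fin.snoc_last, pieriPt_castSucc,
    pieriPt_last, pieriEta_castSucc, smul_apply, add_apply,
    sum_apply, neg_apply, ContinuousLinearMap.proj_apply,
    smul_eq_mul, ContinuousLinearMap.comp_apply, LinearMap.coe_toContinuousLinearMap',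
    Matrix.toLin'_apply, Matrix.mulVec, dotProduct]
  rw [neg_mul_neg, Finset.mul_sum, ← Finset.sum_add_distrib, Finset.mul_sum]
  refine Finset.sum_congr rfl fun j _ => ?_
  have hj := hne j.castSucc
  rw [pieriEta_castSucc, pieriPt_castSucc] at hj
  have hj' := sub_ne_zero.2 hj
  simp only [pieriJac, Matrix.of_apply]
  field_simp
  ring

end Pieri

end MBFPieri

namespace MBFPieri

section PieriDens

variable {n : ℕ} {ys : Fin n → ℝ} {y : ℝ} {z : Fin n → ℝ}

/-- The Dirichlet parameters `(θ, …, θ, κθ)`. -/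
def pieriT (n : ℕ) (θ κ : ℝ) : Fin (n + 1) → ℝ := Fin.snoc (fun _ => θ) (κ * θ)

theorem pieriT_pos {θ κ : ℝ} (hθ : 0 < θ) (hκ : 0 < κ) (i : Fin (n + 1)) : 0 < pieriT n θ κ i := by
  induction i using Fin.lastCases with
  | cast i => simpa [pieriT] using hθ
  | last => simpa [pieriT] using mul_pos hκ hθ

/-- The density of the Pieri measure. -/
def pieriDens (θ κ : ℝ) (ys : Fin n → ℝ) (y : ℝ) (z : Fin n → ℝ) : ℝ :=
  Real.Gamma ((n + κ) * θ) / (Real.Gamma (κ * θ) * Real.Gamma θ ^ n) *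
    ((pairProd n fun i j => |ys i - ys j|) ^ (1 - 2 * θ) / (y ^ (n * θ) * (∏ i, ys i) ^ θ)) *
    ((pairProd (n + 1) fun i j => |pieriPt ys y z i - pieriPt ys y z j|) *
      (∏ i, ∏ j, |ys i - pieriPt ys y z j|) ^ (θ - 1)) *
      pieriW ys y z (Fin.last n) ^ (κ * θ - 1)

theorem abs_pieriW (hy : 0 < y) (i : Fin (n + 1)) : |pieriW ys y z i| =
    (∏ j, |pieriEta ys i - pieriPt ys y z j|) /
      (y * |(chiC (pieriEta ys) i).eval (pieriEta ys i)|) := by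
  rw [pieriW, pieriV, abs_mul, abs_neg, abs_inv, Finset.abs_prod, inv_mul_eq_div, abs_mul,
    abs_of_pos hy]

theorem PieriData.prod_ys_pos (h : PieriData ys y) : 0 < ∏ i, ys i :=
  Finset.prod_pos fun i _ => h.pos.trans (h.low i)

theorem PieriData.prod_cofactor (h : PieriData ys y) :
    ∏ i : Fin n, |(chiC (pieriEta ys) i.castSucc).eval (pieriEta ys i.castSucc)| =
      (pairProd n fun i j => |ys i - ys j|) ^ 2 * ∏ i, ys i := by
  rw [← prod_offdiag _ fun i j => abs_sub_comm _ _, ← Finset.prod_mul_distrib]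
  refine Finset.prod_congr rfl fun i _ => ?_
  rw [eval_chiC, ← prod_succAbove (fun i j => pieriEta ys i - pieriEta ys j), Finset.abs_prod,
    Fin.prod_univ_castSucc]
  congr 1
  · refine Finset.prod_congr rfl fun j _ => ?_
    split_ifs with h1 h2 h2
    · simp
    · exact absurd (Fin.castSucc_injective _ h1) h2
    · exact absurd (congrArg _ h2) h1
    · simp
  · rw [if_neg (Fin.castSucc_lt_last i).ne']
    simp [abs_of_pos (h.pos.trans (h.low i))]

theorem PieriData.prod_pos (h : PieriData ys y) (hz : z ∈ simp0 n y) :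
    0 < ∏ i, ∏ j, |ys i - pieriPt ys y z j| :=
  Finset.prod_pos fun i _ => Finset.prod_pos fun j _ => abs_pos.2 (sub_ne_zero.2 (by
    simpa using (h.upInt hz).ne h.strictAnti i.castSucc j))

theorem PieriData.pairProd_ys_pos (h : PieriData ys y) : 0 < pairProd n fun i j => |ys i - ys j| :=
  pairProd_pos fun _ _ hij => abs_pos.2 (sub_ne_zero.2 (h.strictAnti_ys.injective.ne hij.ne))

theorem PieriData.prod_pieriW (h : PieriData ys y) (hz : z ∈ simp0 n y) :
    ∏ i : Fin n, pieriW ys y z i.castSucc = (∏ i, ∏ j, |ys i - pieriPt ys y z j|) /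
      (y ^ n * ((pairProd n fun i j => |ys i - ys j|) ^ 2 * ∏ i, ys i)) := by
  rw [← h.prod_cofactor, ← Fin.prod_const n y, ← Finset.prod_mul_distrib, ← Finset.prod_div_distrib]
  refine Finset.prod_congr rfl fun i _ => ?_
  rw [← abs_of_pos (h.pieriW_pos hz _), abs_pieriW h.pos, pieriEta_castSucc]

theorem PieriData.abs_det_pieriJac (h : PieriData ys y) (hz : z ∈ simp0 n y) :
    |(pieriJac ys y z).det| = (pairProd (n + 1) fun i j => |pieriPt ys y z i - pieriPt ys y z j|) /
      (y ^ n * ((pairProd n fun i j => |ys i - ys j|) * ∏ i, ys i)) := by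
  have hne : ∀ i j, ys i ≠ pieriPt ys y z j := fun i j => by
    simpa using (h.upInt hz).ne h.strictAnti i.castSucc j
  have hinj : Function.Injective fun j => ys j + z j := by
    intro i j hij
    refine Fin.castSucc_injective _ (((h.upInt hz).strictAnti h.strictAnti).injective ?_)
    simpa using hij
  rw [pieriJac, Matrix.det_mul_column, Matrix.det_mul_row, abs_mul, abs_mul,
    abs_det_cauchy hinj (fun i j => by simpa using hne i j.castSucc), Finset.prod_mul_distrib,
    h.prod_pieriW hz]
  have hP := h.prod_pos hz
  simp only [Fin.prod_univ_castSucc, Finset.prod_mul_distrib, pieriPt_castSucc, pieriPt_last] at hP ⊢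
  rw [abs_mul, abs_of_pos (div_pos hP (by have := h.pos; have := h.pairProd_ys_pos; have := h.prod_ys_pos; positivity)),
    pairProd_succ]
  simp only [pieriPt_castSucc, pieriPt_last]
  simp only [Finset.prod_inv_distrib, abs_inv, Finset.abs_prod]
  have e : ∏ i, |ys i + z i - (y - ∑ i, z i)| = ∏ i, |y - ∑ i, z i - (ys i + z i)| :=
    Finset.prod_congr rfl fun i _ => abs_sub_comm _ _
  rw [e]
  have h1 := h.pos.ne'
  have h2 := h.pairProd_ys_pos.ne'
  have h3 := h.prod_ys_pos.ne'
  have h4 : ∏ i, ∏ j, |ys i - (ys j + z j)| ≠ 0 := (mul_ne_zero_iff.1 hP.ne').1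
  have h5 : ∏ i, |ys i - (y - ∑ i, z i)| ≠ 0 := (mul_ne_zero_iff.1 hP.ne').2
  field_simp

theorem PieriData.pieriDens_eq (h : PieriData ys y) (hz : z ∈ simp0 n y) (θ κ : ℝ) :
    pieriDens θ κ ys y z = Real.Gamma (∑ i, pieriT n θ κ i) / (∏ i, Real.Gamma (pieriT n θ κ i)) *
      |(Matrix.toLin' (pieriJac ys y z)).toContinuousLinearMap.det| *
        ∏ i, pieriW ys y z i ^ (pieriT n θ κ i - 1) := by
  have h1 := h.pos
  have h2 := h.pairProd_ys_pos
  have h3 := h.prod_ys_pos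
  have h4 := h.prod_pos hz
  rw [ContinuousLinearMap.det, LinearMap.coe_toContinuousLinearMap, LinearMap.det_toLin',
    h.abs_det_pieriJac hz, Fin.prod_univ_castSucc, Fin.prod_univ_castSucc, Fin.sum_univ_castSucc]
  simp only [pieriT, Fin.snoc_castSucc, Fin.snoc_last]
  rw [Real.finsetProd_rpow _ _ fun i _ => (h.pieriW_pos hz _).le, h.prod_pieriW hz,
    Real.div_rpow h4.le (by positivity), Real.mul_rpow (by positivity) (by positivity),
    Real.mul_rpow (by positivity) (by positivity), pieriDens]
  set V := pairProd n fun i j => |ys i - ys j|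
  set Q := ∏ i, ys i
  have hr : V ^ (1 - 2 * θ) = V⁻¹ / (V ^ 2) ^ (θ - 1) := by
    rw [← Real.rpow_natCast, ← Real.rpow_mul h2.le, ← Real.rpow_neg_one, ← Real.rpow_sub h2]
    congr 1; push_cast; ring
  have hr2 : y ^ (n * θ) = y ^ n * (y ^ n) ^ (θ - 1) := by
    rw [← Real.rpow_natCast, ← Real.rpow_mul h1.le, ← Real.rpow_add h1]
    congr 1; ring
  have hr3 : Q ^ θ = Q * Q ^ (θ - 1) := by
    nth_rw 2 [← Real.rpow_one Q]
    rw [← Real.rpow_add h3]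
    congr 1; ring
  rw [hr, hr2, hr3]
  simp only [Finset.sum_const, Finset.prod_const, Finset.card_univ, Fintype.card_fin, nsmul_eq_mul]
  rw [← add_mul]
  have := (Real.rpow_pos_of_pos h3 (θ - 1)).ne'
  have := (Real.rpow_pos_of_pos (pow_pos h1 n) (θ - 1)).ne'
  have := (Real.rpow_pos_of_pos (pow_pos h2 2) (θ - 1)).ne'
  field_simp

theorem PieriData.lintegral (h : PieriData ys y) {θ κ : ℝ} (hθ : 0 < θ) (hκ : 0 < κ)
    (m : Fin (n + 1) → ℕ) :
    ∫⁻ z in simp0 n y, ENNReal.ofReal (pieriDens θ κ ys y z * ∏ i, pieriW ys y z i ^ m i)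
      = ENNReal.ofReal ((∏ i, poch (pieriT n θ κ i) (m i)) /
          poch (∑ i, pieriT n θ κ i) (∑ i, m i)) :=
  lintegral_dirichlet_of_cov (fun i => pieriT_pos hθ hκ i) (measurableSet_simp0 n y)
    (fun z _ => h.sum_pieriW z) (fun _ hz i => h.pieriW_pos hz i)
    (fun _ hz => (h.hasFDerivAt hz).hasFDerivWithinAt) h.injOn
    (fun _ hu => h.surj hu) (fun _ hz => h.pieriDens_eq hz θ κ) m

theorem measurable_pieriPt (ys : Fin n → ℝ) (y : ℝ) : Measurable (pieriPt ys y) := by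
  refine measurable_pi_iff.2 fun i => ?_
  induction i using Fin.lastCases with
  | cast i => simp only [pieriPt_castSucc]; fun_prop
  | last => simp only [pieriPt_last]; fun_prop

theorem measurable_pieriW (ys : Fin n → ℝ) (y : ℝ) : Measurable (pieriW ys y) := by
  refine measurable_pi_iff.2 fun i => ?_
  have := measurable_pi_iff.1 (measurable_pieriPt ys y)
  unfold pieriW pieriV
  fun_prop

theorem measurable_pieriDens (θ κ : ℝ) (ys : Fin n → ℝ) (y : ℝ) :
    Measurable (pieriDens θ κ ys y) := by
  have h0 := measurable_pi_iff.1 (measurable_pieriPt ys y)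
  have h1 := measurable_pi_iff.1 (measurable_pieriW ys y) (Fin.last n)
  have h2 : Measurable fun z => pairProd (n + 1) fun i j =>
      |pieriPt ys y z i - pieriPt ys y z j| :=
    measurable_pairProd fun i j => by have := h0 i; have := h0 j; fun_prop
  unfold pieriDens
  fun_prop

theorem PieriData.pieriDens_nonneg (h : PieriData ys y) {θ κ : ℝ} (hθ : 0 < θ) (hκ : 0 < κ)
    (hz : z ∈ simp0 n y) : 0 ≤ pieriDens θ κ ys y z := by
  rw [h.pieriDens_eq hz]
  have h1 : 0 ≤ Real.Gamma (∑ i, pieriT n θ κ i) := (Real.Gamma_pos_of_pos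
    (Finset.sum_pos (fun i _ => pieriT_pos hθ hκ i) Finset.univ_nonempty)).le
  have h2 : 0 ≤ ∏ i, Real.Gamma (pieriT n θ κ i) :=
    Finset.prod_nonneg fun i _ => (Real.Gamma_pos_of_pos (pieriT_pos hθ hκ i)).le
  have h3 : 0 ≤ ∏ i, pieriW ys y z i ^ (pieriT n θ κ i - 1) :=
    Finset.prod_nonneg fun i _ => Real.rpow_nonneg (h.pieriW_pos hz i).le _
  positivity

/-- The measure appearing in the Pieri formula. -/
def pieriMeas (θ κ : ℝ) (ys : Fin n → ℝ) (y : ℝ) : Measure (Fin n → ℝ) :=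
  densOn (simp0 n y) (pieriDens θ κ ys y)

theorem PieriData.isProbabilityMeasure (h : PieriData ys y) {θ κ : ℝ} (hθ : 0 < θ) (hκ : 0 < κ) :
    IsProbabilityMeasure (pieriMeas θ κ ys y) :=
  isProbabilityMeasure_densOn (h.lintegral hθ hκ)

theorem PieriData.isDirichlet (h : PieriData ys y) {θ κ : ℝ} (hθ : 0 < θ) (hκ : 0 < κ) :
    IsDirichlet (pieriT n θ κ) (∑ i, pieriT n θ κ i)
      (polyExp (pieriMeas θ κ ys y) (pieriW ys y)) :=
  isDirichlet_densOn (fun i => pieriT_pos hθ hκ i) (measurableSet_simp0 n y)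
    (measurable_pieriW ys y) (measurable_pieriDens θ κ ys y)
    (fun _ hz => h.pieriDens_nonneg hθ hκ hz) (fun _ hz i => h.pieriW_pos hz i)
    (h.lintegral hθ hκ)

end PieriDens

end MBFPieri

namespace MBFPieri

section Tri

variable {n : ℕ}

/-- Splitting a triangular array into its top level and the levels below. -/
def triEquiv (n : ℕ) : Tri (n + 1) ≃ᵐ (Fin (n + 1) → ℝ) × Tri n where
  toFun x := (x (Fin.last n), fun k => x k.castSucc)
  invFun p := Fin.snoc (α := fun k : Fin (n + 1) => Fin (k.1 + 1) → ℝ) p.2 p.1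
  left_inv x := by
    simp only
    exact Fin.snoc_init_self (α := fun k : Fin (n + 1) => Fin (k.1 + 1) → ℝ) x
  right_inv p := by
    refine Prod.ext ?_ ?_
    · exact Fin.snoc_last (α := fun k : Fin (n + 1) => Fin (k.1 + 1) → ℝ) p.1 p.2
    · funext k
      exact Fin.snoc_castSucc (α := fun k : Fin (n + 1) => Fin (k.1 + 1) → ℝ) p.1 p.2 k
  measurable_toFun := by
    refine Measurable.prodMk (measurable_pi_apply _) ?_
    exact measurable_pi_lambda _ fun k => measurable_pi_apply _
  measurable_invFun := by
    refine measurable_pi_lambda _ fun k => ?_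
    refine Fin.lastCases ?_ (fun k => ?_) k
    · simp only [Equiv.coe_fn_symm_mk, Fin.snoc_last]
      exact measurable_fst
    · simp only [Equiv.coe_fn_symm_mk, Fin.snoc_castSucc]
      exact (measurable_pi_apply k).comp measurable_snd

theorem measurePreserving_triEquiv (n : ℕ) : MeasurePreserving (triEquiv n) := by
  refine MeasurePreserving.symm (triEquiv n).symm ⟨(triEquiv n).symm.measurable, ?_⟩
  refine (Measure.pi_eq fun s hs => ?_).symm
  rw [Measure.map_apply (triEquiv n).symm.measurable (MeasurableSet.univ_pi hs)]
  have : (triEquiv n).symm ⁻¹' (Set.univ.pi s)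
      = s (Fin.last n) ×ˢ Set.univ.pi fun k : Fin n => s k.castSucc := by
    ext p
    rw [Set.mem_preimage, Set.mem_prod, Set.mem_univ_pi, Set.mem_univ_pi, Fin.forall_fin_succ']
    have h := (triEquiv n).apply_symm_apply p
    have h1 : (triEquiv n).symm p (Fin.last n) = p.1 := congrArg Prod.fst h
    have h2 : ∀ k : Fin n, (triEquiv n).symm p k.castSucc = p.2 k :=
      fun k => congrFun (congrArg Prod.snd h) k
    simp only [h1, h2]
    exact and_comm
  rw [this, Measure.volume_eq_prod, Measure.prod_prod, Fin.prod_univ_castSucc, mul_comm, volume_pi,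
    Measure.pi_pi]

variable (a : Fin (n + 2) → ℝ) (x : Tri (n + 1))

theorem lvl_castSucc (k : ℕ) (hk : k < n + 1) :
    lvl (N := n + 2) a x k (hk.trans (Nat.lt_succ_self _))
      = lvl (N := n + 1) (x (Fin.last n)) (fun k : Fin n => x k.castSucc) k hk := by
  unfold lvl
  rw [dif_pos (show k < n + 2 - 1 from hk)]
  by_cases h : k < n
  · rw [dif_pos (show k < n + 1 - 1 from h)]; rfl
  · obtain rfl : k = n := by omega
    rw [dif_neg (show ¬ k < k + 1 - 1 from h)]; rfl

theorem lvl_top {N : ℕ} (a : Fin (N + 1) → ℝ) (x : Tri N) :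
    lvl (N := N + 1) a x N (Nat.lt_succ_self _) = a := by
  unfold lvl
  rw [dif_neg (show ¬ N < N + 1 - 1 from lt_irrefl N)]

theorem obpWt_split (θ : ℝ) : obpWt (N := n + 2) θ a x
    = obpWt (N := n + 1) θ (x (Fin.last n)) (fun k : Fin n => x k.castSucc) *
      (pairProd (n + 1) (fun i j => |x (Fin.last n) i - x (Fin.last n) j| ^ (2 - 2 * θ)) *
        ∏ i : Fin (n + 2), ∏ j : Fin (n + 1), |a i - x (Fin.last n) j| ^ (θ - 1)) := by
  unfold obpWt
  refine (Fin.prod_univ_castSucc (n := n) _).trans ?_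
  congr 1
  · refine Finset.prod_congr rfl fun k _ => ?_
    congr 1
    simp only [Fin.val_castSucc]
    rw [lvl_castSucc a x (k.1 + 1) (by omega)]
  · congr 1
    simp only [Fin.val_last]
    rw [lvl_top]

theorem mem_obpDomain_split : x ∈ obpDomain (N := n + 2) a
    ↔ x (Fin.last n) ∈ cornerBox a ∧
      (fun k : Fin n => x k.castSucc) ∈ obpDomain (N := n + 1) (x (Fin.last n)) := by
  unfold obpDomain
  refine (Fin.forall_fin_succ' (n := n)).trans ?_
  rw [and_comm]
  refine and_congr ?_ (forall_congr' fun k => ?_)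
  · simp only [Fin.val_last]
    rw [lvl_top]
    rfl
  · simp only [Fin.val_castSucc]
    rw [lvl_castSucc a x (k.1 + 1) (by omega)]

theorem sumLvl_castSucc (k : ℕ) (hk : k ≤ n + 1) : sumLvl (N := n + 2) a x k
    = sumLvl (N := n + 1) (x (Fin.last n)) (fun k : Fin n => x k.castSucc) k := by
  unfold sumLvl
  by_cases h0 : k = 0
  · rw [if_pos h0, if_pos h0]
  rw [if_neg h0, if_neg h0, dif_pos (show k - 1 < n + 2 - 1 by omega)]
  by_cases h : k - 1 < n
  · rw [dif_pos (show k - 1 < n + 1 - 1 from h)]; rfl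
  · rw [dif_neg (show ¬ k - 1 < n + 1 - 1 from h)]
    obtain ⟨l, rfl⟩ : ∃ l, k = l + 1 := ⟨k - 1, by omega⟩
    obtain rfl : l = n := by omega
    rfl

end Tri

section Meas

variable {N : ℕ} (a : Fin N → ℝ)

theorem measurable_lvl (k : ℕ) (hk : k < N) (i) : Measurable fun x : Tri (N - 1) => lvl a x k hk i := by
  unfold lvl
  split_ifs with h
  · exact (measurable_pi_apply i).comp (measurable_pi_apply _)
  · exact measurable_const

theorem measurable_entry {M : ℕ} (k : Fin M) (i) : Measurable fun x : Tri M => x k i :=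
  (measurable_pi_apply i).comp (measurable_pi_apply _)

theorem measurable_sumLvl (k : ℕ) : Measurable fun x : Tri (N - 1) => sumLvl a x k := by
  unfold sumLvl
  split_ifs with h h'
  · exact measurable_const
  · exact Finset.measurable_sum _ fun i _ => measurable_entry _ i
  · exact measurable_const

theorem measurable_obpWt (θ : ℝ) : Measurable fun x : Tri (N - 1) => obpWt θ a x := by
  unfold obpWt
  refine Finset.measurable_prod _ fun k _ => Measurable.mul ?_ ?_
  · refine Finset.measurable_prod _ fun i _ => Finset.measurable_prod _ fun j _ => ?_
    split_ifs
    · exact (((measurable_entry k i).sub (measurable_entry k j)).abs).pow_const _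
    · exact measurable_const
  · refine Finset.measurable_prod _ fun i _ => Finset.measurable_prod _ fun j _ => ?_
    exact (((measurable_lvl a _ _ i).sub (measurable_entry k j)).abs).pow_const _

theorem measurableSet_obpDomain : MeasurableSet (obpDomain a) := by
  unfold obpDomain Interlaces
  simp only [Set.ofPred_forall]
  refine MeasurableSet.iInter fun k => MeasurableSet.iInter fun i => ?_
  exact (measurableSet_lt (measurable_entry k i) (measurable_lvl a _ _ _)).inter
    (measurableSet_lt (measurable_lvl a _ _ _) (measurable_entry k i))

theorem obpWt_nonneg (θ : ℝ) (x : Tri (N - 1)) : 0 ≤ obpWt θ a x := by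
  unfold obpWt
  refine Finset.prod_nonneg fun k _ => mul_nonneg ?_ ?_
  · refine Finset.prod_nonneg fun i _ => Finset.prod_nonneg fun j _ => ?_
    split_ifs <;> positivity
  · exact Finset.prod_nonneg fun i _ => Finset.prod_nonneg fun j _ => by positivity

/-- The exponent in the integral representation of the Bessel function. -/
def obpExp (Y : Fin N → ℝ) (x : Tri (N - 1)) : ℝ :=
  ∑ k : Fin N, Y k * (sumLvl a x (k.1 + 1) - sumLvl a x k.1)

theorem measurable_obpExp (Y : Fin N → ℝ) : Measurable (obpExp a Y) :=
  Finset.measurable_sum _ fun k _ =>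
    ((measurable_sumLvl a (k.1 + 1)).sub (measurable_sumLvl a k.1)).const_mul (Y k)

/-- The normalizing constant of the Bessel function. -/
def obpConst (θ : ℝ) (N : ℕ) : ℝ :=
  (∏ k : Fin N, Real.Gamma ((k.1 + 1) * θ)) / Real.Gamma θ ^ (N * (N + 1) / 2)

theorem obpConst_succ (θ : ℝ) (N : ℕ) : obpConst θ (N + 1)
    = obpConst θ N * (Real.Gamma ((N + 1 : ℕ) * θ) / Real.Gamma θ ^ (N + 1)) := by
  have : (N + 1) * (N + 1 + 1) / 2 = N * (N + 1) / 2 + (N + 1) := by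
    have : (N + 1) * (N + 1 + 1) = N * (N + 1) + (N + 1) * 2 := by ring
    rw [this, Nat.add_mul_div_right _ _ two_pos]
  rw [obpConst, obpConst, Fin.prod_univ_castSucc, this, pow_add, div_mul_div_comm]
  simp

theorem obpConst_nonneg {θ : ℝ} (hθ : 0 < θ) (N : ℕ) : 0 ≤ obpConst θ N :=
  div_nonneg (Finset.prod_nonneg fun k _ => (Real.Gamma_pos_of_pos (by positivity)).le)
    (pow_nonneg (Real.Gamma_pos_of_pos hθ).le _)

/-- The integrand of the Bessel function at a real argument. -/
def obpInt (θ : ℝ) (Y : Fin N → ℝ) (x : Tri (N - 1)) : ℝ := Real.exp (obpExp a Y x) * obpWt θ a x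

theorem measurable_obpInt (θ : ℝ) (Y : Fin N → ℝ) : Measurable (obpInt a θ Y) :=
  (measurable_obpExp a Y).exp.mul (measurable_obpWt a θ)

theorem obpInt_nonneg (θ : ℝ) (Y : Fin N → ℝ) (x : Tri (N - 1)) : 0 ≤ obpInt a θ Y x :=
  mul_nonneg (Real.exp_pos _).le (obpWt_nonneg a θ x)

/-- The Bessel function at a real argument, with values in `[0, ∞]`. -/
def besselInt (θ : ℝ) (Y : Fin N → ℝ) : ℝ≥0∞ :=
  ENNReal.ofReal (obpConst θ N * pairProd N fun i j => |a i - a j| ^ (1 - 2 * θ)) *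
    ∫⁻ x in obpDomain a, ENNReal.ofReal (obpInt a θ Y x)

theorem pairProd_nonneg {n : ℕ} {f : Fin n → Fin n → ℝ} (h : ∀ i j, 0 ≤ f i j) : 0 ≤ pairProd n f := by
  refine Finset.prod_nonneg fun i _ => Finset.prod_nonneg fun j _ => ?_
  split_ifs
  · exact h i j
  · exact zero_le_one

theorem MBF_ofReal {θ : ℝ} (hθ : 0 < θ) (Y : Fin N → ℝ) :
    MBF θ a (fun k => (Y k : ℂ)) = ((besselInt a θ Y).toReal : ℂ) := by
  have h0 : 0 ≤ obpConst θ N * pairProd N fun i j => |a i - a j| ^ (1 - 2 * θ) :=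
    mul_nonneg (obpConst_nonneg hθ N) (pairProd_nonneg fun i j => by positivity)
  rw [besselInt, ENNReal.toReal_mul, ENNReal.toReal_ofReal h0,
    ← integral_eq_lintegral_of_nonneg_ae (ae_of_all _ (obpInt_nonneg a θ Y))
      (measurable_obpInt a θ Y).aestronglyMeasurable]
  unfold MBF
  push_cast
  rw [← integral_complex_ofReal]
  congr 1
  · simp [obpConst, pairProd]
  · refine integral_congr_ae (ae_of_all _ fun x => ?_)
    simp [obpInt, obpExp]

end Meas

end MBFPieri

namespace MBFPieri

variable {n : ℕ}

theorem obpExp_split (a : Fin (n + 2) → ℝ) (x : Tri (n + 1)) (Y : Fin (n + 1) → ℝ) :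
    obpExp (N := n + 2) a (Fin.snoc Y 0 : Fin (n + 2) → ℝ) x
      = obpExp (N := n + 1) (x (Fin.last n)) Y (fun k : Fin n => x k.castSucc) := by
  unfold obpExp
  rw [Fin.sum_univ_castSucc]
  simp only [Fin.snoc_last, zero_mul, add_zero, Fin.snoc_castSucc, Fin.val_castSucc]
  refine Finset.sum_congr rfl fun k _ => ?_
  rw [sumLvl_castSucc a x _ (by omega), sumLvl_castSucc a x _ (by omega)]

theorem sumLvl_top (a : Fin (n + 1) → ℝ) (x : Tri n) : sumLvl (N := n + 1) a x (n + 1) = ∑ i, a i := by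
  unfold sumLvl
  rw [if_neg (Nat.succ_ne_zero n), dif_neg (by simp)]

theorem obpExp_add_const (a : Fin (n + 1) → ℝ) (x : Tri n) (Y : Fin (n + 1) → ℝ) (c : ℝ) :
    obpExp (N := n + 1) a (fun i => Y i + c) x
      = c * ∑ i, a i + obpExp (N := n + 1) a Y x := by
  unfold obpExp
  simp only [add_mul, Finset.sum_add_distrib]
  rw [add_comm, ← Finset.mul_sum,
    Fin.sum_univ_eq_sum_range (fun k => sumLvl (N := n + 1) a x (k + 1) - sumLvl (N := n + 1) a x k),
    Finset.sum_range_sub, sumLvl_top]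
  simp [sumLvl]

theorem besselInt_add_const (θ : ℝ) (a : Fin (n + 1) → ℝ) (Y : Fin (n + 1) → ℝ) (c : ℝ) :
    besselInt a θ (fun i => Y i + c)
      = ENNReal.ofReal (Real.exp (c * ∑ i, a i)) * besselInt a θ Y := by
  have : ∀ x, ENNReal.ofReal (obpInt a θ (fun i => Y i + c) x)
      = ENNReal.ofReal (Real.exp (c * ∑ i, a i)) * ENNReal.ofReal (obpInt a θ Y x) := by
    intro x
    rw [← ENNReal.ofReal_mul (Real.exp_pos _).le, obpInt, obpInt, obpExp_add_const, Real.exp_add,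
      mul_assoc]
  rw [besselInt, besselInt]
  simp only [this]
  rw [lintegral_const_mul' _ _ ENNReal.ofReal_ne_top]
  ring

theorem obpInt_split (θ : ℝ) (a : Fin (n + 2) → ℝ) (x : Tri (n + 1)) (Y : Fin (n + 1) → ℝ) :
    obpInt (N := n + 2) a θ (Fin.snoc Y 0 : Fin (n + 2) → ℝ) x
      = (pairProd (n + 1) (fun i j => |x (Fin.last n) i - x (Fin.last n) j| ^ (2 - 2 * θ)) *
        ∏ i : Fin (n + 2), ∏ j : Fin (n + 1), |a i - x (Fin.last n) j| ^ (θ - 1)) *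
        obpInt (N := n + 1) (x (Fin.last n)) θ Y (fun k : Fin n => x k.castSucc) := by
  rw [obpInt, obpInt, obpExp_split, obpWt_split]
  exact (mul_assoc _ _ _).symm.trans (mul_comm _ _)

theorem cornerDens_mul_const {θ : ℝ} {a : Fin (n + 2) → ℝ} (ha : StrictAnti a)
    {b : Fin (n + 1) → ℝ} (hb : b ∈ cornerBox a) :
    obpConst θ (n + 2) * (pairProd (n + 2) fun i j => |a i - a j| ^ (1 - 2 * θ)) *
      (pairProd (n + 1) (fun i j => |b i - b j| ^ (2 - 2 * θ)) *
        ∏ i : Fin (n + 2), ∏ j : Fin (n + 1), |a i - b j| ^ (θ - 1))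
    = cornerDens θ a b *
      (obpConst θ (n + 1) * pairProd (n + 1) fun i j => |b i - b j| ^ (1 - 2 * θ)) := by
  have hb' := strictAnti_of_interlaces ha.antitone hb
  have hp : 0 < pairProd (n + 1) fun i j => |b i - b j| :=
    pairProd_pos fun i j hij => abs_pos.2 (sub_ne_zero.2 (hb'.injective.ne hij.ne))
  have h2 : ∏ i : Fin (n + 2), ∏ j : Fin (n + 1), |a i - b j| ^ (θ - 1)
      = (∏ i : Fin (n + 2), ∏ j : Fin (n + 1), |a i - b j|) ^ (θ - 1) := by
    rw [← Real.finsetProd_rpow _ _ fun i _ => Finset.prod_nonneg fun j _ => abs_nonneg _]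
    refine Finset.prod_congr rfl fun i _ => ?_
    rw [← Real.finsetProd_rpow _ _ fun j _ => abs_nonneg _]
  rw [h2, pairProd_rpow fun i j _ => abs_nonneg _, pairProd_rpow fun i j _ => abs_nonneg _,
    pairProd_rpow fun i j _ => abs_nonneg _, show 2 - 2 * θ = 1 + (1 - 2 * θ) by ring,
    Real.rpow_add hp, Real.rpow_one, obpConst_succ θ (n + 1), cornerDens]
  ring

theorem besselInt_snoc_zero {θ : ℝ} (hθ : 0 < θ) {a : Fin (n + 2) → ℝ} (ha : StrictAnti a)
    (Y : Fin (n + 1) → ℝ) :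
    besselInt a θ (Fin.snoc Y 0 : Fin (n + 2) → ℝ) = ∫⁻ b, besselInt b θ Y ∂cornerMeas θ a := by
  rw [cornerMeas, densOn, lintegral_withDensity_eq_lintegral_mul_non_measurable _
    (measurable_cornerDens θ a).ennreal_ofReal (ae_of_all _ fun _ => ENNReal.ofReal_lt_top)]
  set Q : (Fin (n + 1) → ℝ) → ℝ := fun b =>
    pairProd (n + 1) (fun i j => |b i - b j| ^ (2 - 2 * θ)) *
        ∏ i : Fin (n + 2), ∏ j : Fin (n + 1), |a i - b j| ^ (θ - 1) with hQ
  have hQ0 : ∀ b, 0 ≤ Q b := fun b => mul_nonneg (pairProd_nonneg fun i j => by positivity)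
    (Finset.prod_nonneg fun i _ => Finset.prod_nonneg fun j _ => by positivity)
  set K := obpConst θ (n + 2) * pairProd (n + 2) fun i j => |a i - a j| ^ (1 - 2 * θ) with hK
  have hK0 : 0 ≤ K :=
    mul_nonneg (obpConst_nonneg hθ _) (pairProd_nonneg fun i j => by positivity)
  have hR : ∀ b ∈ cornerBox a, ((fun b => ENNReal.ofReal (cornerDens θ a b)) *
      fun b => besselInt b θ Y) b = ENNReal.ofReal K *
        (ENNReal.ofReal (Q b) * ∫⁻ x in obpDomain b, ENNReal.ofReal (obpInt b θ Y x)) := by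
    intro b hb
    rw [Pi.mul_apply, besselInt, ← mul_assoc, ← mul_assoc,
      ← ENNReal.ofReal_mul (cornerDens_nonneg hθ a b), ← ENNReal.ofReal_mul hK0,
      ← cornerDens_mul_const ha hb]
  rw [setLIntegral_congr_fun (measurableSet_cornerBox a) hR,
    lintegral_const_mul' _ _ ENNReal.ofReal_ne_top, besselInt, ← hK]
  congr 1
  rw [← lintegral_indicator (measurableSet_obpDomain a),
    ← lintegral_indicator (measurableSet_cornerBox a)]
  set f : Tri (n + 1) → ℝ≥0∞ := (obpDomain (N := n + 2) a).indicator fun x =>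
    ENNReal.ofReal (obpInt (N := n + 2) a θ (Fin.snoc Y 0 : Fin (n + 2) → ℝ) x) with hf
  have hfm : Measurable f :=
    (measurable_obpInt a θ _).ennreal_ofReal.indicator (measurableSet_obpDomain a)
  have h1 : ∫⁻ x, f x = ∫⁻ p : (Fin (n + 1) → ℝ) × Tri n, f ((triEquiv n).symm p) := by
    have := (measurePreserving_triEquiv n).lintegral_map_equiv (fun p => f ((triEquiv n).symm p))
    simpa using this.symm
  refine h1.trans ?_
  rw [Measure.volume_eq_prod, lintegral_prod (fun p => f ((triEquiv n).symm p))
    (hfm.comp (triEquiv n).symm.measurable).aemeasurable]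
  refine lintegral_congr fun b => ?_
  have h2 : ∀ x' : Tri n, f ((triEquiv n).symm (b, x')) = (cornerBox a).indicator (fun b =>
      (ENNReal.ofReal (Q b)) * (obpDomain (N := n + 1) b).indicator
        (fun x => ENNReal.ofReal (obpInt (N := n + 1) b θ Y x)) x') b := by
    intro x'
    set x := (triEquiv n).symm (b, x') with hx
    have h := (triEquiv n).apply_symm_apply (b, x')
    have h3 : x (Fin.last n) = b := congrArg Prod.fst h
    have h4 : (fun k : Fin n => x k.castSucc) = x' := congrArg Prod.snd h
    have hm := mem_obpDomain_split a x
    have hi := obpInt_split θ a x Y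
    rw [h3, h4] at hm hi
    by_cases hb : b ∈ cornerBox a
    · rw [Set.indicator_of_mem hb]
      by_cases hx' : x' ∈ obpDomain (N := n + 1) b
      · rw [Set.indicator_of_mem hx', ← ENNReal.ofReal_mul (hQ0 b), ← hi]
        exact Set.indicator_of_mem (hm.2 ⟨hb, hx'⟩) _
      · rw [Set.indicator_of_notMem hx', mul_zero]
        exact Set.indicator_of_notMem (fun h => hx' (hm.1 h).2) _
    · rw [Set.indicator_of_notMem hb]
      exact Set.indicator_of_notMem (fun h => hb (hm.1 h).1) _
  simp only [h2]
  by_cases hb : b ∈ cornerBox a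
  · simp only [Set.indicator_of_mem hb]
    rw [lintegral_const_mul' _ _ ENNReal.ofReal_ne_top]
    congr 1
    exact lintegral_indicator (measurableSet_obpDomain (N := n + 1) b) _
  · simp only [Set.indicator_of_notMem hb, lintegral_zero]

theorem besselInt_one {θ : ℝ} (hθ : 0 < θ) (a : Fin 1 → ℝ) : besselInt a θ (fun _ => 0) = 1 := by
  have h := (Real.Gamma_pos_of_pos hθ).ne'
  have hd : obpDomain a = Set.univ := by
    ext x
    simp only [obpDomain, Set.mem_univ, iff_true]
    exact fun k => k.elim0
  have hi : ∀ x, obpInt a θ (fun _ => 0) x = 1 := by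
    intro x
    have : obpWt θ a x = 1 := Finset.prod_eq_one fun k _ => k.elim0
    simp [obpInt, obpExp, this]
  have hv : (volume : Measure (Tri (1 - 1))) Set.univ = 1 := by
    have := Measure.pi_univ (ι := Fin 0) (α := fun k => Fin (k.1 + 1) → ℝ) (fun _ => volume)
    exact this.trans (by simp)
  rw [besselInt, hd]
  simp only [hi, Measure.restrict_univ, ENNReal.ofReal_one, lintegral_const, hv, mul_one]
  simp [obpConst, pairProd, h]

end MBFPieri

namespace MBFPieri

open MvPolynomial

theorem summable_pow_div_factorial (M : ℝ) : Summable fun k : ℕ => M ^ k / (k.factorial : ℝ) :=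
  Real.summable_pow_div_factorial M

theorem summable_norm_of_le {f : ℕ → ℝ} {M : ℝ} (h : ∀ k, |f k| ≤ M ^ k / (k.factorial : ℝ)) :
    Summable fun k => ‖f k‖ :=
  (summable_pow_div_factorial M).of_nonneg_of_le (fun _ => norm_nonneg _) h

theorem sum_antidiagonal_pow_div_factorial (x y : ℝ) (k : ℕ) :
    ∑ p ∈ Finset.HasAntidiagonal.antidiagonal k,
      (x ^ p.1 / (p.1.factorial : ℝ)) * (y ^ p.2 / (p.2.factorial : ℝ))
        = (x + y) ^ k / (k.factorial : ℝ) := by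
  rw [(Commute.all x y).add_pow', Finset.sum_div]
  refine Finset.sum_congr rfl fun p hp => ?_
  rw [Finset.HasAntidiagonal.mem_antidiagonal] at hp
  have h := Nat.add_choose_mul_factorial_mul_factorial p.2 p.1
  rw [add_comm, hp, mul_right_comm] at h
  have h' : (k.choose p.1 : ℝ) * p.1.factorial * p.2.factorial = k.factorial := by exact_mod_cast h
  have h1 : (p.1.factorial : ℝ) ≠ 0 := Nat.cast_ne_zero.2 (Nat.factorial_ne_zero _)
  have h2 : (p.2.factorial : ℝ) ≠ 0 := Nat.cast_ne_zero.2 (Nat.factorial_ne_zero _)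
  have h3 : (k.choose p.1 : ℝ) ≠ 0 := by
    intro h0
    rw [h0, zero_mul, zero_mul] at h'
    exact Nat.cast_ne_zero.2 (Nat.factorial_ne_zero _) h'.symm
  rw [← h', nsmul_eq_mul]
  field_simp

theorem abs_sum_antidiagonal_le {f g : ℕ → ℝ} {x y : ℝ}
    (hf : ∀ k, |f k| ≤ x ^ k / (k.factorial : ℝ)) (hg : ∀ k, |g k| ≤ y ^ k / (k.factorial : ℝ)) (k : ℕ) :
    |∑ p ∈ Finset.HasAntidiagonal.antidiagonal k, f p.1 * g p.2| ≤ (x + y) ^ k / (k.factorial : ℝ) := by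
  rw [← sum_antidiagonal_pow_div_factorial]
  refine (Finset.abs_sum_le_sum_abs _ _).trans (Finset.sum_le_sum fun p _ => ?_)
  rw [abs_mul]
  exact mul_le_mul (hf _) (hg _) (abs_nonneg _) ((abs_nonneg _).trans (hf _))

section Exchange

variable {Ω : Type*} [MeasurableSpace Ω] {μ : Measure Ω} [IsFiniteMeasure μ] {f : ℕ → Ω → ℝ} {M : ℝ}

theorem integrable_tsum_of_le (hf : ∀ k, Measurable (f k))
    (hM : ∀ᵐ x ∂μ, ∀ k, |f k x| ≤ M ^ k / (k.factorial : ℝ)) :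
    Integrable (fun x => ∑' k, f k x) μ := by
  refine Integrable.of_bound (C := ∑' k : ℕ, M ^ k / (k.factorial : ℝ)) ?_ (hM.mono fun x hx => ?_)
  · refine aestronglyMeasurable_of_tendsto_ae atTop (f := fun K x => ∑ k ∈ Finset.range K, f k x)
      (fun K => (Finset.measurable_sum _ fun k _ => hf k).aestronglyMeasurable)
      (hM.mono fun x hx => ?_)
    exact (summable_norm_of_le hx).of_norm.hasSum.tendsto_sum_nat
  · exact (norm_tsum_le_tsum_norm (summable_norm_of_le hx)).trans
      ((summable_norm_of_le hx).tsum_le_tsum hx (summable_pow_div_factorial M))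

theorem hasSum_integral_of_le (hf : ∀ k, Measurable (f k))
    (hM : ∀ᵐ x ∂μ, ∀ k, |f k x| ≤ M ^ k / (k.factorial : ℝ)) :
    HasSum (fun k => ∫ x, f k x ∂μ) (∫ x, ∑' k, f k x ∂μ) := by
  refine hasSum_integral_of_dominated_convergence (fun k _ => M ^ k / (k.factorial : ℝ))
    (fun k => (hf k).aestronglyMeasurable) (fun k => hM.mono fun x hx => hx k)
    (ae_of_all _ fun _ => summable_pow_div_factorial M) (integrable_const _)
    (hM.mono fun x hx => (summable_norm_of_le hx).of_norm.hasSum)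

end Exchange

variable {n : ℕ} {θ : ℝ}

/-- The Bessel function at the argument `Y` is represented by the series `∑ β k`. -/
structure Represents (θ C : ℝ) (Y : Fin (n + 1) → ℝ) (β : ℕ → MvPolynomial (Fin (n + 1)) ℝ) : Prop where
  bessel : IsBessel θ Y β
  bound : ∀ a : Fin (n + 1) → ℝ, StrictAnti a → ∀ ρ, (∀ i, |a i| ≤ ρ) →
    ∀ k, |eval a (β k)| ≤ (C * ρ) ^ k / (k.factorial : ℝ)
  nonneg : ∀ a : Fin (n + 1) → ℝ, StrictAnti a → 0 ≤ ∑' k, eval a (β k)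
  eq : ∀ a : Fin (n + 1) → ℝ, StrictAnti a → besselInt a θ Y = ENNReal.ofReal (∑' k, eval a (β k))

theorem Represents.expMul {C : ℝ} {Y : Fin (n + 1) → ℝ}
    {β : ℕ → MvPolynomial (Fin (n + 1)) ℝ} (h : Represents θ C Y β) (c : ℝ) :
    Represents θ ((n + 1) * |c| + C) (fun i => Y i + c) (expMul c β) := by
  have hev : ∀ (a : Fin (n + 1) → ℝ) k, eval a (MBFPieri.expMul c β k)
      = ∑ p ∈ Finset.HasAntidiagonal.antidiagonal k,
        ((c * ∑ i, a i) ^ p.1 / (p.1.factorial : ℝ)) * eval a (β p.2) := by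
    intro a k
    rw [expMul_apply, map_sum]
    refine Finset.sum_congr rfl fun p _ => ?_
    rw [smul_eval, map_mul, map_pow, map_sum]
    simp only [eval_X, mul_pow]
    ring
  have hsum : ∀ a : Fin (n + 1) → ℝ, StrictAnti a → ∑' k, eval a (MBFPieri.expMul c β k)
      = Real.exp (c * ∑ i, a i) * ∑' k, eval a (β k) := by
    intro a ha
    obtain ⟨ρ, -, hρ⟩ := exists_abs_le a
    simp only [hev]
    rw [Real.exp_eq_exp_ℝ, NormedSpace.exp_eq_tsum_div]
    exact (tsum_mul_tsum_eq_tsum_sum_antidiagonal_of_summable_norm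
      (f := fun k : ℕ => (c * ∑ i, a i) ^ k / (k.factorial : ℝ))
      (summable_norm_of_le (M := |c * ∑ i, a i|) fun k => by simp [abs_div, abs_pow])
      (summable_norm_of_le (h.bound a ha ρ hρ))).symm
  refine ⟨h.bessel.expMul c, fun a ha ρ hρ k => ?_, fun a ha => ?_, fun a ha => ?_⟩
  · rw [hev, add_mul]
    refine abs_sum_antidiagonal_le (f := fun k => (c * ∑ i, a i) ^ k / (k.factorial : ℝ))
      (g := fun k => eval a (β k)) (fun k => ?_) (h.bound a ha ρ hρ) k
    rw [abs_div, abs_pow, Nat.abs_cast]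
    gcongr
    rw [abs_mul, mul_comm _ |c|, mul_assoc]
    gcongr
    refine (Finset.abs_sum_le_sum_abs _ _).trans ((Finset.sum_le_sum fun i _ => hρ i).trans ?_)
    simp
  · rw [hsum a ha]
    exact mul_nonneg (Real.exp_pos _).le (h.nonneg a ha)
  · rw [hsum a ha, besselInt_add_const, h.eq a ha, ENNReal.ofReal_mul (Real.exp_pos _).le]

theorem represents_zero (hθ : 0 < θ) :
    Represents θ 0 (fun _ : Fin 1 => 0) (Pi.single 0 1) := by
  have hev : ∀ (a : Fin 1 → ℝ) (k : ℕ),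
      eval a ((Pi.single 0 1 : ℕ → MvPolynomial (Fin 1) ℝ) k) = if k = 0 then 1 else 0 := by
    intro a k
    rw [Pi.single_apply]
    split_ifs <;> simp
  have hsum : ∀ a : Fin 1 → ℝ,
      ∑' k, eval a ((Pi.single 0 1 : ℕ → MvPolynomial (Fin 1) ℝ) k) = 1 := by
    intro a
    simp only [hev]
    exact tsum_ite_eq 0 _
  refine ⟨⟨fun k => ?_, fun k => ?_, by simp, fun r k => ?_⟩, fun a _ ρ _ k => ?_, fun a _ => ?_,
    fun a _ => ?_⟩
  · rw [Pi.single_apply]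
    split_ifs
    · exact IsSymmetric.one
    · exact IsSymmetric.zero
  · rw [Pi.single_apply]
    split_ifs with hk
    · subst hk; exact isHomogeneous_one _ _
    · exact isHomogeneous_zero _ _ _
  · have h0 : eval (fun _ : Fin 1 => (0 : ℝ)) (psum (Fin 1) ℝ (r + 1)) = 0 := by simp [psum]
    rw [h0, zero_smul, Pi.single_apply]
    split_ifs
    · rw [psum, map_sum, LinearMap.sum_apply]
      refine Finset.sum_eq_zero fun i _ => ?_
      rw [pow_succ, dunklHom_mul, dunklHom_X, dunkl_one, map_zero]
    · rw [map_zero]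
  · rw [hev]
    split_ifs with hk
    · subst hk; simp
    · simp [hk]
  · rw [hsum]; exact zero_le_one
  · rw [hsum, besselInt_one hθ, ENNReal.ofReal_one]

theorem Represents.snoc_zero (hθ : 0 < θ) {C : ℝ} {Y : Fin (n + 1) → ℝ}
    {β : ℕ → MvPolynomial (Fin (n + 1)) ℝ} (h : Represents θ C Y β) :
    ∃ β', Represents θ C (Fin.snoc Y 0 : Fin (n + 2) → ℝ) β' := by
  have hW : Measurable (id : (Fin (n + 1) → ℝ) → Fin (n + 1) → ℝ) := measurable_id
  have hR : ∀ (a : Fin (n + 2) → ℝ) ρ, (∀ i, |a i| ≤ ρ) →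
      ∀ᵐ b ∂cornerMeas θ a, ∀ i, |(id b : Fin (n + 1) → ℝ) i| ≤ ρ := fun a ρ hρ =>
    (ae_cornerMeas θ a).mono fun b hb => abs_le_of_mem_cornerBox hρ hb
  have hE : ∀ a : Fin (n + 2) → ℝ, StrictAnti a → ∀ p : MvPolynomial (Fin (n + 1)) ℝ,
      polyExp (cornerMeas θ a) id p = ∫ b, eval b p ∂cornerMeas θ a := by
    intro a ha p
    have := isProbabilityMeasure_cornerMeas hθ ha
    obtain ⟨ρ, -, hρ⟩ := exists_abs_le a
    exact polyExp_apply hW (hR a ρ hρ) p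
  obtain ⟨β', hβ', hev⟩ := exists_bessel_corner hθ h.bessel
    (fun a => polyExp (cornerMeas θ a.1) id)
    (fun a => by
      have := isProbabilityMeasure_cornerMeas hθ a.2
      rw [hE a.1 a.2]; simp)
    (fun a => cornerAt_cornerMeas hθ a.2)
  have hev' : ∀ a : Fin (n + 2) → ℝ, StrictAnti a → ∀ k,
      eval a (β' k) = ∫ b, eval b (β k) ∂cornerMeas θ a := fun a ha k => by
    rw [hev ⟨a, ha⟩ k, hE a ha]
  have hsa : ∀ a : Fin (n + 2) → ℝ, StrictAnti a → ∀ᵐ b ∂cornerMeas θ a, StrictAnti b :=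
    fun a ha => (ae_cornerMeas θ a).mono fun b hb => strictAnti_of_interlaces ha.antitone hb
  have hbd : ∀ (a : Fin (n + 2) → ℝ), StrictAnti a → ∀ ρ, (∀ i, |a i| ≤ ρ) →
      ∀ᵐ b ∂cornerMeas θ a, ∀ k, |eval b (β k)| ≤ (C * ρ) ^ k / (k.factorial : ℝ) := by
    intro a ha ρ hρ
    filter_upwards [hsa a ha, hR a ρ hρ] with b hb hb' k
    exact h.bound b hb ρ hb' k
  have hms : ∀ k, Measurable fun b : Fin (n + 1) → ℝ => eval b (β k) :=
    fun k => measurable_eval_comp measurable_id _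
  have hsum : ∀ a : Fin (n + 2) → ℝ, StrictAnti a →
      ∑' k, eval a (β' k) = ∫ b, ∑' k, eval b (β k) ∂cornerMeas θ a := by
    intro a ha
    have := isProbabilityMeasure_cornerMeas hθ ha
    obtain ⟨ρ, -, hρ⟩ := exists_abs_le a
    simp only [hev' a ha]
    exact (hasSum_integral_of_le hms (hbd a ha ρ hρ)).tsum_eq
  refine ⟨β', hβ', fun a ha ρ hρ k => ?_, fun a ha => ?_, fun a ha => ?_⟩
  · have := isProbabilityMeasure_cornerMeas hθ ha
    rw [hev' a ha]
    have := norm_integral_le_of_norm_le_const (μ := cornerMeas θ a)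
      (f := fun b => eval b (β k)) ((hbd a ha ρ hρ).mono fun b hb => hb k)
    simpa using this
  · rw [hsum a ha]
    exact integral_nonneg_of_ae ((hsa a ha).mono fun b hb => h.nonneg b hb)
  · have := isProbabilityMeasure_cornerMeas hθ ha
    obtain ⟨ρ, -, hρ⟩ := exists_abs_le a
    rw [hsum a ha, besselInt_snoc_zero hθ ha,
      ofReal_integral_eq_lintegral_ofReal (integrable_tsum_of_le hms (hbd a ha ρ hρ))
        ((hsa a ha).mono fun b hb => h.nonneg b hb)]
    exact lintegral_congr_ae ((hsa a ha).mono fun b hb => h.eq b hb)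

theorem exists_represents (hθ : 0 < θ) (n : ℕ) : ∃ c : ℝ, 0 ≤ c ∧
    ∀ (R : ℝ) (Y : Fin (n + 1) → ℝ), (∀ i, |Y i| ≤ R) → ∃ β C, 0 ≤ C ∧ C ≤ c * R ∧ Represents θ C Y β := by
  induction n with
  | zero =>
    refine ⟨1, zero_le_one, fun R Y hY => ⟨expMul (Y 0) (Pi.single 0 1), |Y 0|, abs_nonneg _, ?_, ?_⟩⟩
    · simpa using hY 0
    · have := (represents_zero hθ).expMul (Y 0)
      convert this using 1
      · simp
      · funext i; rw [show i = 0 from Subsingleton.elim (α := Fin 1) i 0]; exact (zero_add (Y 0)).symm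
  | succ n ih =>
    obtain ⟨c, hc, ih⟩ := ih
    refine ⟨2 * c + (n + 2), by positivity, fun R Y hY => ?_⟩
    obtain ⟨β, C, hC0, hC, h⟩ := ih (2 * R) (fun i => Y i.castSucc - Y (Fin.last _)) (fun i => by
      have h1 := abs_le.1 (hY i.castSucc)
      have h2 := abs_le.1 (hY (Fin.last _))
      exact abs_le.2 ⟨by linarith, by linarith⟩)
    obtain ⟨β', h'⟩ := h.snoc_zero hθ
    refine ⟨_, _, ?_, ?_, (?_ : Represents θ (((n + 1 : ℕ) + 1) * |Y (Fin.last _)| + C) Y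
      (expMul (Y (Fin.last _)) β'))⟩
    · positivity
    · have := hY (Fin.last _)
      have : ((n : ℝ) + 2) * |Y (Fin.last _)| ≤ (n + 2) * R := by gcongr
      push_cast
      linarith
    · convert h'.expMul (Y (Fin.last _)) using 1
      funext i
      refine Fin.lastCases ?_ (fun i => ?_) i
      · simp
      · simp

end MBFPieri

namespace MBFPieri

open MvPolynomial

variable {θ : ℝ}

/-- The series of the Bessel function with spectral parameter `a`. -/
theorem exists_series (hθ : 0 < θ) {N : ℕ} (hN : 0 < N) {a : Fin N → ℝ} (ha : StrictAnti a) :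
    ∃ γ, IsBessel θ a γ ∧ ∃ M : ℝ, ∀ R (Y : Fin N → ℝ), (∀ i, |Y i| ≤ R) →
      (∀ k, |eval Y (γ k)| ≤ (M * R) ^ k / (k.factorial : ℝ)) ∧
      MBF θ a (fun i => (Y i : ℂ)) = ((∑' k, eval Y (γ k) : ℝ) : ℂ) := by
  obtain ⟨n, rfl⟩ : ∃ n, N = n + 1 := ⟨N - 1, by omega⟩
  obtain ⟨c, hc, hrep⟩ := exists_represents hθ n
  obtain ⟨ρ, hρ0, hρ⟩ := exists_abs_le a
  obtain ⟨γ, _, _, _, hγ⟩ := hrep ρ a hρ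
  refine ⟨γ, hγ.bessel, c * ρ, fun R Y hY => ?_⟩
  obtain ⟨β, C, hC0, hC, hβ⟩ := hrep R Y hY
  have hcomm : ∀ k, eval Y (γ k) = eval a (β k) := fun k => hγ.bessel.eval_comm hβ.bessel k
  refine ⟨fun k => ?_, ?_⟩
  · rw [hcomm]
    refine (hβ.bound a ha ρ hρ k).trans ?_
    rw [mul_right_comm]
    gcongr
  · rw [MBF_ofReal a hθ Y, hβ.eq a ha, ENNReal.toReal_ofReal (hβ.nonneg a ha)]
    simp only [hcomm]

/-- Padding of a tuple by zeros. -/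
def zpad {k : ℕ} (l : ℕ) (Y : Fin k → ℝ) : Fin (k + l) → ℝ := Fin.append Y fun _ => 0

theorem chi_zpad {k : ℕ} (l : ℕ) (Y : Fin k → ℝ) : chi (zpad l Y) = chi Y * Polynomial.X ^ l := by
  rw [chi, chi, Fin.prod_univ_add]
  simp [zpad]

theorem abs_zpad_le {k l : ℕ} {Y : Fin k → ℝ} {R : ℝ} (hR : 0 ≤ R) (h : ∀ i, |Y i| ≤ R)
    (i : Fin (k + l)) : |zpad l Y i| ≤ R := by
  refine Fin.addCases (fun i => ?_) (fun i => ?_) i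
  · simpa [zpad] using h i
  · simpa [zpad] using hR

theorem measurable_zpad {Ω : Type*} [MeasurableSpace Ω] {k l : ℕ} {Y : Ω → Fin k → ℝ}
    (h : Measurable Y) : Measurable fun x => zpad l (Y x) := by
  refine measurable_pi_iff.2 fun i => ?_
  refine Fin.addCases (fun i => ?_) (fun i => ?_) i
  · simp only [zpad, Fin.append_left]
    exact (measurable_pi_apply i).comp h
  · simp [zpad]

section Pieri

variable {n : ℕ} {ys : Fin n → ℝ} {y : ℝ}

theorem isCofactor_zpad (l : ℕ) (ys : Fin n → ℝ) :
    IsCofactor (chi (zpad l (pieriEta ys))) (fun i => chiC (pieriEta ys) i * Polynomial.X ^ l)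
      (pieriEta ys) (Fin.snoc (fun _ => 1) (l + 1)) where
  mul i := by rw [← mul_assoc, (isCofactor_chi (pieriEta ys)).mul, chi_zpad]
  der := by
    have h0 := (isCofactor_chi (pieriEta ys)).mul (Fin.last n)
    rw [pieriEta_last, Polynomial.C_0, sub_zero] at h0
    rw [chi_zpad, Polynomial.derivative_mul, (isCofactor_chi (pieriEta ys)).der,
      Fin.sum_univ_castSucc, Fin.sum_univ_castSucc]
    simp only [one_smul, Fin.snoc_castSucc, Fin.snoc_last]
    rw [← h0, add_mul, Finset.sum_mul]
    cases l with
    | zero => simp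
    | succ l =>
      rw [Polynomial.derivative_X_pow, Polynomial.smul_eq_C_mul]
      simp only [Nat.add_sub_cancel, Polynomial.C_add, Polynomial.C_1]
      ring

theorem PieriData.abs_pieriPt_le (h : PieriData ys y) {ρ : ℝ} (hρ0 : 0 ≤ ρ) (hρ : ∀ i, |ys i| ≤ ρ)
    {z : Fin n → ℝ} (hz : z ∈ simp0 n y) (i : Fin (n + 1)) : |pieriPt ys y z i| ≤ ρ + y := by
  have hs : 0 ≤ ∑ i, z i := Finset.sum_nonneg fun i _ => (hz.1 i).le
  have hy := h.pos
  refine Fin.lastCases ?_ (fun i => ?_) i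
  · rw [pieriPt_last, abs_le]
    constructor <;> linarith [hz.2]
  · have h1 : z i < y := (Finset.single_le_sum (f := z) (fun i _ => (hz.1 i).le)
      (Finset.mem_univ i)).trans_lt hz.2
    rw [pieriPt_castSucc]
    refine (abs_add_le _ _).trans (add_le_add (hρ i) ?_)
    rw [abs_of_pos (hz.1 i)]; exact h1.le

theorem PieriData.abs_pieriW_le (h : PieriData ys y) {z : Fin n → ℝ} (hz : z ∈ simp0 n y)
    (i : Fin (n + 1)) : |pieriW ys y z i| ≤ 1 := by
  rw [abs_of_pos (h.pieriW_pos hz i), ← h.sum_pieriW z]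
  exact Finset.single_le_sum (fun i _ => (h.pieriW_pos hz i).le) (Finset.mem_univ i)

theorem ae_pieriMeas (θ κ : ℝ) (ys : Fin n → ℝ) (y : ℝ) :
    ∀ᵐ z ∂pieriMeas θ κ ys y, z ∈ simp0 n y := ae_densOn (measurableSet_simp0 n y)

theorem pieriT_eq (θ : ℝ) (l : ℕ) : pieriT n θ ((l : ℝ) + 1)
    = fun i => (Fin.snoc (fun _ => 1) ((l : ℝ) + 1) : Fin (n + 1) → ℝ) i * θ := by
  funext i
  refine Fin.lastCases ?_ (fun i => ?_) i <;> simp [pieriT]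

theorem sum_pieriT (θ : ℝ) (l : ℕ) :
    ∑ i, pieriT n θ ((l : ℝ) + 1) i = (n + 1 + l : ℕ) * θ := by
  rw [Fin.sum_univ_castSucc]
  simp only [pieriT, Fin.snoc_castSucc, Fin.snoc_last, Finset.sum_const, Finset.card_univ,
    Fintype.card_fin, nsmul_eq_mul]
  push_cast
  ring

theorem IsBessel.pieri (hθ : 0 < θ) (h : PieriData ys y) {l : ℕ} {a : Fin (n + 1 + l) → ℝ}
    {γ : ℕ → MvPolynomial (Fin (n + 1 + l)) ℝ} (hγ : IsBessel θ a γ) (i₀ : Fin (n + 1 + l)) (k : ℕ) :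
    ∫ z, eval (zpad l (pieriPt ys y z)) (γ k) ∂pieriMeas θ ((l : ℝ) + 1) ys y
      = ∑ p ∈ Finset.HasAntidiagonal.antidiagonal k,
        eval (Pi.single i₀ y) (γ p.1) * eval (zpad l (pieriEta ys)) (γ p.2) := by
  have hκ : 0 < (l : ℝ) + 1 := by positivity
  have := h.isProbabilityMeasure hθ hκ
  obtain ⟨ρ, hρ0, hρ⟩ := exists_abs_le ys
  have hm := measurable_zpad (l := l) (measurable_pieriPt ys y)
  have hm' := measurable_pieriW ys y
  have hae : ∀ᵐ z ∂pieriMeas θ ((l : ℝ) + 1) ys y, ∀ i, |zpad l (pieriPt ys y z) i| ≤ ρ + y :=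
    (ae_pieriMeas θ _ ys y).mono fun z hz i =>
      abs_zpad_le (add_nonneg hρ0 h.pos.le) (h.abs_pieriPt_le hρ0 hρ hz) i
  have hae' : ∀ᵐ z ∂pieriMeas θ ((l : ℝ) + 1) ys y, ∀ i, |pieriW ys y z i| ≤ 1 :=
    (ae_pieriMeas θ _ ys y).mono fun z hz => h.abs_pieriW_le hz
  rw [← polyExp_apply hm hae]
  have hdir := h.isDirichlet hθ hκ
  rw [sum_pieriT, pieriT_eq] at hdir
  refine hγ.expectation hθ i₀ (zpad l (pieriEta ys)) (isCofactor_zpad l ys) y _ _ hdir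
    (fun K ζ => ?_) k
  rw [polyExp_apply hm hae, polyExp_apply hm' hae']
  refine integral_congr_ae (ae_of_all _ fun z => ?_)
  simp only [eval_phi, map_prod, map_sub, map_mul, map_sum, eval_C, eval_X, chi_zpad,
    Polynomial.eval_mul]
  refine Finset.prod_congr rfl fun k _ => ?_
  rw [chi_eq_sub_pieriV h.strictAnti h.pos.ne' (pieriPt ys y z)]
  simp only [Polynomial.eval_sub, Polynomial.eval_mul, Polynomial.eval_C, Polynomial.eval_finsetSum,
    pieriW]
  rw [sub_mul, mul_assoc y, Finset.sum_mul]
  congr 2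
  refine Finset.sum_congr rfl fun i _ => ?_
  ring

theorem eval_neg_of_isHomogeneous {σ : Type*} [Fintype σ] [DecidableEq σ] {p : MvPolynomial σ ℝ}
    {k : ℕ} (hp : p.IsHomogeneous k) (Y : σ → ℝ) :
    eval (fun i => -Y i) p = (-1) ^ k * eval Y p := by
  have := congrArg (eval Y) (scale_of_isHomogeneous (-1) hp)
  rw [eval_scale, smul_eval] at this
  simpa using this

/-- The Pieri formula for the series. -/
theorem IsBessel.integral_tsum (hθ : 0 < θ) (h : PieriData ys y) {l : ℕ} {a : Fin (n + 1 + l) → ℝ}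
    {γ : ℕ → MvPolynomial (Fin (n + 1 + l)) ℝ} (hγ : IsBessel θ a γ) {M : ℝ}
    (hM : ∀ R (Y : Fin (n + 1 + l) → ℝ), (∀ i, |Y i| ≤ R) →
      ∀ k, |eval Y (γ k)| ≤ (M * R) ^ k / (k.factorial : ℝ)) (i₀ : Fin (n + 1 + l)) :
    ∫ z, ∑' k, eval (fun i => -zpad l (pieriPt ys y z) i) (γ k) ∂pieriMeas θ ((l : ℝ) + 1) ys y
      = (∑' k, eval (fun i => -zpad l (pieriEta ys) i) (γ k)) *
        ∑' k, eval (fun i => -(Pi.single i₀ y : Fin (n + 1 + l) → ℝ) i) (γ k) := by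
  have hκ : 0 < (l : ℝ) + 1 := by positivity
  have := h.isProbabilityMeasure hθ hκ
  obtain ⟨ρ, hρ0, hρ⟩ := exists_abs_le ys
  have hm := measurable_zpad (l := l) (measurable_pieriPt ys y)
  have hae : ∀ᵐ z ∂pieriMeas θ ((l : ℝ) + 1) ys y, ∀ k,
      |eval (fun i => -zpad l (pieriPt ys y z) i) (γ k)| ≤ (M * (ρ + y)) ^ k / (k.factorial : ℝ) :=
    (ae_pieriMeas θ _ ys y).mono fun z hz => hM _ _ fun i => by
      rw [abs_neg]
      exact abs_zpad_le (add_nonneg hρ0 h.pos.le) (h.abs_pieriPt_le hρ0 hρ hz) i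
  have hsum : ∀ Y : Fin (n + 1 + l) → ℝ, Summable fun k => ‖eval Y (γ k)‖ := by
    intro Y
    obtain ⟨R, -, hR⟩ := exists_abs_le Y
    exact summable_norm_of_le (hM R Y hR)
  rw [← (hasSum_integral_of_le (f := fun k z => eval (fun i => -zpad l (pieriPt ys y z) i) (γ k))
      (fun k => measurable_eval_comp hm.neg (γ k)) hae).tsum_eq, mul_comm,
    tsum_mul_tsum_eq_tsum_sum_antidiagonal_of_summable_norm (hsum _) (hsum _)]
  refine tsum_congr fun k => ?_
  simp only [eval_neg_of_isHomogeneous (hγ.homog _)]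
  rw [integral_const_mul, hγ.pieri hθ h i₀, Finset.mul_sum]
  refine Finset.sum_congr rfl fun p hp => ?_
  rw [Finset.HasAntidiagonal.mem_antidiagonal] at hp
  rw [← hp, pow_add]
  ring

end Pieri

end MBFPieri

namespace MBFPieri

open MvPolynomial

variable {n : ℕ} {ys z : Fin n → ℝ} {y : ℝ}

theorem prod_prod_eq_pairProd (h : Fin n → Fin n → ℝ) :
    ∏ i, ∏ j, h i j = pairProd n h * pairProd n (fun i j => h j i) * ∏ i, h i i := by
  have e : ∀ i j, h i j = (if i < j then h i j else 1) * (if j < i then h i j else 1) *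
      (if i = j then h i j else 1) := by
    intro i j
    rcases lt_trichotomy i j with hij | hij | hij
    · simp [hij, hij.not_gt, hij.ne]
    · simp [hij]
    · simp [hij, hij.not_gt, hij.ne']
  calc ∏ i, ∏ j, h i j = ∏ i, ∏ j, (if i < j then h i j else 1) * (if j < i then h i j else 1) *
      (if i = j then h i j else 1) :=
        Finset.prod_congr rfl fun i _ => Finset.prod_congr rfl fun j _ => e i j
    _ = _ := by
      simp only [Finset.prod_mul_distrib, Finset.prod_ite_eq, Finset.mem_univ, if_true, pairProd]
      congr 2
      exact Finset.prod_comm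

theorem Yext_castSucc (i : Fin n) : Yext ys y z i.castSucc = ys i := by simp [Yext]

theorem Yext_last : Yext ys y z (Fin.last n) = y - ∑ i, z i := by simp [Yext]

theorem Zext_castSucc (i : Fin n) : Zext z i.castSucc = z i := by simp [Zext]

theorem Zext_last : Zext z (Fin.last n) = 0 := by simp [Zext]

theorem pieriPt_eq (ys : Fin n → ℝ) (y : ℝ) (z : Fin n → ℝ) (i : Fin (n + 1)) :
    pieriPt ys y z i = Yext ys y z i + Zext z i := by
  refine Fin.lastCases ?_ (fun i => ?_) i
  · simp [Yext_last, Zext_last]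
  · simp [Yext_castSucc, Zext_castSucc]

theorem PieriData.pieriW_last (h : PieriData ys y) (hz : z ∈ simp0 n y) :
    pieriW ys y z (Fin.last n) = Ffn ys y z := by
  have hy := h.pos.ne'
  have h0 : ∀ i, ys i ≠ 0 := fun i => (h.pos.trans (h.low i)).ne'
  rw [← abs_of_pos (h.pieriW_pos hz _), abs_pieriW h.pos, Ffn, Fin.prod_univ_castSucc, eval_chiC,
    Finset.abs_prod]
  simp only [pieriEta_last, pieriEta_castSucc, Fin.succAbove_last, pieriPt_castSucc, pieriPt_last,
    zero_sub, abs_neg]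
  rw [mul_comm, mul_div_mul_comm, ← Finset.prod_div_distrib, abs_of_pos (sub_pos.2 hz.2), sub_div,
    div_self hy]
  congr 1
  refine Finset.prod_congr rfl fun i _ => ?_
  have hi := h.pos.trans (h.low i)
  rw [abs_of_pos (add_pos hi (hz.1 i)), abs_of_pos hi, add_div, div_self (h0 i)]

theorem PieriData.Gfn_eq (h : PieriData ys y) (hz : z ∈ simp0 n y) (θ : ℝ) :
    Gfn θ ys y z * ∏ i, z i ^ (θ - 1) =
      (pairProd (n + 1) fun i j => |pieriPt ys y z i - pieriPt ys y z j|) *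
        (∏ i, ∏ j, |ys i - pieriPt ys y z j|) ^ (θ - 1) := by
  have hη := h.strictAnti
  have hup := h.upInt hz
  have hW := hup.strictAnti hη
  have hlt : ∀ i j : Fin n, i < j → pieriPt ys y z j.castSucc < ys i := fun i j hij => by
    simpa using hup.lt_of_lt hη (Fin.castSucc_lt_castSucc_iff.2 hij)
  have hlast : ∀ i : Fin n, pieriPt ys y z (Fin.last n) < ys i := fun i => by
    simpa using hup.lt_of_lt hη (Fin.castSucc_lt_last i)
  have hgt : ∀ i j : Fin n, i ≤ j → ys j < pieriPt ys y z i.castSucc := fun i j hij => by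
    simpa using (hη.antitone (Fin.castSucc_le_castSucc_iff.2 hij)).trans_lt (hup.1 i.castSucc)
  have e1 : pairProd (n + 1) (fun i j => |pieriPt ys y z i - pieriPt ys y z j|) =
      pairProd (n + 1) fun i j => Yext ys y z i - Yext ys y z j + Zext z i - Zext z j := by
    refine pairProd_congr fun i j hij => ?_
    rw [abs_of_pos (sub_pos.2 (hW hij)), pieriPt_eq, pieriPt_eq]
    ring
  have e2 : (∏ i, ∏ j, |ys i - pieriPt ys y z j|) ^ (θ - 1) =
      ∏ i, ∏ j, |ys i - pieriPt ys y z j| ^ (θ - 1) := by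
    rw [← Real.finsetProd_rpow _ _ fun i _ => Finset.prod_nonneg fun j _ => abs_nonneg _]
    exact Finset.prod_congr rfl fun i _ => (Real.finsetProd_rpow _ _ (fun j _ => abs_nonneg _) _).symm
  have e3 : Gfn θ ys y z = pairProd n (fun i j => (ys i - ys j + z i) ^ (θ - 1)) *
      pairProd (n + 1) fun i j => (Yext ys y z i - Yext ys y z j + Zext z i - Zext z j) *
        (Yext ys y z i - Yext ys y z j - Zext z j) ^ (θ - 1) := rfl
  rw [e1, e2, e3, pairProd_mul, pairProd_succ fun i j => (Yext ys y z i - _ - _) ^ (θ - 1)]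
  simp only [Fin.prod_univ_castSucc (n := n), Finset.prod_mul_distrib]
  rw [prod_prod_eq_pairProd]
  have f1 : pairProd n (fun i j => (ys i - ys j + z i) ^ (θ - 1)) =
      pairProd n fun i j => |ys j - pieriPt ys y z i.castSucc| ^ (θ - 1) := by
    refine pairProd_congr fun i j hij => ?_
    rw [abs_of_neg (sub_neg.2 (hgt i j hij.le)), pieriPt_castSucc]
    ring_nf
  have f2 : pairProd n (fun i j => (Yext ys y z i.castSucc - Yext ys y z j.castSucc -
      Zext z j.castSucc) ^ (θ - 1)) =
      pairProd n fun i j => |ys i - pieriPt ys y z j.castSucc| ^ (θ - 1) := by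
    refine pairProd_congr fun i j hij => ?_
    rw [abs_of_pos (sub_pos.2 (hlt i j hij)), pieriPt_castSucc, Yext_castSucc, Yext_castSucc,
      Zext_castSucc, sub_sub]
  have f3 : ∏ i : Fin n, (Yext ys y z i.castSucc - Yext ys y z (Fin.last n) -
      Zext z (Fin.last n)) ^ (θ - 1) = ∏ i, |ys i - pieriPt ys y z (Fin.last n)| ^ (θ - 1) := by
    refine Finset.prod_congr rfl fun i _ => ?_
    rw [abs_of_pos (sub_pos.2 (hlast i)), pieriPt_last, Yext_castSucc, Yext_last, Zext_last,
      sub_zero]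
  have f4 : ∏ i : Fin n, z i ^ (θ - 1) = ∏ i, |ys i - pieriPt ys y z i.castSucc| ^ (θ - 1) := by
    refine Finset.prod_congr rfl fun i _ => ?_
    rw [abs_of_neg (sub_neg.2 (hgt i i le_rfl)), pieriPt_castSucc]
    ring_nf
  rw [f1, f2, f3, f4]
  ring

theorem PieriData.pieriDens_eq_Gfn (h : PieriData ys y) (hz : z ∈ simp0 n y) (θ κ : ℝ) :
    pieriDens θ κ ys y z = Real.Gamma ((n + κ) * θ) / (Real.Gamma (κ * θ) * Real.Gamma θ ^ n) *
      ((∏ i, ∏ j, if i < j then (ys i - ys j) ^ (1 - 2 * θ) else 1) /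
        (y ^ (n * θ) * ∏ i, ys i ^ θ)) *
      (Gfn θ ys y z * Ffn ys y z ^ (κ * θ - 1) * ∏ i, z i ^ (θ - 1)) := by
  rw [mul_right_comm (Gfn θ ys y z), h.Gfn_eq hz, ← h.pieriW_last hz, pieriDens,
    Real.finsetProd_rpow _ _ fun i _ => (h.pos.trans (h.low i)).le,
    ← pairProd_rpow fun _ _ _ => abs_nonneg _]
  have e : pairProd n (fun i j => |ys i - ys j| ^ (1 - 2 * θ)) =
      ∏ i, ∏ j, if i < j then (ys i - ys j) ^ (1 - 2 * θ) else 1 :=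
    pairProd_congr fun i j hij => by rw [abs_of_pos (sub_pos.2 (h.strictAnti_ys hij))]
  rw [e]
  ring

theorem pieriData_of_adjacent (hn : 1 ≤ n) (hy : 0 < y) (hord : StrictAnti ys)
    (hlast : y < ys ⟨n - 1, by omega⟩)
    (hgap : ∀ i : ℕ, ∀ h1 : i + 1 < n, y < ys ⟨i, by omega⟩ - ys ⟨i + 1, h1⟩) :
    PieriData ys y where
  pos := hy
  gap i j hij := by
    have h1 : i.1 + 1 < n := by omega
    have h2 := hgap i.1 h1
    have h3 : ys j ≤ ys ⟨i.1 + 1, h1⟩ := hord.antitone (Fin.le_def.2 hij)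
    simp only [Fin.eta] at h2
    linarith
  low i := hlast.trans_le (hord.antitone (Fin.le_def.2 (by simp only; omega)))

theorem ae_ne_of_linear {f : (Fin n → ℝ) →ₗ[ℝ] ℝ} (hf : f ≠ 0) (c : ℝ) : ∀ᵐ z, f z ≠ c := by
  obtain ⟨x, hx⟩ := f.surjective hf c
  have hk : LinearMap.ker f ≠ ⊤ := fun h => hf (LinearMap.ker_eq_top.1 h)
  have h0 := Measure.addHaar_submodule (volume : Measure (Fin n → ℝ)) (LinearMap.ker f) hk
  rw [← measure_preimage_add_right _ (-x)] at h0
  refine measure_mono_null (fun z hz => ?_) h0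
  have hz' : f z = c := not_not.1 hz
  simp [hz', hx]

/-- The closed simplex agrees with the open one up to a null set. -/
theorem simplex_ae_eq_simp0 (hn : 1 ≤ n) (y : ℝ) :
    {z : Fin n → ℝ | (∀ i, 0 ≤ z i) ∧ ∑ i, z i ≤ y} =ᵐ[volume] simp0 n y := by
  have h1 : ∀ᵐ z : Fin n → ℝ, ∀ i, z i ≠ 0 := ae_all_iff.2 fun i =>
    ae_ne_of_linear (f := LinearMap.proj i) (fun h => by
      simpa using LinearMap.congr_fun h (Pi.single i 1)) 0
  have h2 : ∀ᵐ z : Fin n → ℝ, ∑ i, z i ≠ y := by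
    have := ae_ne_of_linear (f := ∑ i : Fin n, LinearMap.proj (R := ℝ) (φ := fun _ => ℝ) i)
      (fun h => by simpa using LinearMap.congr_fun h (Pi.single ⟨0, hn⟩ 1)) y
    simpa using this
  filter_upwards [h1, h2] with z hz1 hz2
  refine propext ⟨fun h => ⟨fun i => lt_of_le_of_ne (h.1 i) (hz1 i).symm, lt_of_le_of_ne h.2 hz2⟩,
    fun h => ⟨fun i => (h.1 i).le, h.2.le⟩⟩

theorem PieriData.integral_pieriMeas (h : PieriData ys y) (hn : 1 ≤ n) {θ κ : ℝ} (hθ : 0 < θ)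
    (hκ : 0 < κ) (g : (Fin n → ℝ) → ℝ) :
    ∫ z, g z ∂pieriMeas θ κ ys y =
      Real.Gamma ((n + κ) * θ) / (Real.Gamma (κ * θ) * Real.Gamma θ ^ n) *
      ((∏ i, ∏ j, if i < j then (ys i - ys j) ^ (1 - 2 * θ) else 1) /
        (y ^ (n * θ) * ∏ i, ys i ^ θ)) *
      ∫ z in {z : Fin n → ℝ | (∀ i, 0 ≤ z i) ∧ ∑ i, z i ≤ y},
        Gfn θ ys y z * Ffn ys y z ^ (κ * θ - 1) * (∏ i, z i ^ (θ - 1)) * g z := by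
  rw [setIntegral_congr_set (simplex_ae_eq_simp0 hn y), pieriMeas, densOn,
    integral_withDensity_eq_integral_toReal_smul (measurable_pieriDens θ κ ys y).ennreal_ofReal
      (ae_of_all _ fun _ => ENNReal.ofReal_lt_top), ← integral_const_mul]
  refine setIntegral_congr_fun (measurableSet_simp0 n y) fun z hz => ?_
  simp only [smul_eq_mul]
  rw [ENNReal.toReal_ofReal (h.pieriDens_nonneg hθ hκ hz), h.pieriDens_eq_Gfn hz, mul_assoc]

theorem padC_eq_neg_zpad {k l : ℕ} (hk : k ≤ k + l) (Y : Fin k → ℝ) :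
    padC hk (fun i => ((-Y i : ℝ) : ℂ)) = fun i => ((-zpad l Y i : ℝ) : ℂ) := by
  funext i
  refine Fin.addCases (fun i => ?_) (fun i => ?_) i <;> simp [padC, zpad]

theorem padC_eq_neg_zpad_pieriEta {l : ℕ} (hk : n ≤ n + 1 + l) (ys : Fin n → ℝ) :
    padC hk (fun i => ((-ys i : ℝ) : ℂ)) = fun i => ((-zpad l (pieriEta ys) i : ℝ) : ℂ) := by
  funext i
  refine Fin.addCases (fun i => ?_) (fun i => ?_) i
  · refine Fin.lastCases ?_ (fun i => ?_) i <;> simp [padC, zpad]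
  · have : ¬n + 1 + i.1 < n := by omega
    simp [padC, zpad, this]

theorem padC_one_eq_neg_single {N : ℕ} (hN : 1 ≤ N) (y : ℝ) :
    padC hN (fun _ : Fin 1 => ((-y : ℝ) : ℂ)) =
      fun i => ((-(Pi.single ⟨0, hN⟩ y : Fin N → ℝ) i : ℝ) : ℂ) := by
  funext i
  rcases eq_or_ne i ⟨0, hN⟩ with rfl | hi
  · simp [padC]
  · have : i.1 ≠ 0 := fun h => hi (Fin.ext h)
    simp [padC, hi, this]

end MBFPieri

/-- (Theorem 5.3, Pieri-type integral formula)
`𝓑_a(-y₁,…,-y_m;N;θ) 𝓑_a(-y;N;θ)` equals an integral over the simplex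
`V_y = {z ≥ 0, ∑ z_i ≤ y}` of `G·F^{θ(N-m)-1}·𝓑_a(-(y+z), -y+∑z; N; θ) ∏ z_i^{θ-1}`. -/
theorem mbf_pieri_formula
    (θ : ℝ) (hθ : 0 < θ) (m N : ℕ) (hm : 1 ≤ m) (hmN : m ≤ N - 1) (hN : 1 ≤ N)
    (a : Fin N → ℝ) (ha : StrictAnti a)
    (ys : Fin m → ℝ) (y : ℝ) (hy : 0 < y)
    (hord : StrictAnti ys) (hlast : y < ys ⟨m - 1, by omega⟩)
    (hgap : ∀ i : ℕ, ∀ h1 : i + 1 < m, y < ys ⟨i, by omega⟩ - ys ⟨i + 1, h1⟩) :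
    MBF θ a (padC (by omega : m ≤ N) fun i => ((-ys i : ℝ) : ℂ)) *
        MBF θ a (padC (by omega : 1 ≤ N) fun _ : Fin 1 => ((-y : ℝ) : ℂ)) =
      (((Real.Gamma (N * θ) /
            (Real.Gamma ((N - m : ℕ) * θ) * Real.Gamma θ ^ m)) : ℝ) : ℂ) *
        ((((∏ i : Fin m, ∏ j : Fin m,
              if i < j then (ys i - ys j) ^ (1 - 2 * θ) else 1) /
            (y ^ (m * θ) * ∏ i, ys i ^ θ)) : ℝ) : ℂ) *
        ∫ z in {z : Fin m → ℝ | (∀ i, 0 ≤ z i) ∧ ∑ i, z i ≤ y},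
          (((Gfn θ ys y z * Ffn ys y z ^ (θ * ((N : ℝ) - m) - 1) *
              ∏ i, z i ^ (θ - 1)) : ℝ) : ℂ) *
            MBF θ a (padC (by omega : m + 1 ≤ N)
              fun j : Fin (m + 1) =>
                if h : j.1 < m then ((-(ys ⟨j.1, h⟩ + z ⟨j.1, h⟩) : ℝ) : ℂ)
                else ((-y + ∑ i, z i : ℝ) : ℂ)) := by
  obtain ⟨l, rfl⟩ : ∃ l, N = m + 1 + l := ⟨N - (m + 1), by omega⟩
  have h := MBFPieri.pieriData_of_adjacent hm hy hord hlast hgap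
  obtain ⟨γ, hγ, M, hM⟩ := MBFPieri.exists_series hθ hN ha
  have hMBF : ∀ Y : Fin (m + 1 + l) → ℝ, MBF θ a (fun i => (Y i : ℂ)) =
      ((∑' k, MvPolynomial.eval Y (γ k) : ℝ) : ℂ) := fun Y => by
    obtain ⟨R, -, hR⟩ := MBFPieri.exists_abs_le Y
    exact (hM R Y hR).2
  have hpt : ∀ z : Fin m → ℝ, (fun j : Fin (m + 1) =>
      if h : j.1 < m then ((-(ys ⟨j.1, h⟩ + z ⟨j.1, h⟩) : ℝ) : ℂ)
        else ((-y + ∑ i, z i : ℝ) : ℂ)) =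
      fun j => ((-MBFPieri.pieriPt ys y z j : ℝ) : ℂ) := fun z => by
    funext j
    refine Fin.lastCases ?_ (fun j => ?_) j
    · simp [neg_add_eq_sub]
    · simp
  have hκ : 0 < (l : ℝ) + 1 := by positivity
  have key := hγ.integral_tsum hθ h (fun R Y hY => (hM R Y hY).1) ⟨0, hN⟩
  rw [h.integral_pieriMeas hm hθ hκ] at key
  simp only [hpt, MBFPieri.padC_eq_neg_zpad, MBFPieri.padC_eq_neg_zpad_pieriEta,
    MBFPieri.padC_one_eq_neg_single, hMBF, ← Complex.ofReal_mul, integral_complex_ofReal]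
  rw [← key]
  have e1 : ((m + 1 + l : ℕ) : ℝ) * θ = (m + ((l : ℝ) + 1)) * θ := by push_cast; ring
  have e2 : ((m + 1 + l - m : ℕ) : ℝ) = (l : ℝ) + 1 := by
    rw [show m + 1 + l - m = l + 1 by omega]; push_cast; ring
  have e3 : θ * (((m + 1 + l : ℕ) : ℝ) - m) - 1 = ((l : ℝ) + 1) * θ - 1 := by push_cast; ring
  rw [e1, e2, e3]

end
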